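/- arXiv:1806.02100 — 5 statements merged into one kernel-verified Lean document; each statement's English description precedes it below -/
import Mathlib

section
/- Every surjective isometry of the Gromov–Hausdorff space onto itself is the identity map; that is, every isometric equivalence f : GHSpace ≃ᵢ GHSpace equals the identity. -/
namespace GHIsometry

open GromovHausdorff Metric Set Filter Topology

/-- `R` is a correspondence between `X` and `Y` whose distortion is at most `D`. -/
structure IsCorr {X Y : Type*} [MetricSpace X] [MetricSpace Y] (R : X → Y → Prop) (D : ℝ) :
    Prop where
  left : ∀ x, ∃ y, R x y
  right : ∀ y, ∃ x, R x y
  dist_le : ∀ {x y x' y'}, R x y → R x' y' → |dist x x' - dist y y'| ≤ D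

theorem IsCorr.two_mul_ghDist_le {X Y : Type*} [MetricSpace X] [CompactSpace X] [Nonempty X]
    [MetricSpace Y] [CompactSpace Y] [Nonempty Y] {R : X → Y → Prop} {D : ℝ} (h : IsCorr R D) :
    2 * ghDist X Y ≤ D := by
  refine le_of_forall_pos_le_add fun η hη => ?_
  obtain ⟨x₀⟩ := ‹Nonempty X›
  obtain ⟨y₀, h₀⟩ := h.left x₀
  have hD : 0 ≤ D := (abs_nonneg _).trans (h.dist_le h₀ h₀)
  let Z := {z : X × Y // R z.1 z.2}
  have : Nonempty Z := ⟨⟨(x₀, y₀), h₀⟩⟩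
  let Φ : Z → X := fun z => z.1.1
  let Ψ : Z → Y := fun z => z.1.2
  set ε := (D + η) / 2 with hε
  have ε0 : 0 < ε := by positivity
  let : MetricSpace (X ⊕ Y) := glueMetricApprox Φ Ψ ε ε0 fun p q =>
    (h.dist_le p.2 q.2).trans (by rw [hε]; linarith)
  have hl : Isometry (Sum.inl : X → X ⊕ Y) := Isometry.of_dist_eq fun _ _ => rfl
  have hr : Isometry (Sum.inr : Y → X ⊕ Y) := Isometry.of_dist_eq fun _ _ => rfl
  have key : ∀ x y, R x y → dist (Sum.inl x : X ⊕ Y) (Sum.inr y) = ε := fun x y hxy =>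
    glueDist_glued_points Φ Ψ ε ⟨(x, y), hxy⟩
  have := ghDist_le_hausdorffDist hl hr
  have h2 : hausdorffDist (range (Sum.inl : X → X ⊕ Y)) (range Sum.inr) ≤ ε := by
    refine hausdorffDist_le_of_mem_dist ε0.le ?_ ?_
    · rintro _ ⟨x, rfl⟩
      obtain ⟨y, hy⟩ := h.left x
      exact ⟨_, ⟨y, rfl⟩, (key x y hy).le⟩
    · rintro _ ⟨y, rfl⟩
      obtain ⟨x, hx⟩ := h.right y
      exact ⟨_, ⟨x, rfl⟩, by rw [dist_comm]; exact (key x y hx).le⟩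
  linarith

theorem exists_isCorr (X Y : Type*) [MetricSpace X] [CompactSpace X] [Nonempty X]
    [MetricSpace Y] [CompactSpace Y] [Nonempty Y] :
    ∃ R : X → Y → Prop, IsCorr R (2 * ghDist X Y) := by
  set Φ := optimalGHInjl X Y
  set Ψ := optimalGHInjr X Y
  have hΦ : Isometry Φ := isometry_optimalGHInjl X Y
  have hΨ : Isometry Ψ := isometry_optimalGHInjr X Y
  have hd : hausdorffDist (range Φ) (range Ψ) = ghDist X Y := hausdorffDist_optimal
  have cΦ : IsCompact (range Φ) := isCompact_range hΦ.continuous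
  have cΨ : IsCompact (range Ψ) := isCompact_range hΨ.continuous
  have hfin : hausdorffEDist (range Φ) (range Ψ) ≠ ⊤ :=
    hausdorffEDist_ne_top_of_nonempty_of_bounded (range_nonempty _) (range_nonempty _)
      cΦ.isBounded cΨ.isBounded
  refine ⟨fun x y => dist (Φ x) (Ψ y) ≤ ghDist X Y, ?_, ?_, ?_⟩
  · intro x
    obtain ⟨_, ⟨y, rfl⟩, hy⟩ := cΨ.exists_infDist_eq_dist (range_nonempty _) (Φ x)
    exact ⟨y, by rw [← hy, ← hd]; exact infDist_le_hausdorffDist_of_mem ⟨x, rfl⟩ hfin⟩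
  · intro y
    obtain ⟨_, ⟨x, rfl⟩, hx⟩ := cΦ.exists_infDist_eq_dist (range_nonempty _) (Ψ y)
    refine ⟨x, ?_⟩
    rw [dist_comm, ← hx, ← hd, hausdorffDist_comm]
    exact infDist_le_hausdorffDist_of_mem ⟨y, rfl⟩ (by rwa [hausdorffEDist_comm])
  · intro x y x' y' h h'
    rw [← hΦ.dist_eq, ← hΨ.dist_eq, abs_le]
    have h1 := dist_triangle4 (Φ x) (Ψ y) (Ψ y') (Φ x')
    have h2 := dist_triangle4 (Ψ y) (Φ x) (Φ x') (Ψ y')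
    rw [dist_comm (Ψ y') (Φ x')] at h1
    rw [dist_comm (Ψ y) (Φ x)] at h2
    constructor <;> linarith

/-- Twice the Gromov–Hausdorff distance, i.e. the least distortion of a correspondence. -/
noncomputable def gd (p q : GHSpace) : ℝ := 2 * dist p q

theorem gd_le_of_isCorr {p q : GHSpace} {R : p.Rep → q.Rep → Prop} {D : ℝ} (h : IsCorr R D) :
    gd p q ≤ D := by
  rw [gd, dist_ghDist]; exact h.two_mul_ghDist_le

theorem exists_isCorr_gd (p q : GHSpace) : ∃ R : p.Rep → q.Rep → Prop, IsCorr R (gd p q) := by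
  rw [gd, dist_ghDist]; exact exists_isCorr _ _

theorem gd_comm (p q : GHSpace) : gd p q = gd q p := by rw [gd, gd, dist_comm]

theorem gd_map (f : GHSpace ≃ᵢ GHSpace) (p q : GHSpace) : gd (f p) (f q) = gd p q := by
  rw [gd, gd, f.isometry.dist_eq]

theorem IsCorr.comp {X Y Z : Type*} [MetricSpace X] [MetricSpace Y] [MetricSpace Z]
    {R : X → Y → Prop} {S : Y → Z → Prop} {D E : ℝ} (h : IsCorr R D) (h' : IsCorr S E) {F : ℝ}
    (hF : ∀ x y z x' y' z', R x y → S y z → R x' y' → S y' z' → |dist x x' - dist z z'| ≤ F) :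
    IsCorr (fun x z => ∃ y, R x y ∧ S y z) F where
  left x := by
    obtain ⟨y, hy⟩ := h.left x
    obtain ⟨z, hz⟩ := h'.left y
    exact ⟨z, y, hy, hz⟩
  right z := by
    obtain ⟨y, hy⟩ := h'.right z
    obtain ⟨x, hx⟩ := h.right y
    exact ⟨x, y, hx, hy⟩
  dist_le := by
    rintro x z x' z' ⟨y, h1, h2⟩ ⟨y', h3, h4⟩
    exact hF _ _ _ _ _ _ h1 h2 h3 h4

theorem IsCorr.symm {X Y : Type*} [MetricSpace X] [MetricSpace Y] {R : X → Y → Prop} {D : ℝ}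
    (h : IsCorr R D) : IsCorr (fun y x => R x y) D :=
  ⟨h.right, h.left, fun h1 h2 => by rw [abs_sub_comm]; exact h.dist_le h1 h2⟩

theorem isCorr_of_surjective {X Y : Type*} [MetricSpace X] [MetricSpace Y] {φ : X → Y} {D : ℝ}
    (hφ : Function.Surjective φ) (h : ∀ x x', |dist x x' - dist (φ x) (φ x')| ≤ D) :
    IsCorr (fun x y => φ x = y) D where
  left x := ⟨_, rfl⟩
  right := hφ
  dist_le := by rintro x _ x' _ rfl rfl; exact h x x'

theorem gd_le_of_surjective {p q : GHSpace} {φ : p.Rep → q.Rep} {D : ℝ}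
    (hφ : Function.Surjective φ) (h : ∀ x x', |dist x x' - dist (φ x) (φ x')| ≤ D) :
    gd p q ≤ D :=
  gd_le_of_isCorr (isCorr_of_surjective hφ h)

theorem eq_of_isometry_surjective {p q : GHSpace} {φ : p.Rep → q.Rep}
    (hφ : Function.Surjective φ) (h : ∀ x x', dist (φ x) (φ x') = dist x x') : p = q := by
  have h1 : gd p q ≤ 0 := gd_le_of_surjective hφ fun x x' => by simp [h]
  have h2 : dist p q ≤ 0 := by unfold gd at h1; linarith
  exact dist_le_zero.1 h2

theorem exists_equiv_rep (X : Type) [MetricSpace X] [CompactSpace X] [Nonempty X] :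
    ∃ (q : GHSpace) (e : X ≃ q.Rep), ∀ x y, dist (e x) (e y) = dist x y := by
  have := (toGHSpace X).toGHSpace_rep
  rw [toGHSpace_eq_toGHSpace_iff_isometryEquiv] at this
  obtain ⟨e⟩ := this
  exact ⟨toGHSpace X, e.symm.toEquiv, fun x y => e.symm.isometry.dist_eq x y⟩

/-- Every metric on a compact space that is continuous in one variable is realised in the
Gromov–Hausdorff space. -/
theorem exists_realization {A : Type} [τ : TopologicalSpace A] [CompactSpace A] [Nonempty A]
    (d : A → A → ℝ) (h0 : ∀ x, d x x = 0) (hpos : ∀ x y, d x y = 0 → x = y)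
    (hs : ∀ x y, d x y = d y x) (ht : ∀ x y z, d x z ≤ d x y + d y z)
    (hc : ∀ x, Continuous (d x)) :
    ∃ (q : GHSpace) (e : A ≃ q.Rep), ∀ x y, dist (e x) (e y) = d x y := by
  let M : MetricSpace A :=
    { dist := d
      dist_self := h0
      dist_comm := hs
      dist_triangle := ht
      eq_of_dist_eq_zero := fun {x y} h => hpos x y h }
  have hcont : @Continuous A A τ M.toPseudoMetricSpace.toUniformSpace.toTopologicalSpace id := by
    rw [@Metric.continuous_iff' A A M.toPseudoMetricSpace τ id]
    intro a ε hε
    have : Tendsto (d a) (@nhds A τ a) (𝓝 (d a a)) := (hc a).tendsto a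
    rw [h0] at this
    filter_upwards [this.eventually (gt_mem_nhds hε)] with x hx
    change d x a < ε
    rwa [hs]
  have hcomp : @IsCompact A M.toPseudoMetricSpace.toUniformSpace.toTopologicalSpace univ := by
    have := @IsCompact.image A A τ M.toPseudoMetricSpace.toUniformSpace.toTopologicalSpace
      univ id (@isCompact_univ A τ _) hcont
    rwa [image_id] at this
  exact @exists_equiv_rep A M (@CompactSpace.mk A M.toPseudoMetricSpace.toUniformSpace.toTopologicalSpace hcomp) _

/-- Every metric on a compact space dominated by a multiple of the original one is realised in
the Gromov–Hausdorff space. -/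
theorem exists_realization_of_le {p : GHSpace}
    (d : p.Rep → p.Rep → ℝ) (h0 : ∀ x, d x x = 0) (hpos : ∀ x y, d x y = 0 → x = y)
    (hs : ∀ x y, d x y = d y x) (ht : ∀ x y z, d x z ≤ d x y + d y z) {K : ℝ}
    (hK : ∀ x y, d x y ≤ K * dist x y) :
    ∃ (q : GHSpace) (e : p.Rep ≃ q.Rep), ∀ x y, dist (e x) (e y) = d x y := by
  refine exists_realization d h0 hpos hs ht fun x => ?_
  have hK' : ∀ x y, d x y ≤ max K 0 * dist x y := fun x y =>
    (hK x y).trans (mul_le_mul_of_nonneg_right (le_max_left _ _) dist_nonneg)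
  refine (LipschitzWith.of_le_add_mul (max K 0).toNNReal fun y z => ?_).continuous
  have := ht x z y
  have := hK' z y
  rw [dist_comm] at this
  rw [Real.coe_toNNReal _ (le_max_right _ _)]
  linarith

/-- Realisation of `t • p`. -/
theorem exists_smul (p : GHSpace) {t : ℝ} (ht : 0 < t) :
    ∃ (q : GHSpace) (e : p.Rep ≃ q.Rep), ∀ x y, dist (e x) (e y) = t * dist x y := by
  refine exists_realization_of_le (fun x y => t * dist x y) (by simp) ?_ ?_ ?_ (K := t) ?_
  · intro x y h
    rcases mul_eq_zero.1 h with h | h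
    · linarith
    · exact dist_eq_zero.1 h
  · intro x y; rw [dist_comm]
  · intro x y z
    have := mul_le_mul_of_nonneg_left (dist_triangle x y z) ht.le
    linarith
  · intro x y; rfl

theorem exists_dist_le (p : GHSpace) : ∃ M : ℝ, 0 < M ∧ ∀ x y : p.Rep, dist x y ≤ M := by
  obtain ⟨M, hM⟩ := isBounded_iff.1 (isCompact_univ (X := p.Rep)).isBounded
  exact ⟨max M 1, by positivity, fun x y => (hM (mem_univ _) (mem_univ _)).trans (le_max_left _ _)⟩

theorem dist_le_add_gd {p q : GHSpace} {M : ℝ} (hM : ∀ x y : p.Rep, dist x y ≤ M)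
    (x y : q.Rep) : dist x y ≤ M + gd p q := by
  obtain ⟨R, hR⟩ := exists_isCorr_gd p q
  obtain ⟨a, ha⟩ := hR.right x
  obtain ⟨b, hb⟩ := hR.right y
  have := abs_le.1 (hR.dist_le ha hb)
  linarith [hM a b]

/-- `p` has a family of `k` points with pairwise distances at least `r`. -/
def Sep (k : ℕ) (r : ℝ) (p : GHSpace) : Prop :=
  ∃ u : Fin k → p.Rep, ∀ i j, i ≠ j → r ≤ dist (u i) (u j)

theorem Sep.of_gd_le {k : ℕ} {r s : ℝ} {p q : GHSpace} (h : Sep k r p) (hs : gd p q ≤ s) :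
    Sep k (r - s) q := by
  obtain ⟨u, hu⟩ := h
  obtain ⟨R, hR⟩ := exists_isCorr_gd p q
  choose g hg using hR.left
  refine ⟨fun i => g (u i), fun i j hij => ?_⟩
  have := abs_le.1 (hR.dist_le (hg (u i)) (hg (u j)))
  linarith [hu i j hij]

theorem exists_not_sep (p : GHSpace) {r : ℝ} (hr : 0 < r) : ∃ k, ¬ Sep k r p := by
  obtain ⟨t, -, ht, hcov⟩ := (isCompact_univ (X := p.Rep)).finite_cover_balls (half_pos hr)
  refine ⟨ht.toFinset.card + 1, fun ⟨u, hu⟩ => ?_⟩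
  have : ∀ i, ∃ c ∈ t, dist (u i) c < r / 2 := fun i => by
    simpa using hcov (mem_univ (u i))
  choose c hc hd using this
  have : ∃ i ∈ Finset.univ, ∃ j ∈ Finset.univ, i ≠ j ∧ c i = c j :=
    Finset.exists_ne_map_eq_of_card_lt_of_maps_to (t := ht.toFinset) (by simp)
      (fun i _ => by simpa using hc i)
  obtain ⟨i, -, j, -, hij, he⟩ := this
  have h1 := hd i
  have h2 := hd j
  rw [← he] at h2
  have := dist_triangle_right (u i) (u j) (c i)
  linarith [hu i j hij]

theorem exists_sep_of_injective {p : GHSpace} {k : ℕ} {u : Fin k → p.Rep}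
    (hu : Function.Injective u) : ∃ r > 0, Sep k r p := by
  let S := (Finset.univ : Finset (Fin k × Fin k)).filter fun a => a.1 ≠ a.2
  have : ∃ r > 0, ∀ a ∈ S, r ≤ dist (u a.1) (u a.2) := by
    rcases S.eq_empty_or_nonempty with h | h
    · exact ⟨1, one_pos, by simp [h]⟩
    · obtain ⟨a, ha, hmin⟩ := S.exists_min_image (fun a => dist (u a.1) (u a.2)) h
      refine ⟨_, dist_pos.2 fun h => ?_, hmin⟩
      exact (Finset.mem_filter.1 ha).2 (hu h)
  obtain ⟨r, hr, h⟩ := this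
  exact ⟨r, hr, u, fun i j hij => h (i, j) (by simp [S, hij])⟩

/-- A multiplicative version of the fact that packing radii drop. -/
theorem exists_sep_drop {p : GHSpace} {k : ℕ} {r₀ r₁ c : ℝ} (hc : 1 < c) (h0 : 0 < r₀)
    (h : Sep k r₀ p) (h' : ¬ Sep k r₁ p) :
    ∃ r, r₀ ≤ r ∧ r < r₁ ∧ Sep k r p ∧ ¬ Sep k (c * r) p := by
  have anti : ∀ {a b : ℝ}, a ≤ b → Sep k b p → Sep k a p := fun hab ⟨u, hu⟩ =>
    ⟨u, fun i j hij => hab.trans (hu i j hij)⟩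
  have hex : ∃ j : ℕ, ¬ Sep k (c ^ j * r₀) p := by
    obtain ⟨j, hj⟩ := pow_unbounded_of_one_lt (r₁ / r₀) hc
    exact ⟨j, fun hS => h' (anti ((div_lt_iff₀ h0).1 hj).le hS)⟩
  classical
  obtain ⟨j, hj, hmin⟩ : ∃ j, ¬ Sep k (c ^ j * r₀) p ∧ ∀ i < j, Sep k (c ^ i * r₀) p :=
    ⟨Nat.find hex, Nat.find_spec hex, fun i hi => not_not.1 (Nat.find_min hex hi)⟩
  obtain _ | j := j
  · simp [h] at hj
  · have hS := hmin j (Nat.lt_succ_self j)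
    refine ⟨c ^ j * r₀, ?_, ?_, hS, ?_⟩
    · exact le_mul_of_one_le_left h0.le (one_le_pow₀ hc.le)
    · by_contra hcon
      exact h' (anti (not_lt.1 hcon) hS)
    · rwa [← mul_assoc, ← pow_succ']

/-- Enlarging all distances in the packing range and scaling down by `1 - τ` separates. -/
theorem lt_gd_of_sep_drop {p B C : GHSpace} {k : ℕ} {r s τ : ℝ} (hτ : τ < 1)
    (hS : Sep k r p) (hS' : ¬ Sep k ((1 - τ)⁻¹ * r) p)
    (e : p.Rep ≃ B.Rep) (he : ∀ x y, r ≤ dist x y → r + s ≤ dist (e x) (e y))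
    (e' : p.Rep ≃ C.Rep) (he' : ∀ x y, dist (e' x) (e' y) = (1 - τ) * dist x y) :
    s < gd B C := by
  by_contra! hcon
  obtain ⟨u, hu⟩ := hS
  have hB : Sep k (r + s) B := ⟨fun i => e (u i), fun i j hij => he _ _ (hu i j hij)⟩
  obtain ⟨v, hv⟩ := hB.of_gd_le hcon
  refine hS' ⟨fun i => e'.symm (v i), fun i j hij => ?_⟩
  have h1 := hv i j hij
  have h2 := he' (e'.symm (v i)) (e'.symm (v j))
  simp only [Equiv.apply_symm_apply] at h2
  rw [h2] at h1
  rw [inv_mul_le_iff₀ (by linarith)]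
  linarith

theorem exists_dist_max (p : GHSpace) : ∃ a b : p.Rep, ∀ x y : p.Rep, dist x y ≤ dist a b := by
  obtain ⟨⟨a, b⟩, -, h⟩ := (isCompact_univ (X := p.Rep × p.Rep)).exists_isMaxOn
    (univ_nonempty) (f := fun z => dist z.1 z.2) continuous_dist.continuousOn
  exact ⟨a, b, fun x y => h (mem_univ (x, y))⟩

/-- The point is the only space around which all balls are ultrametric. -/
theorem subsingleton_iff (p : GHSpace) :
    Subsingleton p.Rep ↔ ∀ B C, gd B C ≤ max (gd p B) (gd p C) := by
  constructor
  · intro _ B C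
    obtain ⟨R, hR⟩ := exists_isCorr_gd p B
    obtain ⟨S, hS⟩ := exists_isCorr_gd p C
    refine gd_le_of_isCorr (hR.symm.comp hS (F := max (gd p B) (gd p C)) ?_)
    intro x y z x' y' z' h1 h2 h3 h4
    obtain rfl : y = y' := Subsingleton.elim _ _
    have h5 := hR.dist_le h1 h3
    have h6 := hS.dist_le h2 h4
    rw [dist_self, zero_sub, abs_neg, abs_of_nonneg dist_nonneg] at h5 h6
    rw [abs_le]
    have := le_max_left (gd p B) (gd p C)
    have := le_max_right (gd p B) (gd p C)
    constructor <;> linarith [dist_nonneg (x := x) (y := x'), dist_nonneg (x := z) (y := z')]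
  · intro h
    obtain ⟨a, b, hab⟩ := exists_dist_max p
    by_contra hns
    have hpos : 0 < dist a b := by
      rw [not_subsingleton_iff_nontrivial] at hns
      obtain ⟨x, y, hxy⟩ := hns
      exact (dist_pos.2 hxy).trans_le (hab x y)
    obtain ⟨B, e, he⟩ := exists_smul p (t := 3 / 2) (by norm_num)
    obtain ⟨C, e', he'⟩ := exists_smul p (t := 1 / 2) (by norm_num)
    have h1 : gd p B ≤ dist a b / 2 := gd_le_of_surjective e.surjective fun x y => by
      rw [he, abs_le]
      constructor <;> linarith [hab x y, dist_nonneg (x := x) (y := y)]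
    have h2 : gd p C ≤ dist a b / 2 := gd_le_of_surjective e'.surjective fun x y => by
      rw [he', abs_le]
      constructor <;> linarith [hab x y, dist_nonneg (x := x) (y := y)]
    have h3 : ∀ x y : C.Rep, dist x y ≤ dist a b / 2 := fun x y => by
      have := he' (e'.symm x) (e'.symm y)
      simp only [Equiv.apply_symm_apply] at this
      linarith [hab (e'.symm x) (e'.symm y)]
    have h4 := dist_le_add_gd h3 (e a) (e b)
    rw [he, gd_comm] at h4
    linarith [h B C, max_le h1 h2]

theorem gd_le_iff_of_subsingleton {p q : GHSpace} [Subsingleton p.Rep] {D : ℝ} :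
    gd q p ≤ D ↔ ∀ x y : q.Rep, dist x y ≤ D := by
  constructor
  · intro h x y
    have := dist_le_add_gd (p := p) (q := q) (M := 0)
      (fun a b => by rw [Subsingleton.elim a b, dist_self]) x y
    rw [gd_comm] at this
    linarith
  · intro h
    obtain ⟨c⟩ : Nonempty p.Rep := inferInstance
    refine gd_le_of_surjective (φ := fun _ => c) (fun y => ⟨Classical.arbitrary _,
      Subsingleton.elim _ _⟩) fun x x' => ?_
    rw [dist_self, sub_zero, abs_of_nonneg dist_nonneg]
    exact h x x'

theorem exists_subsingleton : ∃ p : GHSpace, Subsingleton p.Rep := by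
  obtain ⟨q, e, -⟩ := exists_equiv_rep Unit
  exact ⟨q, e.symm.subsingleton⟩

theorem subsingleton_map (f : GHSpace ≃ᵢ GHSpace) (p : GHSpace) [h : Subsingleton p.Rep] :
    Subsingleton (f p).Rep := by
  rw [subsingleton_iff] at h ⊢
  intro B C
  have := h (f.symm B) (f.symm C)
  rw [← gd_map f, ← gd_map f p, ← gd_map f p] at this
  simpa using this

theorem dist_le_map_iff (f : GHSpace ≃ᵢ GHSpace) (q : GHSpace) (D : ℝ) :
    (∀ x y : (f q).Rep, dist x y ≤ D) ↔ ∀ x y : q.Rep, dist x y ≤ D := by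
  obtain ⟨p, hp⟩ := exists_subsingleton
  have := subsingleton_map f p
  rw [← gd_le_iff_of_subsingleton (p := f p), ← gd_le_iff_of_subsingleton (p := p), gd_map]

/-- Enlarge distances up to `g` within the fibres of a labelling whose fibres are `g`-separated. -/
theorem exists_enlarge {p : GHSpace} {ι : Type*} (ℓ : p.Rep → ι) {g κ s : ℝ}
    (hκ : 0 < κ) (hs : 0 < s) (hℓ : ∀ x y, ℓ x ≠ ℓ y → g ≤ dist x y) :
    ∃ (B : GHSpace) (e : p.Rep ≃ B.Rep),
      (∀ x y, ℓ x ≠ ℓ y → dist (e x) (e y) = dist x y) ∧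
      (∀ x y, ℓ x = ℓ y → dist (e x) (e y) =
        max (dist x y) (min g (min ((1 + κ) * dist x y) (dist x y + s)))) := by
  classical
  let ψ : ℝ → ℝ := fun d => max d (min g (min ((1 + κ) * d) (d + s)))
  have hψ : ∀ a, a ≤ ψ a := fun a => le_max_left _ _
  have hψ2 : ∀ a, ψ a ≤ max a g := fun a => max_le_max le_rfl (min_le_left _ _)
  have hψ3 : ∀ a, 0 ≤ a → ψ a ≤ (1 + κ) * a := fun a ha =>
    max_le (by nlinarith) ((min_le_right _ _).trans (min_le_left _ _))
  have hψs : ∀ a b c, 0 ≤ a → 0 ≤ b → c ≤ a + b → ψ c ≤ ψ a + ψ b := by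
    intro a b c ha hb hc
    have h1 := hψ a
    have h2 := hψ b
    refine max_le (by linarith) ?_
    have key : ∀ a b, 0 ≤ a → 0 ≤ b → c ≤ a + b → ψ a = min g (min ((1 + κ) * a) (a + s)) →
        min g (min ((1 + κ) * c) (c + s)) ≤ ψ a + ψ b := by
      intro a b ha hb hc h
      have h2 := hψ b
      rcases le_total g (min ((1 + κ) * a) (a + s)) with h3 | h3
      · rw [min_eq_left h3] at h
        exact (min_le_left _ _).trans (by linarith)
      · rw [min_eq_right h3] at h
        rcases le_total ((1 + κ) * a) (a + s) with h4 | h4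
        · rw [min_eq_left h4] at h
          have hb' : min g (min ((1 + κ) * b) (b + s)) ≤ ψ b := le_max_right _ _
          rcases le_total g (min ((1 + κ) * b) (b + s)) with h5 | h5
          · rw [min_eq_left h5] at hb'
            have : 0 ≤ ψ a := ha.trans (hψ a)
            exact (min_le_left _ _).trans (by linarith)
          · rw [min_eq_right h5] at hb'
            refine (min_le_right _ _).trans ?_
            rcases le_total ((1 + κ) * b) (b + s) with h6 | h6
            · rw [min_eq_left h6] at hb'
              refine (min_le_left _ _).trans ?_
              nlinarith
            · rw [min_eq_right h6] at hb'
              exact (min_le_right _ _).trans (by linarith [hψ a])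
        · rw [min_eq_right h4] at h
          exact (min_le_right _ _).trans ((min_le_right _ _).trans (by linarith))
    rcases max_choice a (min g (min ((1 + κ) * a) (a + s))) with h | h
    · rcases max_choice b (min g (min ((1 + κ) * b) (b + s))) with h' | h'
      · have hc0 : min g (min ((1 + κ) * a) (a + s)) ≤ a := max_eq_left_iff.1 h
        have ha' : g ≤ a ∨ a = 0 := by
          by_contra! hcon
          have : 0 < a := lt_of_le_of_ne ha hcon.2.symm
          have : a < min g (min ((1 + κ) * a) (a + s)) :=
            lt_min hcon.1 (lt_min (by nlinarith) (by linarith))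
          linarith
        rcases ha' with h3 | h3
        · exact (min_le_left _ _).trans (by linarith)
        · subst h3
          have : min g (min ((1 + κ) * c) (c + s)) ≤ ψ b := by
            refine le_trans ?_ (le_max_right b (min g (min ((1 + κ) * b) (b + s))))
            gcongr <;> linarith
          linarith
      · rw [add_comm (ψ a)]
        exact key b a hb ha (by linarith) h'
    · exact key a b ha hb hc h
  let d : p.Rep → p.Rep → ℝ := fun x y => if ℓ x = ℓ y then ψ (dist x y) else dist x y
  have hd : ∀ x y, dist x y ≤ d x y := fun x y => by
    dsimp only [d]; split_ifs
    · exact hψ _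
    · exact le_rfl
  have hd0 : ψ 0 = 0 := le_antisymm (by simpa using hψ3 0 le_rfl) (hψ 0)
  obtain ⟨B, e, he⟩ := exists_realization_of_le d (by simp [d, hd0])
    (fun x y h => dist_le_zero.1 (h ▸ hd x y))
    (fun x y => by simp only [d, dist_comm, eq_comm]) (fun x y z => by
      by_cases hxz : ℓ x = ℓ z
      · by_cases hxy : ℓ x = ℓ y
        · simp only [d, hxz, hxy ▸ hxz, if_true]
          exact hψs _ _ _ dist_nonneg dist_nonneg (dist_triangle x y z)
        · have h1 : d x z ≤ max (dist x z) g := by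
            simp only [d, hxz, if_true]; exact hψ2 _
          refine h1.trans (max_le ?_ ?_)
          · linarith [dist_triangle x y z, hd x y, hd y z]
          · linarith [hℓ x y hxy, hd x y, hd y z, dist_nonneg (x := y) (y := z)]
      · have : d x z = dist x z := if_neg hxz
        linarith [dist_triangle x y z, hd x y, hd y z]) (K := 1 + κ) (fun x y => by
      dsimp only [d]; split_ifs
      · exact hψ3 _ dist_nonneg
      · nlinarith [dist_nonneg (x := x) (y := y)])
  refine ⟨B, e, fun x y h => ?_, fun x y h => ?_⟩
  · rw [he]; exact if_neg h
  · rw [he]; exact if_pos h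

/-- Two spaces within `s` of `p`, one enlarged, one shrunk, which are more than `s` apart. -/
theorem exists_spread {p : GHSpace} {ι : Type*} (ℓ : p.Rep → ι) {g M s r₀ r₁ : ℝ} {k : ℕ}
    (hℓ : ∀ x y, ℓ x ≠ ℓ y → g ≤ dist x y) (hM : ∀ x y : p.Rep, dist x y ≤ M)
    (hr₀ : 0 < r₀) (hk : Sep k r₀ p) (hk' : ¬ Sep k r₁ p)
    (hs : 0 < s) (hsg : s ≤ g - r₁) (hsM : s < M) :
    ∃ (B C : GHSpace) (e : p.Rep ≃ B.Rep) (e' : p.Rep ≃ C.Rep),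
      (∀ x y, ℓ x ≠ ℓ y → dist (e x) (e y) = dist x y) ∧
      (∀ x y, dist x y ≤ dist (e x) (e y)) ∧ (∀ x y, dist (e x) (e y) ≤ max (dist x y) g) ∧
      (∀ x y, dist (e' x) (e' y) ≤ dist x y) ∧
      gd p B ≤ s ∧ gd p C ≤ s ∧ s < gd B C ∧
      ∃ K > 0, ∀ x y, dist (e x) (e y) ≤ K * dist x y := by
  have hM0 : 0 < M := hs.trans hsM
  have hτ : s / M < 1 := (div_lt_one hM0).2 hsM
  have hτ0 : 0 < s / M := div_pos hs hM0
  obtain ⟨B, e, he1, he2⟩ := exists_enlarge ℓ (div_pos hs hr₀) hs hℓ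
  obtain ⟨C, e', he'⟩ := exists_smul p (t := 1 - s / M) (by linarith)
  have hle : ∀ x y, dist x y ≤ dist (e x) (e y) := fun x y => by
    by_cases h : ℓ x = ℓ y
    · rw [he2 x y h]; exact le_max_left _ _
    · rw [he1 x y h]
  refine ⟨B, C, e, e', he1, hle, fun x y => ?_, fun x y => ?_, ?_, ?_, ?_,
    1 + s / r₀, by positivity, fun x y => ?_⟩
  · by_cases h : ℓ x = ℓ y
    · rw [he2 x y h]; exact max_le_max le_rfl (min_le_left _ _)
    · rw [he1 x y h]; exact le_max_left _ _
  · rw [he']; nlinarith [dist_nonneg (x := x) (y := y)]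
  · refine gd_le_of_surjective e.surjective fun x y => ?_
    rw [abs_sub_comm, abs_of_nonneg (sub_nonneg.2 (hle x y)), sub_le_iff_le_add']
    by_cases h : ℓ x = ℓ y
    · rw [he2 x y h]
      exact max_le (by linarith) ((min_le_right _ _).trans (min_le_right _ _))
    · rw [he1 x y h]; linarith
  · refine gd_le_of_surjective e'.surjective fun x y => ?_
    have : dist x y - (1 - s / M) * dist x y = s / M * dist x y := by ring
    rw [he', this, abs_of_nonneg (by positivity)]
    calc s / M * dist x y ≤ s / M * M := by gcongr; exact hM x y
      _ = s := by field_simp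
  · obtain ⟨r, hr, hr', hS, hS'⟩ := exists_sep_drop (c := (1 - s / M)⁻¹)
      (by rw [one_lt_inv₀ (by linarith)]; linarith) hr₀ hk hk'
    refine lt_gd_of_sep_drop hτ hS hS' e (fun x y hxy => ?_) e' he'
    by_cases h : ℓ x = ℓ y
    · rw [he2 x y h]
      refine le_trans ?_ (le_max_right _ _)
      refine le_min (by linarith) (le_min ?_ (by linarith))
      have : s ≤ s / r₀ * dist x y := by
        rw [div_mul_eq_mul_div, le_div_iff₀ hr₀]
        gcongr; linarith
      linarith
    · rw [he1 x y h]; linarith [hℓ x y h]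
  · by_cases h : ℓ x = ℓ y
    · rw [he2 x y h]
      refine max_le ?_ ((min_le_right _ _).trans (min_le_left _ _))
      exact le_mul_of_one_le_left dist_nonneg (le_add_of_nonneg_right (by positivity))
    · rw [he1 x y h]
      exact le_mul_of_one_le_left dist_nonneg (le_add_of_nonneg_right (by positivity))

/-- The edges of the complete graph on `Fin n`. -/
abbrev Edge (n : ℕ) := {e : Sym2 (Fin n) // ¬ e.IsDiag}

/-- The edge joining two distinct vertices. -/
def edge {n : ℕ} (i j : Fin n) (h : i ≠ j) : Edge n := ⟨s(i, j), by simpa using h⟩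

/-- The space `q` consists of `n` points, with distances prescribed by the edge weights `x`. -/
def Realizes {n : ℕ} (x : Edge n → ℝ) (q : GHSpace) : Prop :=
  ∃ e : Fin n ≃ q.Rep, ∀ i j (h : i ≠ j), dist (e i) (e j) = x (edge i j h)

/-- The space `q` consists of `n` points at distance `t` from each other. -/
def IsSimplex (t : ℝ) (n : ℕ) (q : GHSpace) : Prop := Realizes (n := n) (fun _ => t) q

/-- Edge weights that are positive and satisfy the triangle inequality. -/
structure Met {n : ℕ} (x : Edge n → ℝ) : Prop where
  pos : ∀ e, 0 < x e
  triangle : ∀ i j k (hij : i ≠ j) (hjk : j ≠ k) (hik : i ≠ k),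
    x (edge i k hik) ≤ x (edge i j hij) + x (edge j k hjk)

theorem edge_comm {n : ℕ} (i j : Fin n) (h : i ≠ j) : edge i j h = edge j i h.symm :=
  Subtype.ext Sym2.eq_swap

theorem Met.exists_realizes {n : ℕ} (hn : 1 ≤ n) {x : Edge n → ℝ} (hx : Met x) :
    ∃ q, Realizes x q := by
  have : Nonempty (Fin n) := ⟨⟨0, hn⟩⟩
  obtain ⟨q, e, he⟩ := exists_realization (A := Fin n)
    (fun i j => if h : i = j then 0 else x (edge i j h)) (by simp) (fun i j h => by
      by_contra hij
      rw [dif_neg hij] at h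
      exact (hx.pos _).ne' h) (fun i j => by
      by_cases hij : i = j
      · subst hij; simp
      · rw [dif_neg hij, dif_neg (Ne.symm hij), edge_comm]) (fun i j k => by
      by_cases hik : i = k
      · rw [dif_pos hik]
        have : ∀ e, 0 ≤ x e := fun e => (hx.pos e).le
        split_ifs <;> simp [this, add_nonneg]
      · by_cases hij : i = j
        · subst hij; simp
        · by_cases hjk : j = k
          · subst hjk; simp
          · simp only [hik, hij, hjk, dif_neg, not_false_eq_true]
            exact hx.triangle i j k hij hjk hik) (fun _ => continuous_of_discreteTopology)
  exact ⟨q, e, fun i j h => by rw [he, dif_neg h]⟩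

theorem Realizes.met {n : ℕ} {x : Edge n → ℝ} {q : GHSpace} (h : Realizes x q) : Met x := by
  obtain ⟨e, he⟩ := h
  refine ⟨?_, ?_⟩
  · rintro ⟨s, hs⟩
    induction s with
    | _ i j =>
      have hij : i ≠ j := by simpa using hs
      have := he i j hij
      rw [show (⟨s(i, j), hs⟩ : Edge n) = edge i j hij from rfl, ← this]
      exact dist_pos.2 fun h => hij (e.injective h)
  · intro i j k hij hjk hik
    rw [← he, ← he, ← he]
    exact dist_triangle _ _ _

theorem Realizes.eq {n : ℕ} {x : Edge n → ℝ} {p q : GHSpace} (hp : Realizes x p)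
    (hq : Realizes x q) : p = q := by
  obtain ⟨e, he⟩ := hp
  obtain ⟨e', he'⟩ := hq
  refine eq_of_isometry_surjective (φ := e.symm.trans e') (Equiv.surjective _) fun a b => ?_
  obtain ⟨i, rfl⟩ := e.surjective a
  obtain ⟨j, rfl⟩ := e.surjective b
  simp only [Equiv.trans_apply, Equiv.symm_apply_apply]
  by_cases h : i = j
  · subst h; simp
  · rw [he' i j h, he i j h]

theorem exists_isSimplex {t : ℝ} (ht : 0 < t) {n : ℕ} (hn : 1 ≤ n) : ∃ q, IsSimplex t n q :=
  Met.exists_realizes hn ⟨fun _ => ht, fun _ _ _ _ _ _ => by linarith⟩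

theorem IsSimplex.gd_le_max {t : ℝ} {n : ℕ} {q : GHSpace} (h : IsSimplex t n q) {B C : GHSpace}
    (hB : ∀ x y : B.Rep, dist x y ≤ t) (hC : ∀ x y : C.Rep, dist x y ≤ t) :
    gd B C ≤ max (gd q B) (gd q C) := by
  obtain ⟨e, he⟩ := h
  obtain ⟨R, hR⟩ := exists_isCorr_gd q B
  obtain ⟨S, hS⟩ := exists_isCorr_gd q C
  refine gd_le_of_isCorr (hR.symm.comp hS (F := max (gd q B) (gd q C)) ?_)
  intro x y z x' y' z' h1 h2 h3 h4
  have h5 := abs_le.1 (hR.dist_le h1 h3)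
  have h6 := abs_le.1 (hS.dist_le h2 h4)
  have h7 := le_max_left (gd q B) (gd q C)
  have h8 := le_max_right (gd q B) (gd q C)
  have h9 := hB x x'
  have h10 := hC z z'
  obtain ⟨i, rfl⟩ := e.surjective y
  obtain ⟨j, rfl⟩ := e.surjective y'
  rw [abs_le]
  by_cases hij : i = j
  · subst hij
    rw [dist_self] at h5 h6
    constructor <;> linarith [dist_nonneg (x := x) (y := x'), dist_nonneg (x := z) (y := z')]
  · rw [he i j hij] at h5 h6
    constructor <;> linarith

theorem exists_isSimplex_of_dist {t : ℝ} (ht : 0 < t) {q : GHSpace}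
    (h : ∀ x y : q.Rep, x ≠ y → dist x y = t) : ∃ n, 1 ≤ n ∧ IsSimplex t n q := by
  have hfin : Finite q.Rep := by
    by_contra hinf
    rw [not_finite_iff_infinite] at hinf
    obtain ⟨k, hk⟩ := exists_not_sep q ht
    obtain ⟨u⟩ : Nonempty (Fin k ↪ q.Rep) := ⟨(Fin.valEmbedding).trans (Infinite.natEmbedding _)⟩
    exact hk ⟨u, fun i j hij => (h _ _ fun he => hij (u.injective he)).ge⟩
  obtain ⟨n, ⟨e⟩⟩ := Finite.exists_equiv_fin q.Rep
  refine ⟨n, ?_, e.symm, fun i j hij => h _ _ fun he => hij (e.symm.injective he)⟩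
  have := (e (Classical.arbitrary _)).pos
  omega

theorem exists_isSimplex_iff {t : ℝ} (ht : 0 < t) {q : GHSpace} (hq : ∀ x y : q.Rep, dist x y ≤ t) :
    (∃ n, 1 ≤ n ∧ IsSimplex t n q) ↔ ∀ B C : GHSpace, (∀ x y : B.Rep, dist x y ≤ t) →
      (∀ x y : C.Rep, dist x y ≤ t) → gd B C ≤ max (gd q B) (gd q C) := by
  constructor
  · rintro ⟨n, -, h⟩ B C hB hC
    exact h.gd_le_max hB hC
  · intro h
    refine exists_isSimplex_of_dist ht ?_
    by_contra! hcon
    obtain ⟨a, b, hab, hne⟩ := hcon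
    have hlt : dist a b < t := lt_of_le_of_ne (hq a b) hne
    have hpos := dist_pos.2 hab
    have hex := exists_not_sep q (r := (dist a b + t) / 2) (by linarith)
    classical
    obtain ⟨k, hk, hmin⟩ : ∃ k, ¬ Sep k ((dist a b + t) / 2) q ∧
        ∀ i < k, Sep i ((dist a b + t) / 2) q :=
      ⟨Nat.find hex, Nat.find_spec hex, fun i hi => not_not.1 (Nat.find_min hex hi)⟩
    obtain _ | k := k
    · exact hk ⟨fun i => i.elim0, fun i => i.elim0⟩
    obtain ⟨u, hu⟩ := hmin k (Nat.lt_succ_self k)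
    have hns : ¬ Function.Surjective u := by
      intro hs
      obtain ⟨i, hi⟩ := hs a
      obtain ⟨j, hj⟩ := hs b
      have := hu i j (by rintro rfl; exact hab (hi.symm.trans hj))
      rw [hi, hj] at this
      linarith
    obtain ⟨c, hc⟩ : ∃ c, ∀ i, u i ≠ c := by simpa [Function.Surjective] using hns
    have huinj : Function.Injective u := fun i j hij => by
      by_contra hne
      have := hu i j hne
      rw [hij, dist_self] at this
      linarith
    obtain ⟨r₀, hr₀, hS⟩ := exists_sep_of_injective (u := (Fin.cons c u : Fin (k + 1) → q.Rep))
      (Fin.cons_injective_iff.2 ⟨by simpa using hc, huinj⟩)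
    obtain ⟨B, C, e, e', -, -, h2, h3, h4, h5, h6, -⟩ := exists_spread (fun _ : q.Rep => ()) (g := t)
      (M := t) (s := (t - dist a b) / 2) (by simp) hq hr₀ hS hk (by linarith) (by linarith)
      (by linarith)
    have := h B C (fun x y => by
        have := h2 (e.symm x) (e.symm y)
        simp only [Equiv.apply_symm_apply] at this
        exact this.trans (max_le (hq _ _) le_rfl)) (fun x y => by
        have := h3 (e'.symm x) (e'.symm y)
        simp only [Equiv.apply_symm_apply] at this
        exact this.trans (hq _ _))
    linarith [max_le h4 h5]

theorem IsSimplex.dist_le {t : ℝ} (ht : 0 < t) {n : ℕ} {q : GHSpace} (h : IsSimplex t n q)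
    (x y : q.Rep) : dist x y ≤ t := by
  obtain ⟨e, he⟩ := h
  obtain ⟨i, rfl⟩ := e.surjective x
  obtain ⟨j, rfl⟩ := e.surjective y
  by_cases hij : i = j
  · subst hij; simpa using ht.le
  · exact (he i j hij).le

theorem IsSimplex.exists_map (f : GHSpace ≃ᵢ GHSpace) {t : ℝ} (ht : 0 < t) {n : ℕ} (hn : 1 ≤ n)
    {q : GHSpace} (h : IsSimplex t n q) : ∃ k, 1 ≤ k ∧ IsSimplex t k (f q) := by
  have hq := h.dist_le ht
  rw [exists_isSimplex_iff ht ((dist_le_map_iff f q t).2 hq)]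
  intro B C hB hC
  have := (exists_isSimplex_iff ht hq).1 ⟨n, hn, h⟩ (f.symm B) (f.symm C)
    ((dist_le_map_iff f.symm B t).2 hB) ((dist_le_map_iff f.symm C t).2 hC)
  rw [← gd_map f, ← gd_map f q, ← gd_map f q] at this
  simpa using this

theorem IsSimplex.gd_le_iff {t : ℝ} (ht : 0 < t) {m n : ℕ} (hm : 1 ≤ m) {p q : GHSpace}
    (hp : IsSimplex t n p) (hq : IsSimplex (2 * t) m q) : gd p q ≤ t ↔ m ≤ n := by
  obtain ⟨e, he⟩ := hp
  obtain ⟨e', he'⟩ := hq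
  constructor
  · intro h
    by_contra! hlt
    obtain ⟨R, hR⟩ := exists_isCorr_gd p q
    choose g hg using hR.right
    obtain ⟨i, j, hij, hne⟩ := Fintype.exists_ne_map_eq_of_card_lt
      (fun i : Fin m => e.symm (g (e' i))) (by simpa using hlt)
    have h1 := abs_le.1 (hR.dist_le (hg (e' i)) (hg (e' j)))
    rw [e.symm.injective hne, dist_self, he' i j hij] at h1
    linarith
  · intro h
    have : ∃ φ : Fin n → Fin m, Function.Surjective φ :=
      ⟨fun i => ⟨min i (m - 1), by omega⟩, fun j => ⟨⟨j, by omega⟩, by ext; simp; omega⟩⟩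
    obtain ⟨φ, hφ⟩ := this
    refine gd_le_of_surjective (φ := fun x => e' (φ (e.symm x)))
      (e'.surjective.comp (hφ.comp e.symm.surjective)) fun x y => ?_
    obtain ⟨i, rfl⟩ := e.surjective x
    obtain ⟨j, rfl⟩ := e.surjective y
    simp only [Equiv.symm_apply_apply]
    by_cases hij : i = j
    · subst hij; simpa using ht.le
    · rw [he i j hij]
      by_cases hφij : φ i = φ j
      · rw [hφij, dist_self, sub_zero, abs_of_pos ht]
      · rw [he' _ _ hφij, abs_le]; constructor <;> linarith

theorem IsSimplex.le_of_map {n : ℕ} (hn : 1 ≤ n) : ∀ (f : GHSpace ≃ᵢ GHSpace) {t : ℝ}, 0 < t →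
    ∀ {k : ℕ} {q : GHSpace}, IsSimplex t n q → IsSimplex t k (f q) → n ≤ k := by
  induction n, hn using Nat.le_induction with
  | base =>
    intro f t ht k q _ h2
    obtain ⟨e, -⟩ := h2
    have := (e.symm (Classical.arbitrary _)).pos
    omega
  | succ n hn ih =>
    intro f t ht k q h1 h2
    obtain ⟨p, hp⟩ := exists_isSimplex (half_pos ht) hn
    obtain ⟨a, ha, hp'⟩ := hp.exists_map f (half_pos ht) hn
    have h3 := ih f (half_pos ht) hp hp'
    rw [← mul_div_cancel₀ t (two_ne_zero)] at h1 h2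
    have hk : 1 ≤ k := by
      obtain ⟨e, -⟩ := h2
      have := (e.symm (Classical.arbitrary _)).pos
      omega
    have h4 := IsSimplex.gd_le_iff (half_pos ht) (by omega) hp h1
    have h5 := IsSimplex.gd_le_iff (half_pos ht) hk hp' h2
    rw [gd_map, h4] at h5
    omega

theorem IsSimplex.map (f : GHSpace ≃ᵢ GHSpace) {t : ℝ} (ht : 0 < t) {n : ℕ} (hn : 1 ≤ n)
    {q : GHSpace} (h : IsSimplex t n q) : f q = q := by
  obtain ⟨k, hk, hf⟩ := h.exists_map f ht hn
  have h1 := IsSimplex.le_of_map hn f ht h hf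
  have h2 := IsSimplex.le_of_map hk f.symm ht hf (by simpa using h)
  obtain rfl : n = k := le_antisymm h1 h2
  exact Realizes.eq hf h

/-- The action of vertex permutations on edges. -/
def act (n : ℕ) : Equiv.Perm (Fin n) →* Equiv.Perm (Edge n) where
  toFun σ :=
    { toFun := fun e => ⟨e.1.map σ, (Sym2.isDiag_map σ.injective).not.2 e.2⟩
      invFun := fun e => ⟨e.1.map σ.symm, (Sym2.isDiag_map σ.symm.injective).not.2 e.2⟩
      left_inv := fun e => Subtype.ext (by simp [Sym2.map_map])
      right_inv := fun e => Subtype.ext (by simp [Sym2.map_map]) }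
  map_one' := by ext e : 2; simp
  map_mul' σ τ := by ext e : 2; simp [Sym2.map_map]

theorem act_edge {n : ℕ} (σ : Equiv.Perm (Fin n)) (i j : Fin n) (h : i ≠ j) :
    act n σ (edge i j h) = edge (σ i) (σ j) (σ.injective.ne h) := rfl

theorem Edge.ind {n : ℕ} {P : Edge n → Prop} (h : ∀ i j (hij : i ≠ j), P (edge i j hij))
    (e : Edge n) : P e := by
  obtain ⟨s, hs⟩ := e
  induction s with
  | _ i j => exact h i j (by simpa using hs)

theorem exists_pos_le {α : Type*} [Finite α] {x : α → ℝ} (h : ∀ a, 0 < x a) :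
    ∃ g > 0, ∀ a, g ≤ x a := by
  cases isEmpty_or_nonempty α
  · exact ⟨1, one_pos, isEmptyElim⟩
  · obtain ⟨a, ha⟩ := Finite.exists_min x
    exact ⟨x a, h a, ha⟩

theorem exists_pos_ge {α : Type*} [Finite α] (x : α → ℝ) : ∃ M > 0, ∀ a, x a ≤ M := by
  cases isEmpty_or_nonempty α
  · exact ⟨1, one_pos, isEmptyElim⟩
  · obtain ⟨a, ha⟩ := Finite.exists_max x
    exact ⟨max (x a) 1, by positivity, fun b => (ha b).trans (le_max_left _ _)⟩

theorem eq_comp_of_le_comp {α : Type*} [Finite α] {x : α → ℝ} {g : Equiv.Perm α}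
    (h : ∀ a, x a ≤ x (g a)) (a : α) : x a = x (g a) := by
  have := Fintype.ofFinite α
  exact (Finset.sum_eq_sum_iff_of_le fun a _ => h a).1 (Equiv.sum_comp g x).symm a
    (Finset.mem_univ a)

/-- Almost invariant vectors are invariant. -/
theorem exists_tolerance {α : Type*} [Finite α] (x : α → ℝ) :
    ∃ δ > 0, ∀ g : Equiv.Perm α, (∀ a, x a ≤ x (g a) + δ) → ∀ a, x a = x (g a) := by
  obtain ⟨δ, hδ, h⟩ := exists_pos_le (α := {z : α × α // x z.2 < x z.1})
    (x := fun z => x z.1.1 - x z.1.2) (fun z => sub_pos.2 z.2)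
  refine ⟨δ / 2, half_pos hδ, fun g hg => eq_comp_of_le_comp fun a => ?_⟩
  by_contra! hlt
  have := h ⟨(a, g a), hlt⟩
  have := hg a
  dsimp only at *
  linarith

theorem IsSimplex.exists_labels {t : ℝ} {m : ℕ} {A q : GHSpace} (h : IsSimplex t m q)
    (hlt : gd A q < t) : ∃ ℓ : A.Rep → Fin m, Function.Surjective ℓ ∧
      (∀ x y, ℓ x ≠ ℓ y → |dist x y - t| ≤ gd A q) ∧ ∀ x y, ℓ x = ℓ y → dist x y ≤ gd A q := by
  obtain ⟨e, he⟩ := h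
  obtain ⟨R, hR⟩ := exists_isCorr_gd A q
  choose φ hφ using hR.left
  refine ⟨fun x => e.symm (φ x), fun j => ?_, fun x y hxy => ?_, fun x y hxy => ?_⟩
  · obtain ⟨a, ha⟩ := hR.right (e j)
    refine ⟨a, ?_⟩
    by_contra hne
    have := abs_le.1 (hR.dist_le ha (hφ a))
    obtain ⟨i, hi⟩ := e.surjective (φ a)
    rw [← hi, dist_self, he j i (by rintro rfl; simp [← hi] at hne)] at this
    linarith
  · have := hR.dist_le (hφ x) (hφ y)
    have h2 := he _ _ hxy
    simp only [Equiv.apply_symm_apply] at h2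
    rwa [h2] at this
  · have := hR.dist_le (hφ x) (hφ y)
    rw [e.symm.injective hxy, dist_self, sub_zero] at this
    exact (le_abs_self _).trans this

/-- `A` splits into `m` nonempty pieces with positive mutual distances. -/
def Comp (A : GHSpace) (m : ℕ) : Prop := ∃ t > 0, ∃ q, IsSimplex t m q ∧ gd A q < t

theorem gd_simplex_le {t : ℝ} {m : ℕ} {A q : GHSpace} (h : IsSimplex t m q)
    {ℓ : A.Rep → Fin m} (hℓ : Function.Surjective ℓ) {D : ℝ}
    (h1 : ∀ x y, ℓ x ≠ ℓ y → |dist x y - t| ≤ D) (h2 : ∀ x y, ℓ x = ℓ y → dist x y ≤ D) :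
    gd A q ≤ D := by
  obtain ⟨e, he⟩ := h
  refine gd_le_of_surjective (e.surjective.comp hℓ) fun x y => ?_
  dsimp only [Function.comp]
  by_cases hxy : ℓ x = ℓ y
  · rw [hxy, dist_self, sub_zero, abs_of_nonneg dist_nonneg]; exact h2 x y hxy
  · rw [he _ _ hxy]; exact h1 x y hxy

theorem comp_of_labels {A : GHSpace} {m : ℕ} {ℓ : A.Rep → Fin m} (hℓ : Function.Surjective ℓ)
    {g : ℝ} (hg : 0 < g) (h : ∀ x y, ℓ x ≠ ℓ y → g ≤ dist x y) : Comp A m := by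
  obtain ⟨M, hM, hle⟩ := exists_dist_le A
  have hm : 1 ≤ m := by have := (ℓ (Classical.arbitrary _)).pos; omega
  obtain ⟨q, hq⟩ := exists_isSimplex (t := M + g) (by positivity) hm
  refine ⟨M + g, by positivity, q, hq,
    (gd_simplex_le hq hℓ (D := M) (fun x y hxy => ?_) (fun x y _ => hle x y)).trans_lt (by linarith)⟩
  rw [abs_le]
  constructor <;> linarith [h x y hxy, hle x y]

theorem Comp.exists_labels {A : GHSpace} {m : ℕ} (h : Comp A m) : ∃ ℓ : A.Rep → Fin m,
    Function.Surjective ℓ ∧ ∃ g > 0, ∀ x y, ℓ x ≠ ℓ y → g ≤ dist x y := by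
  obtain ⟨t, -, q, hq, hlt⟩ := h
  obtain ⟨ℓ, h1, h2, -⟩ := hq.exists_labels hlt
  refine ⟨ℓ, h1, t - gd A q, by linarith, fun x y hxy => ?_⟩
  linarith [(abs_le.1 (h2 x y hxy)).1]

theorem Comp.map (f : GHSpace ≃ᵢ GHSpace) {A : GHSpace} {m : ℕ} (h : Comp A m) :
    Comp (f A) m := by
  obtain ⟨ℓ, -⟩ := h.exists_labels
  have hm : 1 ≤ m := by have := (ℓ (Classical.arbitrary _)).pos; omega
  obtain ⟨t, ht, q, hq, hlt⟩ := h
  refine ⟨t, ht, q, hq, ?_⟩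
  rwa [← hq.map f ht hm, gd_map]

theorem comp_succ_of_split {A : GHSpace} {m : ℕ} {ℓ : A.Rep → Fin m}
    (hℓ : Function.Surjective ℓ) {g : ℝ} (hg : 0 < g) (h : ∀ x y, ℓ x ≠ ℓ y → g ≤ dist x y)
    {Q : A.Rep → Prop} {a b : A.Rep} (ha : Q a) (hb : ¬ Q b) (hab : ℓ a = ℓ b) {g' : ℝ}
    (hg' : 0 < g') (hQ : ∀ x y, Q x → ¬ Q y → g' ≤ dist x y) : Comp A (m + 1) := by
  classical
  let ℓ' : A.Rep → Option (Fin m) := fun x => if Q x ∧ ℓ x = ℓ a then none else some (ℓ x)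
  refine comp_of_labels (ℓ := fun x => (finSuccEquiv m).symm (ℓ' x))
    ((finSuccEquiv m).symm.surjective.comp ?_) (lt_min hg hg') fun x y hxy => ?_
  · rintro (_ | j)
    · exact ⟨a, if_pos ⟨ha, rfl⟩⟩
    · by_cases hj : j = ℓ a
      · exact ⟨b, by simp [ℓ', hb, hj, hab]⟩
      · obtain ⟨x, rfl⟩ := hℓ j
        exact ⟨x, by simp [ℓ', hj]⟩
  · by_cases hl : ℓ x = ℓ y
    · refine (min_le_right _ _).trans ?_
      by_cases hx : Q x
      · by_cases hy : Q y
        · simp [ℓ', hl, hx, hy] at hxy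
        · exact hQ x y hx hy
      · by_cases hy : Q y
        · rw [dist_comm]; exact hQ y x hy hx
        · simp [ℓ', hl, hx, hy] at hxy
    · exact (min_le_left _ _).trans (h x y hl)

theorem Realizes.comp {n : ℕ} {x : Edge n → ℝ} {A : GHSpace} (h : Realizes x A) : Comp A n := by
  obtain ⟨g, hg, hle⟩ := exists_pos_le h.met.pos
  obtain ⟨e, he⟩ := h
  refine comp_of_labels e.symm.surjective hg fun a b hab => ?_
  have := he _ _ hab
  simp only [Equiv.apply_symm_apply] at this
  rw [this]
  exact hle _

theorem Realizes.not_comp_succ {n : ℕ} {x : Edge n → ℝ} {A : GHSpace} (h : Realizes x A) :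
    ¬ Comp A (n + 1) := by
  intro hc
  obtain ⟨e, -⟩ := h
  obtain ⟨ℓ, hℓ, -⟩ := hc.exists_labels
  have := Fintype.card_le_of_surjective _ (hℓ.comp e.surjective)
  simp at this

/-- A metric substitute for domination: `B` is closer than `A` to every space that is
far away and close to a simplex with `n` points. -/
def Le (n : ℕ) (A B : GHSpace) : Prop := ∃ T : ℝ, ∀ t, T ≤ t → ∀ q Z, IsSimplex t n q →
  gd Z q ≤ t / 4 → gd Z q + gd A Z < t → gd B Z ≤ gd A Z

theorem Le.map (f : GHSpace ≃ᵢ GHSpace) {n : ℕ} (hn : 1 ≤ n) {A B : GHSpace} (h : Le n A B) :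
    Le n (f A) (f B) := by
  obtain ⟨T, hT⟩ := h
  refine ⟨max T 1, fun t ht q Z hq h1 h2 => ?_⟩
  have ht0 : 0 < t := lt_of_lt_of_le one_pos ((le_max_right _ _).trans ht)
  have := hT t ((le_max_left _ _).trans ht) q (f.symm Z) hq
  rw [← gd_map f, ← gd_map f A, ← gd_map f B, hq.map f ht0 hn, f.apply_symm_apply] at this
  exact this h1 h2

theorem IsSimplex.le_gd {t : ℝ} {n : ℕ} (hn : 2 ≤ n) {q Z A : GHSpace} (hq : IsSimplex t n q)
    (hZ : gd Z q ≤ t / 4) {M : ℝ} (hM : ∀ x y : A.Rep, dist x y ≤ M) :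
    3 * t / 4 - M ≤ gd A Z := by
  obtain ⟨e, he⟩ := hq
  have h01 : (⟨0, by omega⟩ : Fin n) ≠ ⟨1, by omega⟩ := by simp
  have h1 := dist_le_add_gd (dist_le_add_gd hM (q := Z)) (e ⟨0, by omega⟩) (e ⟨1, by omega⟩)
  rw [he _ _ h01] at h1
  linarith

theorem Le.of_dist_le {n : ℕ} (hn : 2 ≤ n) {A B : GHSpace} (e : A.Rep ≃ B.Rep)
    (h : ∀ x y, dist x y ≤ dist (e x) (e y)) : Le n A B := by
  obtain ⟨M, hM, hA⟩ := exists_dist_le A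
  obtain ⟨N, hN, hB⟩ := exists_dist_le B
  refine ⟨4 * (M + N), fun t ht q Z hq h1 _ => ?_⟩
  have h3 := hq.le_gd hn h1 hA
  obtain ⟨R, hR⟩ := exists_isCorr_gd A Z
  refine gd_le_of_isCorr (R := fun b z => R (e.symm b) z) ⟨fun b => hR.left _, fun z => ?_, ?_⟩
  · obtain ⟨a, ha⟩ := hR.right z
    exact ⟨e a, by simpa using ha⟩
  · intro b z b' z' h4 h5
    have h6 := abs_le.1 (hR.dist_le h4 h5)
    have h7 := h (e.symm b) (e.symm b')
    simp only [Equiv.apply_symm_apply] at h7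
    rw [abs_le]
    constructor
    · linarith
    · linarith [hB b b', dist_nonneg (x := z) (y := z')]

theorem Realizes.exists_perm {n : ℕ} {x : Edge n → ℝ} {A Z : GHSpace} (hA : Realizes x A)
    {ℓ : Z.Rep → Fin n} (hℓ : Function.Surjective ℓ) {D : ℝ} (hD : gd A Z ≤ D)
    (hlt : ∀ z z', ℓ z ≠ ℓ z' → D < dist z z') : ∃ σ : Equiv.Perm (Fin n),
      ∀ z z' (h : ℓ z ≠ ℓ z'), |x (act n σ (edge (ℓ z) (ℓ z') h)) - dist z z'| ≤ D := by
  obtain ⟨e, he⟩ := hA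
  obtain ⟨R, hR⟩ := exists_isCorr_gd A Z
  choose φ hφ using hR.left
  have key : ∀ a z z', R a z → R a z' → ℓ z = ℓ z' := fun a z z' h h' => by
    by_contra hne
    have := abs_le.1 (hR.dist_le h h')
    rw [dist_self] at this
    linarith [hlt z z' hne]
  have hs : Function.Surjective fun i => ℓ (φ (e i)) := fun j => by
    obtain ⟨z, rfl⟩ := hℓ j
    obtain ⟨a, ha⟩ := hR.right z
    exact ⟨e.symm a, by simpa using key a _ _ (hφ a) ha⟩
  let τ : Equiv.Perm (Fin n) := Equiv.ofBijective _ (Finite.surjective_iff_bijective.1 hs)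
  refine ⟨τ.symm, fun z z' h => ?_⟩
  obtain ⟨a, ha⟩ := hR.right z
  obtain ⟨a', ha'⟩ := hR.right z'
  have h1 : ∀ a z, R a z → e (τ.symm (ℓ z)) = a := fun a z ha => by
    rw [← Equiv.eq_symm_apply, Equiv.symm_apply_eq]
    change _ = ℓ (φ (e (e.symm a)))
    rw [e.apply_symm_apply]
    exact key a _ _ ha (hφ a)
  rw [act_edge, ← he, h1 a z ha, h1 a' z' ha']
  exact (hR.dist_le ha ha').trans hD

theorem Realizes.exists_perm' {n : ℕ} {x y : Edge n → ℝ} {A B : GHSpace} (hA : Realizes x A)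
    (hB : Realizes y B) {D : ℝ} (hD : gd A B ≤ D) (hlt : ∀ e, D < y e) :
    ∃ σ : Equiv.Perm (Fin n), ∀ e, |x (act n σ e) - y e| ≤ D := by
  obtain ⟨e, he⟩ := hB
  obtain ⟨σ, hσ⟩ := hA.exists_perm e.symm.surjective hD (fun z z' h => by
    have := he _ _ h
    simp only [Equiv.apply_symm_apply] at this
    rw [this]
    exact hlt _)
  refine ⟨σ, Edge.ind fun i j hij => ?_⟩
  have := hσ (e i) (e j) (by simpa using hij)
  rw [he i j hij] at this
  simpa using this

theorem Realizes.gd_le {n : ℕ} {x y : Edge n → ℝ} {A B : GHSpace} (hA : Realizes x A)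
    (hB : Realizes y B) {D : ℝ} (hD : 0 ≤ D) (h : ∀ e, |x e - y e| ≤ D) : gd A B ≤ D := by
  obtain ⟨e, he⟩ := hA
  obtain ⟨e', he'⟩ := hB
  refine gd_le_of_surjective (e.symm.trans e').surjective fun a b => ?_
  obtain ⟨i, rfl⟩ := e.surjective a
  obtain ⟨j, rfl⟩ := e.surjective b
  simp only [Equiv.trans_apply, Equiv.symm_apply_apply]
  by_cases hij : i = j
  · subst hij; simpa using hD
  · rw [he i j hij, he' i j hij]; exact h _

theorem Met.add_const {n : ℕ} {x : Edge n → ℝ} (h : Met x) {c : ℝ} (hc : 0 ≤ c) :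
    Met (fun e => x e + c) :=
  ⟨fun e => add_pos_of_pos_of_nonneg (h.pos e) hc, fun i j k hij hjk hik => by
    linarith [h.triangle i j k hij hjk hik]⟩

theorem Le.exists_perm {n : ℕ} (hn : 1 ≤ n) {x y : Edge n → ℝ} {A B : GHSpace}
    (hA : Realizes x A) (hB : Realizes y B) (h : Le n A B) :
    ∃ σ : Equiv.Perm (Fin n), ∀ e, x e ≤ y (act n σ e) := by
  obtain ⟨T, hT⟩ := h
  obtain ⟨g, hg, hgx⟩ := exists_pos_le hA.met.pos
  obtain ⟨M, hM, hxM⟩ := exists_pos_ge x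
  have hl : ∃ l, 0 < l ∧ T ≤ l ∧ 3 * (M + g) ≤ l :=
    ⟨max T (3 * (M + g)), by positivity, le_max_left _ _, le_max_right _ _⟩
  obtain ⟨l, hl, hlT, hlM⟩ := hl
  obtain ⟨Z, hZ⟩ := Met.exists_realizes hn (hA.met.add_const hl.le)
  obtain ⟨q, hq⟩ := exists_isSimplex (t := l + (M + g)) (by positivity) hn
  have h1 : gd Z q ≤ M := hZ.gd_le hq hM.le fun e => by
    rw [abs_le]; constructor <;> linarith [hgx e, hxM e]
  have h2 : gd A Z ≤ l := hA.gd_le hZ hl.le fun e => by simp [abs_of_pos hl]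
  have h3 := hT _ (by linarith) q Z hq (by linarith) (by linarith)
  obtain ⟨σ, hσ⟩ := hB.exists_perm' hZ (h3.trans h2) (fun e => by linarith [hgx e])
  exact ⟨σ, fun e => by linarith [(abs_le.1 (hσ e)).1]⟩

/-- A metric characterisation of the spaces with exactly `n` points. -/
def HasNPoints (n : ℕ) (A : GHSpace) : Prop := Comp A n ∧ ¬ Comp A (n + 1) ∧
  ∃ δ > 0, ∀ B C, gd A B < δ → gd A C < δ → Le n B A → Le n C A →
    gd B C ≤ max (gd A B) (gd A C)

theorem HasNPoints.map (f : GHSpace ≃ᵢ GHSpace) {n : ℕ} (hn : 1 ≤ n) {A : GHSpace}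
    (h : HasNPoints n A) : HasNPoints n (f A) := by
  obtain ⟨h1, h2, δ, hδ, h3⟩ := h
  refine ⟨h1.map f, fun hc => h2 (by simpa using hc.map f.symm), δ, hδ, fun B C hB hC hB' hC' => ?_⟩
  have := h3 (f.symm B) (f.symm C)
  rw [← gd_map f A, ← gd_map f A, ← gd_map f (f.symm B)] at this
  simp only [f.apply_symm_apply] at this
  exact this hB hC (by simpa using hB'.map f.symm hn) (by simpa using hC'.map f.symm hn)

/-- Stretch the distances between different labels by a constant. -/
theorem exists_stretch {B : GHSpace} {ι : Type*} (ℓ : B.Rep → ι) {g l : ℝ} (hg : 0 < g)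
    (hl : 0 < l) (hℓ : ∀ x y, ℓ x ≠ ℓ y → g ≤ dist x y) :
    ∃ (Z : GHSpace) (e : B.Rep ≃ Z.Rep),
      (∀ x y, ℓ x ≠ ℓ y → dist (e x) (e y) = dist x y + l) ∧
      (∀ x y, ℓ x = ℓ y → dist (e x) (e y) = dist x y) := by
  classical
  obtain ⟨Z, e, he⟩ := exists_realization_of_le
    (fun x y : B.Rep => if ℓ x = ℓ y then dist x y else dist x y + l) (by simp)
    (fun x y h => by
      split_ifs at h
      · exact dist_eq_zero.1 h
      · linarith [dist_nonneg (x := x) (y := y)])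
    (fun x y => by simp only [dist_comm, eq_comm])
    (fun x y z => by
      have := dist_triangle x y z
      split_ifs <;> first | linarith | (exfalso; simp_all))
    (K := 1 + l / g) (fun x y => by
      split_ifs with h
      · exact le_mul_of_one_le_left dist_nonneg (le_add_of_nonneg_right (by positivity))
      · have : l ≤ l / g * dist x y := by
          rw [div_mul_eq_mul_div, le_div_iff₀ hg]
          gcongr; exact hℓ x y h
        linarith)
  exact ⟨Z, e, fun x y h => by rw [he, if_neg h], fun x y h => by rw [he, if_pos h]⟩

theorem Realizes.exists_near {n : ℕ} (hn : 1 ≤ n) {x : Edge n → ℝ} {A : GHSpace}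
    (hA : Realizes x A) : ∃ δ > 0, ∀ B, gd A B < δ → Le n B A → ∃ ℓ : B.Rep → Fin n,
      Function.Surjective ℓ ∧ (∀ b b', ℓ b = ℓ b' → dist b b' ≤ gd A B) ∧
      ∀ b b' (h : ℓ b ≠ ℓ b'), x (edge (ℓ b) (ℓ b') h) - gd A B ≤ dist b b' ∧
        dist b b' ≤ x (edge (ℓ b) (ℓ b') h) := by
  obtain ⟨g, hg, hgx⟩ := exists_pos_le hA.met.pos
  obtain ⟨η, hη, hηx⟩ := exists_tolerance x
  refine ⟨min (g / 2) η, lt_min (half_pos hg) hη, fun B hB hBA => ?_⟩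
  have hB1 := hB.trans_le (min_le_left _ _)
  have hB2 := hB.trans_le (min_le_right _ _)
  have hA' := hA
  obtain ⟨e, he⟩ := hA'
  obtain ⟨R, hR⟩ := exists_isCorr_gd A B
  choose φ hφ using hR.right
  let ℓ : B.Rep → Fin n := fun b => e.symm (φ b)
  have hℓ : ∀ b, e (ℓ b) = φ b := fun b => e.apply_symm_apply _
  have hsame : ∀ b b', ℓ b = ℓ b' → dist b b' ≤ gd A B := fun b b' h => by
    have := hR.dist_le (hφ b) (hφ b')
    rw [← hℓ b, ← hℓ b', h, dist_self, zero_sub, abs_neg] at this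
    exact (le_abs_self _).trans this
  have hcross : ∀ b b' (h : ℓ b ≠ ℓ b'), |x (edge (ℓ b) (ℓ b') h) - dist b b'| ≤ gd A B :=
    fun b b' h => by
      have := hR.dist_le (hφ b) (hφ b')
      rwa [← hℓ b, ← hℓ b', he _ _ h] at this
  have hsurj : Function.Surjective ℓ := fun j => by
    obtain ⟨b, hb⟩ := hR.left (e j)
    refine ⟨b, ?_⟩
    by_contra hne
    have := abs_le.1 (hR.dist_le hb (hφ b))
    rw [dist_self, ← hℓ b, he _ _ (Ne.symm hne)] at this
    linarith [hgx (edge _ _ (Ne.symm hne))]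
  have hgap : ∀ b b', ℓ b ≠ ℓ b' → g / 2 ≤ dist b b' := fun b b' h => by
    linarith [(abs_le.1 (hcross b b' h)).2, hgx (edge _ _ h)]
  obtain ⟨M, hM, hBM⟩ := exists_dist_le B
  obtain ⟨T, hT⟩ := hBA
  obtain ⟨l, hl, hlT, hlM⟩ : ∃ l, 0 < l ∧ T ≤ l ∧ 3 * (M + g) ≤ l :=
    ⟨max T (3 * (M + g)), by positivity, le_max_left _ _, le_max_right _ _⟩
  obtain ⟨Z, e', he1, he2⟩ := exists_stretch ℓ (half_pos hg) hl hgap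
  obtain ⟨q, hq⟩ := exists_isSimplex (t := l + (M + g)) (by positivity) hn
  have hcross' : ∀ z z', ℓ (e'.symm z) ≠ ℓ (e'.symm z') →
      dist z z' = dist (e'.symm z) (e'.symm z') + l := fun z z' h => by
    simpa using he1 _ _ h
  have h1 : gd Z q ≤ M + g / 2 := by
    refine gd_simplex_le hq (ℓ := fun z => ℓ (e'.symm z)) (hsurj.comp e'.symm.surjective)
      (fun z z' h => ?_) (fun z z' h => ?_)
    · rw [hcross' z z' h, abs_le]
      constructor <;> linarith [hgap _ _ h, hBM (e'.symm z) (e'.symm z')]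
    · have := he2 _ _ h
      simp only [Equiv.apply_symm_apply] at this
      rw [this]
      linarith [hBM (e'.symm z) (e'.symm z')]
  have h2 : gd B Z ≤ l := gd_le_of_surjective e'.surjective fun b b' => by
    by_cases h : ℓ b = ℓ b'
    · rw [he2 _ _ h]; simpa using hl.le
    · rw [he1 _ _ h]; simp [abs_of_pos hl]
  have h3 := hT _ (by linarith) q Z hq (by linarith) (by linarith)
  obtain ⟨σ, hσ⟩ := hA.exists_perm (ℓ := fun z => ℓ (e'.symm z))
    (hsurj.comp e'.symm.surjective) (h3.trans h2) (fun z z' h => by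
      rw [hcross' z z' h]; linarith [hgap _ _ h])
  have hσ' : ∀ b b' (h : ℓ b ≠ ℓ b'), dist b b' ≤ x (act n σ (edge (ℓ b) (ℓ b') h)) := by
    intro b b' h
    have := hσ (e' b) (e' b') (by simpa using h)
    rw [he1 _ _ h] at this
    simp only [Equiv.symm_apply_apply] at this
    linarith [(abs_le.1 this).1]
  have hinv := hηx (act n σ) (Edge.ind fun i j hij => by
    obtain ⟨b, rfl⟩ := hsurj i
    obtain ⟨b', rfl⟩ := hsurj j
    linarith [hσ' b b' hij, (abs_le.1 (hcross b b' hij)).2])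
  refine ⟨ℓ, hsurj, hsame, fun b b' h => ⟨?_, ?_⟩⟩
  · linarith [(abs_le.1 (hcross b b' h)).2]
  · rw [hinv]; exact hσ' b b' h

theorem Realizes.hasNPoints {n : ℕ} (hn : 1 ≤ n) {x : Edge n → ℝ} {A : GHSpace}
    (hA : Realizes x A) : HasNPoints n A := by
  obtain ⟨δ, hδ, h⟩ := hA.exists_near hn
  refine ⟨hA.comp, hA.not_comp_succ, δ, hδ, fun B C hB hC hB' hC' => ?_⟩
  obtain ⟨ℓ, h1, h2, h3⟩ := h B hB hB'
  obtain ⟨ℓ', h1', h2', h3'⟩ := h C hC hC'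
  have m1 := le_max_left (gd A B) (gd A C)
  have m2 := le_max_right (gd A B) (gd A C)
  refine gd_le_of_isCorr (R := fun b c => ℓ b = ℓ' c) ⟨fun b => ?_, fun c => ?_, ?_⟩
  · obtain ⟨c, hc⟩ := h1' (ℓ b)
    exact ⟨c, hc.symm⟩
  · exact h1 (ℓ' c)
  · intro b c b' c' hbc hbc'
    rw [abs_le]
    by_cases hb : ℓ b = ℓ b'
    · have := h2 _ _ hb
      have := h2' c c' (by rw [← hbc, ← hbc', hb])
      constructor <;> linarith [dist_nonneg (x := b) (y := b'), dist_nonneg (x := c) (y := c')]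
    · have h4 := h3 _ _ hb
      have hc : ℓ' c ≠ ℓ' c' := by rwa [← hbc, ← hbc']
      have h5 := h3' _ _ hc
      have : edge (ℓ' c) (ℓ' c') hc = edge (ℓ b) (ℓ b') hb := by simp only [hbc, hbc']
      rw [this] at h5
      constructor <;> linarith [h4.1, h4.2, h5.1, h5.2]

theorem exists_realizes_of_equiv {n : ℕ} {A : GHSpace} (e : Fin n ≃ A.Rep) :
    ∃ x : Edge n → ℝ, Realizes x A :=
  ⟨fun s => Sym2.lift ⟨fun i j => dist (e i) (e j), fun _ _ => dist_comm _ _⟩ s.1, e,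
    fun _ _ _ => rfl⟩

/-- Enlarging distances within the pieces of `A` does not change the distance to spaces
that are far away and close to a simplex. -/
theorem le_of_enlarge {n : ℕ} (hn : 2 ≤ n) {A B : GHSpace} (hA : ¬ Comp A (n + 1))
    {ℓ : A.Rep → Fin n} (hℓ : Function.Surjective ℓ) {g : ℝ} (hg : 0 < g)
    (hgap : ∀ x y, ℓ x ≠ ℓ y → g ≤ dist x y) (e : A.Rep ≃ B.Rep)
    (hcross : ∀ x y, ℓ x ≠ ℓ y → dist (e x) (e y) = dist x y)
    (hle : ∀ x y, dist x y ≤ dist (e x) (e y)) {K : ℝ} (hK : 0 < K)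
    (hBK : ∀ x y, dist (e x) (e y) ≤ K * dist x y) : Le n B A := by
  obtain ⟨M, hM, hBM⟩ := exists_dist_le B
  refine ⟨2 * M, fun t ht q Z hq h1 h2 => ?_⟩
  have h3 := hq.le_gd hn h1 hBM
  have hlt : gd Z q < t := by linarith
  obtain ⟨m, hm, hm1, hm2⟩ := hq.exists_labels hlt
  obtain ⟨R, hR⟩ := exists_isCorr_gd B Z
  choose φ hφ using hR.left
  have hfun : ∀ b z, R b z → m z = m (φ b) := fun b z hb => by
    by_contra hne
    have := abs_le.1 (hR.dist_le hb (hφ b))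
    rw [dist_self] at this
    linarith [(abs_le.1 (hm1 _ _ hne)).1]
  have hlab : ∀ a a', ℓ a = ℓ a' → m (φ (e a)) = m (φ (e a')) := by
    intro a a' haa
    by_contra hne
    refine hA (comp_succ_of_split hℓ hg hgap (Q := fun c => m (φ (e c)) = m (φ (e a))) (a := a)
      (b := a') rfl (Ne.symm hne) haa (g' := (t - gd Z q - gd B Z) / K)
      (div_pos (by linarith) hK) fun x y hx hy => ?_)
    have hxy : m (φ (e x)) ≠ m (φ (e y)) := fun h => hy (h ▸ hx)
    rw [div_le_iff₀' hK]
    linarith [(abs_le.1 (hm1 _ _ hxy)).1, (abs_le.1 (hR.dist_le (hφ (e x)) (hφ (e y)))).1,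
      hBK x y]
  refine gd_le_of_isCorr (R := fun a z => R (e a) z) ⟨fun a => hR.left _, fun z => ?_, ?_⟩
  · obtain ⟨b, hb⟩ := hR.right z
    exact ⟨e.symm b, by simpa using hb⟩
  · intro a z a' z' h4 h5
    have h6 := hR.dist_le h4 h5
    by_cases haa : ℓ a = ℓ a'
    · have h7 : m z = m z' := by rw [hfun _ _ h4, hfun _ _ h5, hlab a a' haa]
      rw [abs_le] at h6 ⊢
      constructor <;> linarith [hm2 _ _ h7, dist_nonneg (x := a) (y := a'), hle a a']
    · rwa [hcross a a' haa] at h6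

theorem HasNPoints.exists_realizes {n : ℕ} (hn : 2 ≤ n) {A : GHSpace} (h : HasNPoints n A) :
    ∃ x : Edge n → ℝ, Realizes x A := by
  obtain ⟨h1, h2, δ, hδ, h3⟩ := h
  obtain ⟨ℓ, hℓ, g, hg, hgap⟩ := h1.exists_labels
  by_cases hinj : Function.Injective ℓ
  · exact exists_realizes_of_equiv (Equiv.ofBijective ℓ ⟨hinj, hℓ⟩).symm
  exfalso
  have hinf : Infinite A.Rep := by
    by_contra hfin
    rw [not_infinite_iff_finite] at hfin
    obtain ⟨a, b, hab, hne⟩ := Function.not_injective_iff.1 hinj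
    obtain ⟨g', hg', hle⟩ := exists_pos_le (α := {c // c ≠ a}) (x := fun c => dist a c)
      (fun c => dist_pos.2 c.2.symm)
    exact h2 (comp_succ_of_split hℓ hg hgap (Q := fun c => c = a) rfl (Ne.symm hne) hab hg'
      fun x y hx hy => hx ▸ hle ⟨y, hy⟩)
  obtain ⟨k, hk⟩ := exists_not_sep A (half_pos hg)
  obtain ⟨u⟩ : Nonempty (Fin k ↪ A.Rep) := ⟨(Fin.valEmbedding).trans (Infinite.natEmbedding _)⟩
  obtain ⟨r₀, hr₀, hS⟩ := exists_sep_of_injective u.injective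
  obtain ⟨M, hM, hAM⟩ := exists_dist_le A
  have hsδ := min_le_left (δ / 2) (g / 2)
  have hsg := min_le_right (δ / 2) (g / 2)
  have hs : 0 < min (δ / 2) (g / 2) := by positivity
  obtain ⟨B, C, e, e', hcross, hle, -, hle', hB, hC, hBC, K, hK, hBK⟩ := exists_spread ℓ
    (M := M + g) (s := min (δ / 2) (g / 2)) hgap (fun x y => by linarith [hAM x y]) hr₀ hS hk
    hs (by linarith) (by linarith)
  have h4 : Le n C A := Le.of_dist_le hn e'.symm fun x y => by
    have := hle' (e'.symm x) (e'.symm y)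
    simpa using this
  have h5 := le_of_enlarge hn h2 hℓ hg hgap e hcross hle hK hBK
  linarith [h3 B C (by linarith) (by linarith) h5 h4, max_le hB hC]

theorem Realizes.exists_map (f : GHSpace ≃ᵢ GHSpace) {n : ℕ} (hn : 2 ≤ n) {x : Edge n → ℝ}
    {A : GHSpace} (hA : Realizes x A) : ∃ y : Edge n → ℝ, Realizes y (f A) :=
  ((hA.hasNPoints (by omega)).map f (by omega)).exists_realizes hn

section OrbitOrder

theorem perm_apply_inv_apply {α : Type*} (σ : Equiv.Perm α) (a : α) : σ (σ⁻¹ a) = a :=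
  σ.apply_symm_apply a

theorem perm_inv_apply_apply {α : Type*} (σ : Equiv.Perm α) (a : α) : σ⁻¹ (σ a) = a :=
  σ.symm_apply_apply a

variable {ι : Type*} {G : Subgroup (Equiv.Perm ι)}

/-- `x` and `y` agree up to a permutation in `G`. -/
def Eqv (G : Subgroup (Equiv.Perm ι)) (x y : ι → ℝ) : Prop := ∃ g ∈ G, ∀ i, x i = y (g i)

/-- `x` is dominated by `y` up to a permutation in `G`. -/
def Pre (G : Subgroup (Equiv.Perm ι)) (x y : ι → ℝ) : Prop := ∃ g ∈ G, ∀ i, x i ≤ y (g i)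

theorem Eqv.refl (x : ι → ℝ) : Eqv G x x := ⟨1, G.one_mem, fun _ => rfl⟩

theorem Eqv.symm {x y : ι → ℝ} : Eqv G x y → Eqv G y x := fun ⟨g, hg, h⟩ =>
  ⟨g⁻¹, G.inv_mem hg, fun i => by rw [h]; simp⟩

theorem Eqv.trans {x y z : ι → ℝ} : Eqv G x y → Eqv G y z → Eqv G x z :=
  fun ⟨g, hg, h⟩ ⟨g', hg', h'⟩ => ⟨g' * g, G.mul_mem hg' hg, fun i => by rw [h, h']; rfl⟩

theorem Eqv.pre {x y : ι → ℝ} : Eqv G x y → Pre G x y := fun ⟨g, hg, h⟩ =>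
  ⟨g, hg, fun i => (h i).le⟩

theorem Pre.trans {x y z : ι → ℝ} : Pre G x y → Pre G y z → Pre G x z :=
  fun ⟨g, hg, h⟩ ⟨g', hg', h'⟩ => ⟨g' * g, G.mul_mem hg' hg, fun i => (h i).trans (h' _)⟩

theorem Pre.of_le {x y : ι → ℝ} (h : ∀ i, x i ≤ y i) : Pre G x y := ⟨1, G.one_mem, h⟩

theorem Eqv.add_const {x y : ι → ℝ} (c : ℝ) : Eqv G x y →
    Eqv G (fun i => x i + c) (fun i => y i + c) := fun ⟨g, hg, h⟩ => ⟨g, hg, fun i => congrArg (· + c) (h i)⟩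

/-- `F` and `F'` induce inverse automorphisms of the preorder `Pre G`, compatible with
adding constants. -/
structure IsAuto (G : Subgroup (Equiv.Perm ι)) (F F' : (ι → ℝ) → ι → ℝ) : Prop where
  pre : ∀ {x y}, Pre G x y → Pre G (F x) (F y)
  pre' : ∀ {x y}, Pre G x y → Pre G (F' x) (F' y)
  add : ∀ x c, Eqv G (F fun i => x i + c) (fun i => F x i + c)
  add' : ∀ x c, Eqv G (F' fun i => x i + c) (fun i => F' x i + c)
  right_inv : ∀ x, Eqv G (F (F' x)) x
  left_inv : ∀ x, Eqv G (F' (F x)) x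

variable {F F' : (ι → ℝ) → ι → ℝ}

theorem IsAuto.symm (h : IsAuto G F F') : IsAuto G F' F :=
  ⟨h.pre', h.pre, h.add', h.add, h.left_inv, h.right_inv⟩

/-- Tolerance: permutations that move `x` by at most `δ` fix it. -/
def Tol (x : ι → ℝ) (δ : ℝ) : Prop :=
  ∀ g : Equiv.Perm ι, (∀ a, x a ≤ x (g a) + δ) → ∀ a, x a = x (g a)

theorem IsAuto.exists_lift (h : IsAuto G F F') {x x' : ι → ℝ} (hx : Eqv G (F x) x') {t : ℝ}
    (hx' : Tol x' (4 * t)) {c : ℝ} (hct : c ≤ t) (hc : 0 ≤ c) {v : ι → ℝ}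
    (hv : ∀ i, |v i| ≤ c) :
    ∃ u : ι → ℝ, (∀ i, |u i| ≤ c) ∧ Eqv G (F fun i => x i + v i) (fun i => x' i + u i) := by
  have h1 : Pre G (fun i => x' i + -c) (F fun i => x i + v i) :=
    ((hx.add_const (-c)).symm.trans (h.add x (-c)).symm).pre.trans
      (h.pre (Pre.of_le fun i => by linarith [(abs_le.1 (hv i)).1]))
  have h2 : Pre G (F fun i => x i + v i) (fun i => x' i + c) :=
    (h.pre (Pre.of_le fun i => by linarith [(abs_le.1 (hv i)).2])).trans
      ((h.add x c).trans (hx.add_const c)).pre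
  obtain ⟨g, hg, h1⟩ := h1
  obtain ⟨g', hg', h2⟩ := h2
  have h3 := hx' (g' * g) fun a => by
    have := h1 a
    have := h2 (g a)
    rw [Equiv.Perm.mul_apply]
    linarith
  refine ⟨fun i => F (fun i => x i + v i) (g i) - x' i, fun i => ?_, Eqv.symm ⟨g, hg, fun i => by
    ring⟩⟩
  have h4 := h1 i
  have h5 := h2 (g i)
  have h6 := h3 i
  rw [Equiv.Perm.mul_apply] at h6
  rw [abs_le]
  constructor <;> linarith

variable [Finite ι]

theorem Pre.antisymm {x y : ι → ℝ} : Pre G x y → Pre G y x → Eqv G x y :=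
  fun ⟨g, hg, h⟩ ⟨g', _, h'⟩ => ⟨g, hg, fun i => (h i).antisymm (by
    have := eq_comp_of_le_comp (x := x) (g := g' * g) fun i => (h i).trans (h' _)
    rw [this i]; exact h' _)⟩

theorem Pre.of_forall_add {x y : ι → ℝ} (h : ∀ ε > 0, Pre G x (fun i => y i + ε)) :
    Pre G x y := by
  by_contra hcon
  have : ∀ g : G, ∃ i, y (g.1 i) < x i := fun g => by
    by_contra! hle
    exact hcon ⟨g, g.2, hle⟩
  choose i hi using this
  obtain ⟨δ, hδ, hle⟩ := exists_pos_le (x := fun g : G => x (i g) - y (g.1 (i g)))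
    (fun g => sub_pos.2 (hi g))
  obtain ⟨g, hg, hg'⟩ := h (δ / 2) (half_pos hδ)
  have h1 := hle ⟨g, hg⟩
  have h2 := hg' (i ⟨g, hg⟩)
  dsimp only at h1 h2
  linarith

theorem IsAuto.eqv (h : IsAuto G F F') {x y : ι → ℝ} (hxy : Eqv G x y) : Eqv G (F x) (F y) :=
  (h.pre hxy.pre).antisymm (h.pre hxy.symm.pre)

theorem IsAuto.eqv_symm (h : IsAuto G F F') {x y : ι → ℝ} (hxy : Eqv G (F x) y) :
    Eqv G (F' y) x :=
  (h.symm.eqv hxy.symm).trans (h.left_inv x)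

theorem IsAuto.exists_le (h : IsAuto G F F') {x x' : ι → ℝ} (hx : Eqv G (F x) x') {t : ℝ}
    (ht : 0 < t) (hxt : Tol x (4 * t)) (hx' : Tol x' (4 * t)) (e : ι) :
    ∃ k : ι, ∀ u v : ι → ℝ, (∀ i, |u i| ≤ t / 2) → (∀ i, |v i| ≤ t / 2) →
      Eqv G (F fun i => x i + v i) (fun i => x' i + u i) →
      ∃ σ ∈ G, (∀ i, x' i = x' (σ i)) ∧ u (σ k) ≤ v e := by
  classical
  let b : ι → ℝ := fun i => if i = e then 0 else t
  have hb : ∀ i, |b i| ≤ t := fun i => by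
    dsimp only [b]; split_ifs
    · simpa using ht.le
    · rw [abs_of_pos ht]
  obtain ⟨w, hw, hxw⟩ := h.exists_lift hx hx' le_rfl ht.le hb
  have hk : ∃ k, w k ≤ 0 := by
    by_contra! hpos
    obtain ⟨η, hη, hle⟩ := exists_pos_le hpos
    have h1 : Pre G (F fun i => x i + η) (F fun i => x i + b i) :=
      ((h.add x η).trans (hx.add_const η)).pre.trans
        ((Pre.of_le fun i => by linarith [hle i]).trans hxw.symm.pre)
    have h2 := (h.left_inv _).symm.pre.trans ((h.pre' h1).trans (h.left_inv _).pre)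
    obtain ⟨σ, hσ, h2⟩ := h2
    have h3 := hxt σ fun i => by linarith [h2 i, (abs_le.1 (hb (σ i))).2]
    have h4 := h2 (σ⁻¹ e)
    have h5 := h3 (σ⁻¹ e)
    simp only [perm_apply_inv_apply, b, if_true] at h4 h5
    linarith
  obtain ⟨k, hk⟩ := hk
  refine ⟨k, fun u v hu hv huv => ?_⟩
  have h1 : Pre G (fun i => x' i + u i) (fun i => x' i + w i + v e) :=
    huv.symm.pre.trans ((h.pre (Pre.of_le fun i => by
      by_cases hi : i = e
      · simp [b, hi]
      · simp only [b, hi, if_false]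
        linarith [(abs_le.1 (hv i)).2, (abs_le.1 (hv e)).1])).trans
      ((h.add _ (v e)).trans (hxw.add_const (v e))).pre)
  obtain ⟨σ, hσ, h1⟩ := h1
  have h2 := hx' σ fun i => by
    linarith [h1 i, (abs_le.1 (hu i)).1, (abs_le.1 (hw (σ i))).2, (abs_le.1 (hv e)).2]
  refine ⟨σ⁻¹, G.inv_mem hσ, fun i => ?_, ?_⟩
  · have := h2 (σ⁻¹ i)
    simp only [perm_apply_inv_apply] at this
    exact this.symm
  · have h3 := h1 (σ⁻¹ k)
    have h4 := h2 (σ⁻¹ k)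
    simp only [perm_apply_inv_apply] at h3 h4
    linarith

/-- Only the identity of `G` fixes `x`. -/
def Rigid (G : Subgroup (Equiv.Perm ι)) (x : ι → ℝ) : Prop :=
  ∀ σ ∈ G, (∀ i, x i = x (σ i)) → σ = 1

/-- Near a rigid point, an automorphism permutes coordinates and translates. -/
theorem IsAuto.exists_local (h : IsAuto G F F') {x : ι → ℝ} (hr : Rigid G x) :
    ∃ (π : Equiv.Perm ι) (c : ι → ℝ),
      ∀ᶠ y in 𝓝 x, Eqv G (F y) (fun i => y (π i) + c i) := by
  classical
  have := Fintype.ofFinite ι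
  obtain ⟨x', hx⟩ : ∃ x', Eqv G (F x) x' := ⟨_, Eqv.refl _⟩
  obtain ⟨t, ht, hxt, hxt'⟩ : ∃ t > 0, Tol x (4 * t) ∧ Tol x' (4 * t) := by
    obtain ⟨δ, hδ, h1⟩ := exists_tolerance x
    obtain ⟨δ', hδ', h2⟩ := exists_tolerance x'
    refine ⟨min δ δ' / 4, by positivity, fun g hg => h1 g fun a => ?_, fun g hg => h2 g fun a => ?_⟩
    · linarith [hg a, min_le_left δ δ']
    · linarith [hg a, min_le_right δ δ']
  choose k hk using h.exists_le hx ht hxt hxt'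
  choose m hm using h.symm.exists_le (h.eqv_symm hx) ht hxt' hxt
  have hm' : ∀ u v : ι → ℝ, (∀ i, |u i| ≤ t / 2) → (∀ i, |v i| ≤ t / 2) →
      Eqv G (F fun i => x i + v i) (fun i => x' i + u i) → ∀ i, v (m i) ≤ u i := by
    intro u v hu hv huv i
    obtain ⟨σ, hσ, h1, h2⟩ := hm i v u hv hu (h.eqv_symm huv)
    rw [hr σ hσ h1] at h2
    exact h2
  have hlift : ∀ v : ι → ℝ, (∀ i, |v i| ≤ t / 2) → ∃ u : ι → ℝ, (∀ i, |u i| ≤ t / 2) ∧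
      Eqv G (F fun i => x i + v i) (fun i => x' i + u i) := fun v hv =>
    h.exists_lift hx hxt' (by linarith) (by linarith) hv
  let b : ι → ι → ℝ := fun e i => if i = e then -(t / 2) else 0
  have hb : ∀ e i, |b e i| ≤ t / 2 := fun e i => by
    dsimp only [b]; split_ifs
    · rw [abs_neg, abs_of_pos (half_pos ht)]
    · simpa using (half_pos ht).le
  have hb' : ∀ e i, b e i ≤ -(t / 2) → i = e := fun e i hi => by
    by_contra hne
    simp only [b, hne, if_false] at hi
    linarith
  have hsurj : Function.Surjective m := fun e => by
    obtain ⟨u, hu, huv⟩ := hlift (b e) (hb e)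
    obtain ⟨σ, -, -, hle⟩ := hk e u (b e) hu (hb e) huv
    exact ⟨σ (k e), hb' e _ ((hm' u _ hu (hb e) huv _).trans (hle.trans (by simp [b])))⟩
  have hinj : Function.Injective m := Finite.injective_iff_surjective.2 hsurj
  have hr' : Rigid G x' := by
    intro τ hτ hfix
    ext g
    obtain ⟨u, hu, huv⟩ := hlift (b (m g)) (hb (m g))
    obtain ⟨σ, -, -, hle⟩ := hk (m g) u (b (m g)) hu (hb _) huv
    have h1 : u (σ (k (m g))) ≤ -(t / 2) := hle.trans (by simp [b])
    have h2 : σ (k (m g)) = g := hinj (hb' _ _ ((hm' u _ hu (hb _) huv _).trans h1))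
    rw [h2] at h1
    have h3 : Eqv G (F fun i => x i + b (m g) i) (fun i => x' i + u (τ⁻¹ i)) :=
      huv.trans ⟨τ, hτ, fun i => by simp [← hfix i]⟩
    have h4 := hm' _ _ (fun i => hu (τ⁻¹ i)) (hb _) h3 (τ g)
    simp only [perm_inv_apply_apply] at h4
    exact hinj (hb' _ _ (h4.trans h1))
  have hk' : ∀ u v : ι → ℝ, (∀ i, |u i| ≤ t / 2) → (∀ i, |v i| ≤ t / 2) →
      Eqv G (F fun i => x i + v i) (fun i => x' i + u i) → ∀ i, u (k i) ≤ v i := by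
    intro u v hu hv huv i
    obtain ⟨σ, hσ, h1, h2⟩ := hk i u v hu hv huv
    rw [hr' σ hσ h1] at h2
    exact h2
  have hmk : ∀ e, m (k e) = e := fun e => by
    obtain ⟨u, hu, huv⟩ := hlift (b e) (hb e)
    exact hb' _ _ ((hm' u _ hu (hb e) huv _).trans
      ((hk' u _ hu (hb e) huv e).trans (by simp [b])))
  refine ⟨Equiv.ofBijective m ⟨hinj, hsurj⟩, fun i => x' i - x (m i), ?_⟩
  filter_upwards [closedBall_mem_nhds x (half_pos ht)] with y hy
  have hv : ∀ i, |y i - x i| ≤ t / 2 := fun i => by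
    rw [← Real.dist_eq]
    exact (dist_le_pi_dist y x i).trans hy
  obtain ⟨u, hu, huv⟩ := hlift (fun i => y i - x i) hv
  have h1 : ∀ i, u i = y (m i) - x (m i) := fun i => by
    refine le_antisymm ?_ (hm' u _ hu hv huv i)
    have := hk' u _ hu hv huv (m i)
    rwa [hinj (hmk (m i))] at this
  convert huv using 2
  · ext i; ring
  · rename_i i
    rw [h1]
    change y (m i) + (x' i - x (m i)) = _
    ring

theorem eqv_of_eventually {π π' : Equiv.Perm ι} {c c' x : ι → ℝ}
    (h : ∀ᶠ y in 𝓝 x, Eqv G (fun i => y (π i) + c i) (fun i => y (π' i) + c' i)) (y : ι → ℝ) :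
    Eqv G (fun i => y (π i) + c i) (fun i => y (π' i) + c' i) := by
  have := Fintype.ofFinite ι
  obtain ⟨w, hw⟩ : ∃ w : ι → ℝ, Function.Injective w :=
    ⟨fun i => ((Fintype.equivFin ι i : ℕ) : ℝ), fun i j hij => by simpa [Fin.val_inj] using hij⟩
  have hlim : Tendsto (fun n : ℕ => x + ((n : ℝ) + 1)⁻¹ • w) atTop (𝓝 x) := by
    have h0 : Tendsto (fun n : ℕ => ((n : ℝ) + 1)⁻¹) atTop (𝓝 0) := by
      simpa using tendsto_one_div_add_atTop_nhds_zero_nat (𝕜 := ℝ)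
    simpa using tendsto_const_nhds.add (h0.smul_const w)
  obtain ⟨N, hN⟩ := eventually_atTop.1 (hlim.eventually h)
  choose σ hσ hxσ using fun n : ℕ => hN (N + n) (by omega)
  obtain ⟨a, b, hab, hne⟩ := Finite.exists_ne_map_eq_of_infinite σ
  have h1 : ((↑(N + a) : ℝ) + 1)⁻¹ ≠ ((↑(N + b) : ℝ) + 1)⁻¹ := by
    rw [Ne, inv_inj, add_left_inj, Nat.cast_inj]; omega
  have h2 : ∀ i, π i = π' (σ a i) ∧ c i = c' (σ a i) := fun i => by
    have e1 := hxσ a i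
    have e2 := hxσ b i
    rw [← hne] at e2
    simp only [Pi.add_apply, Pi.smul_apply, smul_eq_mul] at e1 e2
    have h3 : π i = π' (σ a i) := by
      apply hw
      have : (((↑(N + a) : ℝ) + 1)⁻¹ - ((↑(N + b) : ℝ) + 1)⁻¹) *
          (w (π i) - w (π' (σ a i))) = 0 := by linarith
      rcases mul_eq_zero.1 this with h | h
      · exact absurd (sub_eq_zero.1 h) h1
      · exact sub_eq_zero.1 h
    rw [h3] at e1
    exact ⟨h3, by linarith⟩
  exact ⟨σ a, hσ a, fun i => by dsimp only; rw [(h2 i).1, (h2 i).2]⟩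

theorem IsAuto.eqv_of_segment (h : IsAuto G F F') {x z : ι → ℝ}
    (hr : ∀ y ∈ segment ℝ x z, Rigid G y) {π : Equiv.Perm ι} {c : ι → ℝ}
    (hx : ∀ᶠ y in 𝓝 x, Eqv G (F y) (fun i => y (π i) + c i)) :
    Eqv G (F z) (fun i => z (π i) + c i) := by
  let u : Set (ι → ℝ) := {x | ∀ᶠ y in 𝓝 x, Eqv G (F y) (fun i => y (π i) + c i)}
  let v : Set (ι → ℝ) := {x | ∃ (π' : Equiv.Perm ι) (c' : ι → ℝ),
    (∀ᶠ y in 𝓝 x, Eqv G (F y) (fun i => y (π' i) + c' i)) ∧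
    ¬ ∀ y : ι → ℝ, Eqv G (fun i => y (π i) + c i) (fun i => y (π' i) + c' i)}
  have hu : IsOpen u := isOpen_setOfPred_eventually_nhds
  have hv : IsOpen v := by
    rw [isOpen_iff_mem_nhds]
    rintro x ⟨π', c', h1, h2⟩
    filter_upwards [eventually_eventually_nhds.2 h1] with y hy
    exact ⟨π', c', hy, h2⟩
  have huv : Disjoint u v := by
    rw [Set.disjoint_left]
    rintro x h1 ⟨π', c', h2, h3⟩
    refine h3 (eqv_of_eventually (x := x) ?_)
    filter_upwards [h1, h2] with y hy hy'
    exact hy.symm.trans hy'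
  have hsub : segment ℝ x z ⊆ u ∪ v := fun y hy => by
    obtain ⟨π', c', h1⟩ := h.exists_local (hr y hy)
    by_cases h2 : ∀ y : ι → ℝ, Eqv G (fun i => y (π i) + c i) (fun i => y (π' i) + c' i)
    · left
      filter_upwards [h1] with y' hy'
      exact hy'.trans (h2 y').symm
    · exact Or.inr ⟨π', c', h1, h2⟩
  have := (convex_segment x z).isPreconnected.subset_left_of_subset_union hu hv huv hsub
    ⟨x, left_mem_segment ℝ x z, hx⟩ (right_mem_segment ℝ x z)
  exact this.self_of_nhds

theorem IsAuto.exists_perm (h : IsAuto G F F') (h0 : Eqv G (F 0) 0) {x : ι → ℝ}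
    (hd : Dense {z | ∀ y ∈ segment ℝ x z, Rigid G y}) :
    ∃ π : Equiv.Perm ι, ∀ z, Eqv G (F z) (fun i => z (π i)) := by
  have := Fintype.ofFinite ι
  have hrx : Rigid G x := by
    obtain ⟨z, hz⟩ := hd.nonempty
    exact hz x (left_mem_segment ℝ x z)
  obtain ⟨π, c, hx⟩ := h.exists_local hrx
  have key : ∀ z, Eqv G (F z) (fun i => z (π i) + c i) := by
    intro z
    have happ : ∀ ε > 0, ∃ z', (∀ i, |z' i - z i| ≤ ε / 2) ∧
        Eqv G (F z') (fun i => z' (π i) + c i) := fun ε hε => by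
      obtain ⟨z', hz', hdist⟩ := hd.exists_dist_lt z (half_pos hε)
      refine ⟨z', fun i => ?_, h.eqv_of_segment hz' hx⟩
      rw [← Real.dist_eq, dist_comm]
      exact (dist_le_pi_dist z z' i).trans hdist.le
    refine Pre.antisymm (Pre.of_forall_add fun ε hε => ?_) (Pre.of_forall_add fun ε hε => ?_)
    · obtain ⟨z', h1, h2⟩ := happ ε hε
      refine (h.pre (y := fun i => z' i + ε / 2) (Pre.of_le fun i => ?_)).trans
        (((h.add z' (ε / 2)).trans (h2.add_const _)).pre.trans (Pre.of_le fun i => ?_))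
      · linarith [(abs_le.1 (h1 i)).1]
      · linarith [(abs_le.1 (h1 (π i))).2]
    · obtain ⟨z', h1, h2⟩ := happ ε hε
      have h3 : Pre G (fun i => z' (π i) + c i + ε / 2) (fun i => F z i + ε) := by
        have h4 : Pre G (F fun i => z' i + ε / 2) (F fun i => z i + ε) :=
          h.pre (Pre.of_le fun i => by linarith [(abs_le.1 (h1 i)).2])
        exact ((h.add z' (ε / 2)).trans (h2.add_const _)).symm.pre.trans
          (h4.trans (h.add z ε).pre)
      exact (Pre.of_le fun i => by linarith [(abs_le.1 (h1 (π i))).1]).trans h3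
  have hc : ∀ i, c i = 0 := by
    obtain ⟨g, -, hg⟩ := (key 0).symm.trans h0
    intro i
    simpa using hg i
  refine ⟨π, fun z => ?_⟩
  simpa [hc] using key z

end OrbitOrder

theorem exists_notMem_of_card_lt {n : ℕ} {s : Finset (Fin n)} (h : s.card < n) : ∃ c, c ∉ s := by
  by_contra! hs
  rw [Finset.eq_univ_of_forall hs, Finset.card_univ, Fintype.card_fin] at h
  exact lt_irrefl n h

theorem edge_eq_iff {n : ℕ} {i j k l : Fin n} (h : i ≠ j) (h' : k ≠ l) :
    edge i j h = edge k l h' ↔ i = k ∧ j = l ∨ i = l ∧ j = k := by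
  rw [edge, edge, Subtype.mk.injEq, Sym2.eq_iff]

theorem mem_edge {n : ℕ} {v i j : Fin n} (h : i ≠ j) : v ∈ (edge i j h).1 ↔ v = i ∨ v = j :=
  Sym2.mem_iff

theorem eq_edge {n : ℕ} {e : Edge n} {i j : Fin n} (h : i ≠ j) (hi : i ∈ e.1) (hj : j ∈ e.1) :
    e = edge i j h :=
  Subtype.ext ((Sym2.mem_and_mem_iff h).1 ⟨hi, hj⟩)

/-- No two pairs of coordinates become simultaneously equal on the line through `x` and `z`. -/
def Generic {ι : Type*} (x z : ι → ℝ) : Prop := ∀ a b c d, a ≠ b → c ≠ d → a ≠ c → a ≠ d →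
  (x a - x b) * (z c - z d) ≠ (x c - x d) * (z a - z b)

theorem Generic.not_eq {ι : Type*} {x z y : ι → ℝ} (h : Generic x z) (hy : y ∈ segment ℝ x z)
    {a b c d : ι} (hab : a ≠ b) (hcd : c ≠ d) (hac : a ≠ c) (had : a ≠ d) (h1 : y a = y b) :
    y c ≠ y d := by
  intro h2
  obtain ⟨s, t, hs, ht, hst, rfl⟩ := hy
  simp only [Pi.add_apply, Pi.smul_apply, smul_eq_mul] at h1 h2
  have h3 := sub_ne_zero.2 (h a b c d hab hcd hac had)
  have h4 : s * ((x a - x b) * (z c - z d) - (x c - x d) * (z a - z b)) = 0 := by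
    linear_combination (z c - z d) * h1 - (z a - z b) * h2
  have h5 : t * ((x a - x b) * (z c - z d) - (x c - x d) * (z a - z b)) = 0 := by
    linear_combination (x a - x b) * h2 - (x c - x d) * h1
  have h6 := (mul_eq_zero.1 h4).resolve_right h3
  have h7 := (mul_eq_zero.1 h5).resolve_right h3
  rw [h6, h7] at hst
  norm_num at hst

theorem dense_generic {ι : Type*} [Finite ι] {x : ι → ℝ} (hx : Function.Injective x) :
    Dense {z | Generic x z} := by
  classical
  let S := {q : ι × ι × ι × ι // q.1 ≠ q.2.1 ∧ q.2.2.1 ≠ q.2.2.2 ∧ q.1 ≠ q.2.2.1 ∧ q.1 ≠ q.2.2.2}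
  let L : S → (ι → ℝ) → ℝ := fun q z => (x q.1.1 - x q.1.2.1) * (z q.1.2.2.1 - z q.1.2.2.2) -
    (x q.1.2.2.1 - x q.1.2.2.2) * (z q.1.1 - z q.1.2.1)
  have key : Dense (⋂ q : S, {z | L q z ≠ 0}) := by
    refine dense_iInter_of_isOpen (fun q => ?_) fun q z => ?_
    · exact isOpen_ne_fun (by fun_prop) continuous_const
    · by_cases hz : L q z = 0
      · obtain ⟨⟨a, b, c, d⟩, hab, hcd, hac, had⟩ := q
        dsimp only at hab hcd hac had
        have hlim : Tendsto (fun n : ℕ => z + ((n : ℝ) + 1)⁻¹ • Pi.single a (1 : ℝ)) atTop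
            (𝓝 z) := by
          have h0 : Tendsto (fun n : ℕ => ((n : ℝ) + 1)⁻¹) atTop (𝓝 0) := by
            simpa using tendsto_one_div_add_atTop_nhds_zero_nat (𝕜 := ℝ)
          simpa using tendsto_const_nhds.add (h0.smul_const (Pi.single a (1 : ℝ)))
        refine mem_closure_of_tendsto hlim (Eventually.of_forall fun n => ?_)
        have hne : x c - x d ≠ 0 := sub_ne_zero.2 (hx.ne hcd)
        have hn : ((n : ℝ) + 1)⁻¹ ≠ 0 := by positivity
        simp only [L] at hz
        simp only [L, mem_ofPred_eq, Pi.add_apply, Pi.smul_apply, smul_eq_mul, Pi.single_eq_same,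
          Pi.single_eq_of_ne hab.symm, Pi.single_eq_of_ne hac.symm, Pi.single_eq_of_ne had.symm]
        intro h
        exact mul_ne_zero hne hn (by linarith)
      · exact subset_closure hz
  refine key.mono fun z hz a b c d hab hcd hac had h => ?_
  exact mem_iInter.1 hz ⟨(a, b, c, d), hab, hcd, hac, had⟩ (sub_eq_zero.2 h)

theorem rigid_of_generic {n : ℕ} (hn : 4 ≤ n) {x z y : Edge n → ℝ} (h : Generic x z)
    (hy : y ∈ segment ℝ x z) : Rigid (act n).range y := by
  rintro _ ⟨σ, rfl⟩ hσ
  suffices σ = 1 by rw [this, map_one]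
  by_contra hne
  obtain ⟨a, ha⟩ : ∃ a, σ a ≠ a := by
    by_contra! hfix
    exact hne (Equiv.ext hfix)
  obtain ⟨c, hc⟩ := exists_notMem_of_card_lt (s := {a, σ a})
    (Finset.card_le_two.trans_lt (by omega))
  obtain ⟨d, hd⟩ := exists_notMem_of_card_lt (s := {a, σ a, c})
    (Finset.card_le_three.trans_lt (by omega))
  simp only [Finset.mem_insert, Finset.mem_singleton, not_or] at hc hd
  have hac : a ≠ c := Ne.symm hc.1
  have had : a ≠ d := Ne.symm hd.1
  have h1 := hσ (edge a c hac)
  have h2 := hσ (edge a d had)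
  rw [act_edge] at h1 h2
  refine h.not_eq hy ?_ ?_ ?_ ?_ h1 h2 <;> rw [Ne, edge_eq_iff] <;> grind

theorem exists_dense_rigid {n : ℕ} (hn : 4 ≤ n) : ∃ x : Edge n → ℝ,
    Dense {z | ∀ y ∈ segment ℝ x z, Rigid (act n).range y} := by
  obtain ⟨x, hx⟩ : ∃ x : Edge n → ℝ, Function.Injective x :=
    ⟨fun i => ((Fintype.equivFin _ i : ℕ) : ℝ), fun i j hij => by simpa [Fin.val_inj] using hij⟩
  exact ⟨x, (dense_generic hx).mono fun z hz y hy => rigid_of_generic hn hz hy⟩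

theorem exists_triangle {n : ℕ} {π : Equiv.Perm (Edge n)}
    (h : ∀ z, Met z ↔ Met fun e => z (π e)) {i j k : Fin n} (hij : i ≠ j) (hjk : j ≠ k)
    (hik : i ≠ k) : ∃ (i' j' k' : Fin n) (hij' : i' ≠ j') (hjk' : j' ≠ k') (hik' : i' ≠ k'),
      π (edge i j hij) = edge i' j' hij' ∧ π (edge j k hjk) = edge j' k' hjk' ∧
        π (edge i k hik) = edge i' k' hik' := by
  let w : Edge n → ℝ := fun e => if e = π (edge i k hik) then 5 / 2 else
    if e = π (edge i j hij) ∨ e = π (edge j k hjk) then 1 else 2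
  have h1 : ¬ Met w := by
    rw [h]
    intro hm
    have := hm.triangle i j k hij hjk hik
    have e1 : edge i j hij ≠ edge i k hik := by rw [Ne, edge_eq_iff]; grind
    have e2 : edge j k hjk ≠ edge i k hik := by rw [Ne, edge_eq_iff]; grind
    simp only [w, π.injective.eq_iff, e1, e2, if_true, if_false, true_or, or_true] at this
    norm_num at this
  have h2 : ∃ (i' j' k' : Fin n) (hij' : i' ≠ j') (hjk' : j' ≠ k') (hik' : i' ≠ k'),
      w (edge i' j' hij') + w (edge j' k' hjk') < w (edge i' k' hik') := by
    by_contra! hcon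
    refine h1 ⟨fun e => ?_, hcon⟩
    dsimp only [w]
    split_ifs <;> norm_num
  obtain ⟨i', j', k', hij', hjk', hik', hlt⟩ := h2
  have e1 : edge i' j' hij' ≠ edge j' k' hjk' := by rw [Ne, edge_eq_iff]; grind
  have h3 : edge i' k' hik' = π (edge i k hik) ∧
      (edge i' j' hij' = π (edge i j hij) ∨ edge i' j' hij' = π (edge j k hjk)) ∧
      (edge j' k' hjk' = π (edge i j hij) ∨ edge j' k' hjk' = π (edge j k hjk)) := by
    dsimp only [w] at hlt
    split_ifs at hlt <;> first | exact ⟨‹_›, ‹_›, ‹_›⟩ | (exfalso; norm_num at hlt)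
  obtain ⟨h4, h5 | h5, h6 | h6⟩ := h3
  · exact absurd (h5.trans h6.symm) e1
  · exact ⟨i', j', k', hij', hjk', hik', h5.symm, h6.symm, h4.symm⟩
  · exact ⟨k', j', i', hjk'.symm, hij'.symm, hik'.symm, by rw [← h6, edge_comm],
      by rw [← h5, edge_comm], by rw [← h4, edge_comm]⟩
  · exact absurd (h5.trans h6.symm) e1

/-- A permutation of the edges of a complete graph on at least four vertices that preserves
the metric cone comes from a permutation of the vertices. -/
theorem exists_act_eq {n : ℕ} (hn : 4 ≤ n) {π : Equiv.Perm (Edge n)}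
    (h : ∀ z, Met z ↔ Met fun e => z (π e)) : ∃ σ, act n σ = π := by
  have hv : ∀ a, ∃ a', ∀ d (had : a ≠ d), a' ∈ (π (edge a d had)).1 := by
    intro a
    obtain ⟨b, hb⟩ := exists_notMem_of_card_lt (s := {a}) (by simp; omega)
    obtain ⟨c, hc⟩ := exists_notMem_of_card_lt (s := {a, b})
      (Finset.card_le_two.trans_lt (by omega))
    simp only [Finset.mem_insert, Finset.mem_singleton, not_or] at hb hc
    obtain ⟨b', a', c', hba', hac', hbc', h1, h2, h3⟩ :=
      exists_triangle h hb (Ne.symm hc.1) (Ne.symm hc.2)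
    refine ⟨a', fun d had => ?_⟩
    by_cases hdb : d = b
    · subst hdb; rw [edge_comm, h1, mem_edge]; exact Or.inr rfl
    by_cases hdc : d = c
    · subst hdc; rw [h2, mem_edge]; exact Or.inl rfl
    by_contra hmem
    obtain ⟨u₁, v₁, w₁, hu₁, hv₁, hw₁, h4, h5, -⟩ := exists_triangle h hb had (Ne.symm hdb)
    obtain ⟨u₂, v₂, w₂, hu₂, hv₂, hw₂, h6, h7, -⟩ := exists_triangle h hc.1 had (Ne.symm hdc)
    have hv₁' : v₁ ∈ (π (edge a d had)).1 := by rw [h5, mem_edge]; exact Or.inl rfl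
    have hv₂' : v₂ ∈ (π (edge a d had)).1 := by rw [h7, mem_edge]; exact Or.inl rfl
    have hb' : v₁ = b' := by
      have : v₁ ∈ (edge b' a' hba').1 := by rw [← h1, h4, mem_edge]; exact Or.inr rfl
      rw [mem_edge] at this
      exact this.resolve_right fun he => hmem (he ▸ hv₁')
    have hc' : v₂ = c' := by
      have : v₂ ∈ (edge a' c' hac').1 := by rw [← h2, edge_comm, h6, mem_edge]; exact Or.inr rfl
      rw [mem_edge] at this
      exact this.resolve_left fun he => hmem (he ▸ hv₂')
    have h8 := eq_edge hbc' (hb' ▸ hv₁') (hc' ▸ hv₂')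
    rw [← h3, π.injective.eq_iff, edge_eq_iff] at h8
    grind
  choose σ hσ using hv
  have hinj : Function.Injective σ := by
    intro a b hab
    by_contra hne
    obtain ⟨c, hc⟩ := exists_notMem_of_card_lt (s := {a, b})
      (Finset.card_le_two.trans_lt (by omega))
    simp only [Finset.mem_insert, Finset.mem_singleton, not_or] at hc
    obtain ⟨i, j, k, hij, hjk, hik, h1, h2, h3⟩ :=
      exists_triangle h hne (Ne.symm hc.2) (Ne.symm hc.1)
    have e1 := hσ a b hne
    have e2 := hσ b c (Ne.symm hc.2)
    have e3 := hσ a c (Ne.symm hc.1)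
    rw [h1, mem_edge] at e1
    rw [h2, mem_edge, ← hab] at e2
    rw [h3, mem_edge] at e3
    grind
  refine ⟨Equiv.ofBijective σ (Finite.injective_iff_bijective.1 hinj),
    Equiv.ext (Edge.ind fun i j hij => ?_)⟩
  rw [act_edge]
  refine (eq_edge _ (hσ i j hij) ?_).symm
  rw [edge_comm]
  exact hσ j i hij.symm

theorem Realizes.congr {n : ℕ} {x y : Edge n → ℝ} {A : GHSpace} (hA : Realizes x A)
    (h : Eqv (act n).range x y) : Realizes y A := by
  obtain ⟨_, ⟨σ, rfl⟩, h⟩ := h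
  obtain ⟨e, he⟩ := hA
  refine ⟨σ.symm.trans e, fun i j hij => ?_⟩
  have hij' : σ.symm i ≠ σ.symm j := σ.symm.injective.ne hij
  rw [Equiv.trans_apply, Equiv.trans_apply, he _ _ hij', h, act_edge]
  simp

/-- Isometries preserve the domination of spaces with `n` points. -/
theorem Realizes.pre_map (f : GHSpace ≃ᵢ GHSpace) {n : ℕ} (hn : 2 ≤ n) {x y x' y' : Edge n → ℝ}
    {A B : GHSpace} (hA : Realizes x A) (hB : Realizes y B) (hA' : Realizes x' (f A))
    (hB' : Realizes y' (f B)) (h : Pre (act n).range x y) : Pre (act n).range x' y' := by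
  obtain ⟨g, hg, h⟩ := h
  obtain ⟨e, he⟩ := hA
  obtain ⟨e', he'⟩ := hB.congr (y := fun i => y (g i))
    ⟨g⁻¹, inv_mem hg, fun i => by simp only [perm_apply_inv_apply]⟩
  have hle : Le n A B := Le.of_dist_le hn (e.symm.trans e') fun a b => by
    obtain ⟨i, rfl⟩ := e.surjective a
    obtain ⟨j, rfl⟩ := e.surjective b
    simp only [Equiv.trans_apply, Equiv.symm_apply_apply]
    by_cases hij : i = j
    · subst hij; simp
    · rw [he i j hij, he' i j hij]; exact h _
  obtain ⟨σ, hσ⟩ := (hle.map f (by omega)).exists_perm (by omega) hA' hB'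
  exact ⟨act n σ, ⟨σ, rfl⟩, hσ⟩

theorem Realizes.pre_map_add_const (f : GHSpace ≃ᵢ GHSpace) {n : ℕ} (hn : 2 ≤ n)
    {x y y' : Edge n → ℝ} {c : ℝ} (hc : 0 ≤ c) {A B : GHSpace} (hA : Realizes x A)
    (hB : Realizes (fun e => x e + c) B) (hA' : Realizes y (f A)) (hB' : Realizes y' (f B)) :
    Pre (act n).range y' (fun e => y e + c) := by
  obtain ⟨δ, hδ, hle⟩ := exists_pos_le hA.met.pos
  obtain ⟨q, hq⟩ := exists_isSimplex (t := δ + c) (by positivity) (n := n) (by omega)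
  have hq' := hq.map f (by positivity) (by omega)
  obtain ⟨g, -, hg⟩ := Realizes.pre_map f hn hq hB (x' := fun _ => δ + c) (by rw [hq']; exact hq)
    hB' (Pre.of_le fun e => by linarith [hle e])
  have h1 : gd (f A) (f B) ≤ c := by
    rw [gd_map]
    exact hA.gd_le hB hc fun e => by simp [abs_of_nonneg hc]
  obtain ⟨σ, hσ⟩ := hA'.exists_perm' hB' h1 fun e => by
    have := hg (g⁻¹ e)
    rw [perm_apply_inv_apply] at this
    linarith
  exact ⟨act n σ, ⟨σ, rfl⟩, fun e => by linarith [(abs_le.1 (hσ e)).1]⟩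

theorem Realizes.map_add_const (f : GHSpace ≃ᵢ GHSpace) {n : ℕ} (hn : 2 ≤ n)
    {x y : Edge n → ℝ} {c : ℝ} (hc : 0 ≤ c) {A B : GHSpace} (hA : Realizes x A)
    (hB : Realizes (fun e => x e + c) B) (hA' : Realizes y (f A)) :
    Realizes (fun e => y e + c) (f B) := by
  obtain ⟨y', hB'⟩ := hB.exists_map f hn
  refine hB'.congr (Pre.antisymm (hA.pre_map_add_const f hn hc hB hA' hB') ?_)
  obtain ⟨Q, hQ⟩ := (hA'.met.add_const hc).exists_realizes (by omega)
  obtain ⟨z, hz⟩ := hQ.exists_map f.symm hn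
  have h1 := hA'.pre_map_add_const f.symm hn hc hQ (by simpa using hA) hz
  exact Realizes.pre_map f hn hz hB (by simpa using hQ) hB' h1

/-- The relation between edge weights induced by the action of an isometry on spaces with `n`
points, extended to all weights by adding constants. -/
def Induced (f : GHSpace ≃ᵢ GHSpace) {n : ℕ} (x y : Edge n → ℝ) : Prop :=
  ∃ l ≥ 0, ∃ A, Realizes (fun e => x e + l) A ∧ Realizes (fun e => y e + l) (f A)

section Induced

variable {f : GHSpace ≃ᵢ GHSpace} {n : ℕ} {x y x' y' : Edge n → ℝ}

theorem Induced.of_realizes {A : GHSpace} (hx : Realizes x A) (hy : Realizes y (f A)) :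
    Induced f x y :=
  ⟨0, le_rfl, A, by simpa using hx, by simpa using hy⟩

theorem exists_met_add_const (x : Edge n → ℝ) : ∃ l ≥ 0, Met (fun e => x e + l) := by
  obtain ⟨M, hM, h⟩ := exists_pos_ge fun e => |x e|
  have h' := fun e => abs_le.1 (h e)
  exact ⟨3 * M + 1, by positivity, fun e => by linarith [(h' e).1], fun i j k hij hjk hik => by
    linarith [(h' (edge i k hik)).2, (h' (edge i j hij)).1, (h' (edge j k hjk)).1]⟩

theorem exists_induced (f : GHSpace ≃ᵢ GHSpace) (hn : 2 ≤ n) (x : Edge n → ℝ) :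
    ∃ y, Induced f x y := by
  obtain ⟨l, hl, hx⟩ := exists_met_add_const x
  obtain ⟨A, hA⟩ := hx.exists_realizes (by omega)
  obtain ⟨y, hy⟩ := hA.exists_map f hn
  exact ⟨fun e => y e - l, l, hl, A, hA, by simpa using hy⟩

theorem Induced.symm (h : Induced f x y) : Induced f.symm y x := by
  obtain ⟨l, hl, A, hx, hy⟩ := h
  exact ⟨l, hl, f A, hy, by simpa using hx⟩

theorem Induced.eventually (hn : 2 ≤ n) (h : Induced f x y) : ∃ l ≥ 0, ∀ m ≥ l,
    ∃ A, Realizes (fun e => x e + m) A ∧ Realizes (fun e => y e + m) (f A) := by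
  obtain ⟨l, hl, A, hx, hy⟩ := h
  refine ⟨l, hl, fun m hm => ?_⟩
  have hx' := hx.met.add_const (sub_nonneg.2 hm)
  obtain ⟨B, hB⟩ := hx'.exists_realizes (by omega)
  have hB' := hx.map_add_const f hn (sub_nonneg.2 hm) hB hy
  simp only [add_assoc, add_sub_cancel] at hB hB'
  exact ⟨B, hB, hB'⟩

theorem Induced.pre (hn : 2 ≤ n) (h : Induced f x y) (h' : Induced f x' y')
    (hxx : Pre (act n).range x x') : Pre (act n).range y y' := by
  obtain ⟨l, -, hl⟩ := h.eventually hn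
  obtain ⟨l', -, hl'⟩ := h'.eventually hn
  obtain ⟨A, hx, hy⟩ := hl (max l l') (le_max_left _ _)
  obtain ⟨B, hx', hy'⟩ := hl' (max l l') (le_max_right _ _)
  obtain ⟨g, hg, hle⟩ := hxx
  obtain ⟨k, hk, hle'⟩ := Realizes.pre_map f hn hx hx' hy hy'
    ⟨g, hg, fun e => by linarith [hle e]⟩
  exact ⟨k, hk, fun e => by linarith [hle' e]⟩

theorem Induced.eqv (hn : 2 ≤ n) (h : Induced f x y) (h' : Induced f x y') :
    Eqv (act n).range y y' :=
  (h.pre hn h' (Eqv.refl x).pre).antisymm (h'.pre hn h (Eqv.refl x).pre)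

theorem Induced.add_const (hn : 2 ≤ n) (h : Induced f x y) (c : ℝ) :
    Induced f (fun e => x e + c) (fun e => y e + c) := by
  obtain ⟨l, hl0, hl⟩ := h.eventually hn
  obtain ⟨A, hx, hy⟩ := hl (l + |c|) (by linarith [abs_nonneg c])
  refine ⟨l + |c| - c, by linarith [le_abs_self c], A, ?_, ?_⟩
  · simpa only [add_assoc, add_sub_cancel] using hx
  · simpa only [add_assoc, add_sub_cancel] using hy

theorem Induced.congr (h : Induced f x y) (hy : Eqv (act n).range y y') : Induced f x y' := by
  obtain ⟨l, hl, A, hx, hA⟩ := h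
  exact ⟨l, hl, A, hx, hA.congr (hy.add_const l)⟩

theorem Induced.met (hn : 2 ≤ n) (h : Induced f x y) (hx : Met x) : Met y := by
  obtain ⟨A, hA⟩ := hx.exists_realizes (by omega)
  obtain ⟨z, hz⟩ := hA.exists_map f hn
  exact (hz.congr ((Induced.of_realizes hA hz).eqv hn h)).met

theorem induced_zero (hn : 2 ≤ n) : Induced f (0 : Edge n → ℝ) 0 := by
  obtain ⟨q, hq⟩ := exists_isSimplex one_pos (n := n) (by omega)
  have hq' := hq.map f one_pos (by omega)
  refine ⟨1, zero_le_one, q, ?_, ?_⟩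
  · simpa [IsSimplex] using hq
  · rw [hq']; simpa [IsSimplex] using hq

theorem induced_self (hn : 4 ≤ n) (x : Edge n → ℝ) : Induced f x x := by
  have hn2 : 2 ≤ n := by omega
  choose F hF using exists_induced f hn2
  choose F' hF' using exists_induced f.symm hn2
  have hauto : IsAuto (act n).range F F' :=
    { pre := fun {x y} => (hF x).pre hn2 (hF y)
      pre' := fun {x y} => (hF' x).pre hn2 (hF' y)
      add := fun x c => (hF _).eqv hn2 ((hF x).add_const hn2 c)
      add' := fun x c => (hF' _).eqv hn2 ((hF' x).add_const hn2 c)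
      right_inv := fun x => (hF _).eqv hn2 (hF' x).symm
      left_inv := fun x => (hF' _).eqv hn2 (hF x).symm }
  obtain ⟨z, hz⟩ := exists_dense_rigid hn
  obtain ⟨π, hπ⟩ := hauto.exists_perm ((hF 0).eqv hn2 (induced_zero hn2)) hz
  have hind : ∀ z, Induced f z (fun e => z (π e)) := fun z => (hF z).congr (hπ z)
  obtain ⟨σ, rfl⟩ := exists_act_eq hn fun z =>
    ⟨(hind z).met hn2, (hind z).symm.met hn2⟩
  exact (hind x).congr ⟨act n σ, ⟨σ, rfl⟩, fun _ => rfl⟩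

end Induced

theorem Realizes.map_eq (f : GHSpace ≃ᵢ GHSpace) {n : ℕ} (hn : 4 ≤ n) {x : Edge n → ℝ}
    {A : GHSpace} (hA : Realizes x A) : f A = A := by
  obtain ⟨y, hy⟩ := hA.exists_map f (by omega)
  exact (hy.congr ((Induced.of_realizes hA hy).eqv (by omega) (induced_self hn x))).eq hA

theorem exists_realizes_gd_le (q : GHSpace) {ε : ℝ} (hε : 0 < ε) : ∃ n ≥ 4,
    ∃ (x : Edge n → ℝ) (A : GHSpace), Realizes x A ∧ gd q A ≤ 3 * ε := by
  obtain ⟨t, -, htfin, ht⟩ := finite_cover_balls_of_compact (isCompact_univ (X := q.Rep)) hε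
  have := htfin.to_subtype
  have hne : Nonempty t := by
    have := ht (mem_univ (Classical.arbitrary q.Rep))
    simp only [mem_iUnion] at this
    obtain ⟨a, ha, -⟩ := this
    exact ⟨⟨a, ha⟩⟩
  have := Fintype.ofFinite t
  have hcard : 4 ≤ Fintype.card (t × Fin 4) := by
    rw [Fintype.card_prod, Fintype.card_fin]
    have := Fintype.card_pos (α := t)
    omega
  obtain ⟨n, hcard, ⟨k⟩⟩ : ∃ n ≥ 4, Nonempty (t × Fin 4 ≃ Fin n) :=
    ⟨_, hcard, ⟨Fintype.equivFin _⟩⟩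
  let u : Fin n → q.Rep := fun i => (k.symm i).1
  have hu : ∀ a, ∃ i, dist a (u i) < ε := fun a => by
    have := ht (mem_univ a)
    simp only [mem_iUnion] at this
    obtain ⟨b, hb, hab⟩ := this
    exact ⟨k (⟨b, hb⟩, 0), by simpa [u] using hab⟩
  have : Nonempty (Fin n) := ⟨⟨0, by omega⟩⟩
  obtain ⟨A, e, he⟩ := exists_realization (A := Fin n)
    (fun i j => if i = j then 0 else dist (u i) (u j) + ε) (by simp) (fun i j h => by
      by_contra hij
      rw [if_neg hij] at h
      linarith [dist_nonneg (x := u i) (y := u j)])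
    (fun i j => by simp only [eq_comm, dist_comm])
    (fun i j l => by
      by_cases hij : i = j
      · subst hij; simp
      by_cases hjl : j = l
      · subst hjl; simp
      rw [if_neg hij, if_neg hjl]
      have := dist_triangle (u i) (u j) (u l)
      split_ifs <;> linarith [dist_nonneg (x := u i) (y := u j), dist_nonneg (x := u j) (y := u l)])
    (fun _ => continuous_of_discreteTopology)
  obtain ⟨x, hx⟩ := exists_realizes_of_equiv e
  refine ⟨n, hcard, x, A, hx, gd_le_of_isCorr (R := fun a b => dist a (u (e.symm b)) < ε)
    ⟨fun a => ?_, fun b => ⟨u (e.symm b), by simpa using hε⟩, ?_⟩⟩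
  · obtain ⟨i, hi⟩ := hu a
    exact ⟨e i, by simpa using hi⟩
  · intro a b a' b' h h'
    obtain ⟨i, rfl⟩ := e.surjective b
    obtain ⟨j, rfl⟩ := e.surjective b'
    rw [Equiv.symm_apply_apply] at h h'
    have h1 := dist_triangle4 a (u i) (u j) a'
    have h2 := dist_triangle4 (u i) a a' (u j)
    rw [dist_comm (u j) a'] at h1
    rw [dist_comm (u i) a] at h2
    rw [he, abs_le]
    split_ifs with hij
    · subst hij
      rw [dist_self] at h1 h2
      constructor <;> linarith [dist_nonneg (x := a) (y := a')]
    · constructor <;> linarith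

theorem map_eq_self (f : GHSpace ≃ᵢ GHSpace) (q : GHSpace) : f q = q := by
  refine dist_le_zero.1 (le_of_forall_pos_le_add fun ε hε => ?_)
  obtain ⟨n, hn, x, A, hA, hle⟩ := exists_realizes_gd_le q (ε := ε / 3) (by positivity)
  have h1 := hA.map_eq f hn
  have h2 := f.isometry.dist_eq q A
  rw [h1] at h2
  have h3 := dist_triangle_right (f q) q A
  unfold gd at hle
  linarith

end GHIsometry

/-- **Main Theorem** (Lowther). The isometry group of the Gromov–Hausdorff space is
trivial: every surjective isometry of `GHSpace` onto itself is the identity. -/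
theorem ghspace_isometry_group_trivial
    (f : GromovHausdorff.GHSpace ≃ᵢ GromovHausdorff.GHSpace) :
    f = IsometryEquiv.refl GromovHausdorff.GHSpace := by
  exact IsometryEquiv.ext fun q => GHIsometry.map_eq_self f q
end

section
/- Every surjective isometry f of the Gromov–Hausdorff space onto itself fixes the class of the one-point metric space: f(Δ_1) = Δ_1. Consequently, for every X ∈ GHSpace, diam f(X) = diam X. -/
/-- The metric on `Fin n` in which every nonzero distance equals `t`. -/
noncomputable def simplexMetric (n : ℕ) (t : ℝ) (ht : 0 < t) : MetricSpace (Fin n) where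
  dist i j := if i = j then 0 else t
  dist_self i := by simp
  dist_comm i j := by by_cases h : i = j <;> simp [h, Ne.symm, eq_comm]
  dist_triangle i j k := by
    by_cases h1 : i = k <;> by_cases h2 : i = j <;> by_cases h3 : j = k <;>
      simp_all <;> linarith
  eq_of_dist_eq_zero := by
    intro i j h
    by_cases hij : i = j
    · exact hij
    · simp [hij] at h; exact absurd h (ne_of_gt ht)

/-- The point of the Gromov–Hausdorff space corresponding to the simplex `tΔ_n`,
the `n`-point metric space all of whose nonzero distances equal `t`. -/
noncomputable def simplexGH (n : ℕ) (hn : 0 < n) (t : ℝ) (ht : 0 < t) :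
    GromovHausdorff.GHSpace :=
  letI := simplexMetric n t ht
  haveI : Nonempty (Fin n) := ⟨⟨0, hn⟩⟩
  GromovHausdorff.toGHSpace (Fin n)

/-- The class `Δ₁` of the one-point metric space. -/
noncomputable def onePointGH : GromovHausdorff.GHSpace := simplexGH 1 one_pos 1 one_pos

/-- The diameter of (a representative of) a point of the Gromov–Hausdorff space. -/
noncomputable def ghDiam (X : GromovHausdorff.GHSpace) : ℝ :=
  Metric.diam (Set.univ : Set X.Rep)

open GromovHausdorff Metric Set in
/-- A pair of surjections from a common source bounds the Gromov–Hausdorff distance by half of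
the distortion. -/
theorem ghDist_le_of_surjective {X Y Z : Type*} [MetricSpace X] [CompactSpace X] [Nonempty X]
    [MetricSpace Y] [CompactSpace Y] [Nonempty Y] {Φ : Z → X} {Ψ : Z → Y}
    (hΦ : Function.Surjective Φ) (hΨ : Function.Surjective Ψ) {r : ℝ}
    (H : ∀ p q, |dist (Φ p) (Φ q) - dist (Ψ p) (Ψ q)| ≤ 2 * r) : ghDist X Y ≤ r := by
  obtain ⟨x₀⟩ := ‹Nonempty X›
  obtain ⟨z₀, -⟩ := hΦ x₀
  have : Nonempty Z := ⟨z₀⟩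
  have hr : 0 ≤ r := by
    have h := H z₀ z₀
    simp only [dist_self, sub_self, abs_zero] at h
    linarith
  refine le_of_forall_gt_imp_ge_of_dense fun ε hε => ?_
  let : MetricSpace (X ⊕ Y) := glueMetricApprox Φ Ψ ε (hr.trans_lt hε)
    fun p q => (H p q).trans (by linarith)
  have hl : Isometry (Sum.inl : X → X ⊕ Y) := Isometry.of_dist_eq fun _ _ => rfl
  have hr' : Isometry (Sum.inr : Y → X ⊕ Y) := Isometry.of_dist_eq fun _ _ => rfl
  have hd (p : Z) : dist (Sum.inl (Φ p) : X ⊕ Y) (Sum.inr (Ψ p)) = ε :=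
    glueDist_glued_points Φ Ψ ε p
  refine (ghDist_le_hausdorffDist hl hr').trans
    (hausdorffDist_le_of_mem_dist (hr.trans hε.le) ?_ ?_)
  · rintro _ ⟨x, rfl⟩
    obtain ⟨p, rfl⟩ := hΦ x
    exact ⟨_, mem_range_self (Ψ p), (hd p).le⟩
  · rintro _ ⟨y, rfl⟩
    obtain ⟨p, rfl⟩ := hΨ y
    exact ⟨_, mem_range_self (Φ p), by rw [dist_comm, hd p]⟩

theorem ghDiam_toGHSpace (X : Type*) [MetricSpace X] [CompactSpace X] [Nonempty X] :
    ghDiam (GromovHausdorff.toGHSpace X) = Metric.diam (Set.univ : Set X) := by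
  obtain ⟨e⟩ := GromovHausdorff.toGHSpace_eq_toGHSpace_iff_isometryEquiv.1
    (GromovHausdorff.toGHSpace X).toGHSpace_rep
  exact e.diam_univ

theorem ghDiam_nonneg (X : GromovHausdorff.GHSpace) : 0 ≤ ghDiam X := Metric.diam_nonneg

theorem dist_le_ghDiam {X : GromovHausdorff.GHSpace} (x y : X.Rep) : dist x y ≤ ghDiam X :=
  Metric.dist_le_diam_of_mem isCompact_univ.isBounded (Set.mem_univ x) (Set.mem_univ y)

theorem subsingleton_onePointGH_rep : Subsingleton onePointGH.Rep := by
  let := simplexMetric 1 1 one_pos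
  obtain ⟨e⟩ := GromovHausdorff.toGHSpace_eq_toGHSpace_iff_isometryEquiv.1
    (GromovHausdorff.GHSpace.toGHSpace_rep onePointGH : _ = GromovHausdorff.toGHSpace (Fin 1))
  exact e.injective.subsingleton

theorem ghDiam_onePointGH : ghDiam onePointGH = 0 :=
  have := subsingleton_onePointGH_rep
  Metric.diam_subsingleton Set.subsingleton_univ

theorem dist_le_max_ghDiam (X Y : GromovHausdorff.GHSpace) :
    dist X Y ≤ max (ghDiam X) (ghDiam Y) / 2 := by
  rw [GromovHausdorff.dist_ghDist]
  refine ghDist_le_of_surjective (Z := X.Rep × Y.Rep) Prod.fst_surjective Prod.snd_surjective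
    fun p q => ?_
  rw [mul_div_cancel₀ _ two_ne_zero]
  rw [abs_sub_le_iff]
  constructor
  · linarith [dist_le_ghDiam p.1 q.1, le_max_left (ghDiam X) (ghDiam Y),
      dist_nonneg (x := p.2) (y := q.2)]
  · linarith [dist_le_ghDiam p.2 q.2, le_max_right (ghDiam X) (ghDiam Y),
      dist_nonneg (x := p.1) (y := q.1)]

open GromovHausdorff Metric Set in
theorem ghDiam_le_two_mul_dist_onePointGH (X : GHSpace) : ghDiam X ≤ 2 * dist X onePointGH := by
  have := subsingleton_onePointGH_rep
  obtain ⟨Φ, Ψ, hΦ, hΨ, h⟩ := ghDist_eq_hausdorffDist X.Rep onePointGH.Rep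
  obtain ⟨c⟩ := (inferInstance : Nonempty onePointGH.Rep)
  have hc : range Ψ = {Ψ c} := by
    ext y
    constructor
    · rintro ⟨d, rfl⟩
      rw [Subsingleton.elim d c]
      rfl
    · rintro rfl
      exact ⟨c, rfl⟩
  have hfin := hausdorffEDist_ne_top_of_nonempty_of_bounded (range_nonempty Φ) (range_nonempty Ψ)
    (isCompact_range hΦ.continuous).isBounded (isCompact_range hΨ.continuous).isBounded
  have key (x : X.Rep) : dist (Φ x) (Ψ c) ≤ dist X onePointGH := by
    have := infDist_le_hausdorffDist_of_mem (mem_range_self x) hfin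
    rwa [← h, hc, infDist_singleton, ← dist_ghDist] at this
  refine diam_le_of_forall_dist_le (by positivity) fun x _ y _ => ?_
  rw [← hΦ.dist_eq]
  linarith [dist_triangle_right (Φ x) (Φ y) (Ψ c), key x, key y]

theorem ghDiam_eq_two_mul_dist_onePointGH (X : GromovHausdorff.GHSpace) :
    ghDiam X = 2 * dist X onePointGH := by
  refine le_antisymm (ghDiam_le_two_mul_dist_onePointGH X) ?_
  have h := dist_le_max_ghDiam X onePointGH
  rw [ghDiam_onePointGH, max_eq_left (ghDiam_nonneg X)] at h
  linarith

open GromovHausdorff Metric Set Pointwise in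
/-- Doubling all distances of `X` doubles its diameter and moves it by at most half of the
diameter. -/
theorem exists_ghDiam_eq_two_mul (X : GHSpace) :
    ∃ Y : GHSpace, ghDiam Y = 2 * ghDiam X ∧ dist X Y ≤ ghDiam X / 2 := by
  let φ := kuratowskiEmbedding X.Rep
  have hφ : Isometry φ := kuratowskiEmbedding.isometry X.Rep
  let ψ := fun x => (2 : ℝ) • φ x
  have hψ (x y : X.Rep) : dist (ψ x) (ψ y) = 2 * dist x y := by
    simp only [ψ]
    rw [dist_smul₀, hφ.dist_eq]
    simp
  have : CompactSpace (range ψ) :=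
    isCompact_iff_compactSpace.1 (isCompact_range (hφ.continuous.const_smul (2 : ℝ)))
  refine ⟨toGHSpace (range ψ), ?_, ?_⟩
  · have hdiam : ghDiam (toGHSpace (range ψ)) = diam ((2 : ℝ) • range φ) := by
      rw [ghDiam_toGHSpace, ← (isometry_subtype_coe (s := range ψ)).diam_range,
        Subtype.range_coe, ← image_smul, ← range_comp]
      rfl
    rw [hdiam, diam_smul₀, hφ.diam_range]
    simp [ghDiam]
  · have hX : dist X (toGHSpace (range ψ)) = ghDist X.Rep (range ψ) :=
      congrArg (dist · _) X.toGHSpace_rep.symm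
    rw [hX]
    refine ghDist_le_of_surjective Function.surjective_id (rangeFactorization_surjective (f := ψ))
      fun x y => ?_
    have h : dist (rangeFactorization ψ x) (rangeFactorization ψ y) = 2 * dist x y := hψ x y
    rw [h, id, id, abs_sub_comm, abs_of_nonneg (by linarith [dist_nonneg (x := x) (y := y)])]
    linarith [dist_le_ghDiam x y]

/-- A point `Z` whose distances satisfy the ultrametric inequality through `Z` is the one-point
space. -/
theorem eq_onePointGH_of_dist_le_max {Z : GromovHausdorff.GHSpace}
    (hZ : ∀ X Y, dist X Y ≤ max (dist X Z) (dist Z Y)) : Z = onePointGH := by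
  obtain ⟨Y, hY, hZY⟩ := exists_ghDiam_eq_two_mul Z
  have h := hZ onePointGH Y
  have h1 := ghDiam_eq_two_mul_dist_onePointGH Y
  have h2 := ghDiam_eq_two_mul_dist_onePointGH Z
  rw [dist_comm onePointGH Y, dist_comm onePointGH Z] at h
  refine dist_le_zero.1 ?_
  rcases le_max_iff.1 h with h | h <;> linarith

/-- Every surjective isometry of the Gromov–Hausdorff space fixes the class of the
one-point metric space, and consequently preserves diameters. -/
theorem ghspace_isometry_fixes_onePoint
    (f : GromovHausdorff.GHSpace ≃ᵢ GromovHausdorff.GHSpace) :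
    f onePointGH = onePointGH ∧ ∀ X : GromovHausdorff.GHSpace, ghDiam (f X) = ghDiam X := by
  have hf : f onePointGH = onePointGH := by
    refine eq_onePointGH_of_dist_le_max fun X Y => ?_
    obtain ⟨X, rfl⟩ := f.surjective X
    obtain ⟨Y, rfl⟩ := f.surjective Y
    simp only [f.dist_eq]
    have h := dist_le_max_ghDiam X Y
    rwa [ghDiam_eq_two_mul_dist_onePointGH, ghDiam_eq_two_mul_dist_onePointGH,
      ← mul_max_of_nonneg _ _ zero_le_two, mul_div_cancel_left₀ _ two_ne_zero,
      dist_comm Y] at h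
  refine ⟨hf, fun X => ?_⟩
  rw [ghDiam_eq_two_mul_dist_onePointGH, ghDiam_eq_two_mul_dist_onePointGH X]
  nth_rw 1 [← hf]
  rw [f.dist_eq]
end

section
/- Let t > 0 and n ≥ 1 be an integer. For all B, C ∈ GHSpace with diam B ≤ t and diam C ≤ t, one has d_GH(B, C) ≤ max{ d_GH(tΔ_n, B), d_GH(tΔ_n, C) }. In other words, in no triangle of GHSpace with one vertex at tΔ_n and the other two vertices of diameter at most t can the side opposite to tΔ_n be strictly the longest. -/
open GromovHausdorff in
/-- The Gromov–Hausdorff distance is at most half the distortion of any correspondence. -/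
theorem GromovHausdorff.ghDist_le_of_correspondence {X Y : Type*} [MetricSpace X] [CompactSpace X]
    [Nonempty X] [MetricSpace Y] [CompactSpace Y] [Nonempty Y] (R : X → Y → Prop) {r : ℝ}
    (hr : 0 < r) (hl : ∀ x, ∃ y, R x y) (hrt : ∀ y, ∃ x, R x y)
    (hR : ∀ x y x' y', R x y → R x' y' → |dist x x' - dist y y'| ≤ 2 * r) :
    ghDist X Y ≤ r := by
  let Z := {p : X × Y // R p.1 p.2}
  have : Nonempty Z := by
    obtain ⟨x⟩ := ‹Nonempty X›
    obtain ⟨y, hy⟩ := hl x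
    exact ⟨⟨(x, y), hy⟩⟩
  let Φ : Z → X := fun p => p.1.1
  let Ψ : Z → Y := fun p => p.1.2
  let _ : MetricSpace (X ⊕ Y) := Metric.glueMetricApprox Φ Ψ r hr
    fun p q => hR _ _ _ _ p.2 q.2
  have hdist : ∀ x y, R x y → dist (Sum.inl x : X ⊕ Y) (Sum.inr y) = r := fun x y h =>
    Metric.glueDist_glued_points Φ Ψ r (⟨(x, y), h⟩ : Z)
  refine (ghDist_le_hausdorffDist (Φ := (Sum.inl : X → X ⊕ Y)) (Ψ := (Sum.inr : Y → X ⊕ Y))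
    (Isometry.of_dist_eq fun _ _ => rfl) (Isometry.of_dist_eq fun _ _ => rfl)).trans
    (Metric.hausdorffDist_le_of_mem_dist hr.le ?_ ?_)
  · rintro _ ⟨x, rfl⟩
    obtain ⟨y, hy⟩ := hl x
    exact ⟨_, ⟨y, rfl⟩, (hdist x y hy).le⟩
  · rintro _ ⟨y, rfl⟩
    obtain ⟨x, hx⟩ := hrt y
    exact ⟨_, ⟨x, rfl⟩, (dist_comm _ _).trans_le (hdist x y hx).le⟩

open GromovHausdorff in
/-- Compact spaces at Gromov–Hausdorff distance less than `r` admit a correspondence of distortion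
at most `2 * r`. -/
theorem GromovHausdorff.exists_correspondence_of_ghDist_lt {X Y : Type*} [MetricSpace X]
    [CompactSpace X] [Nonempty X] [MetricSpace Y] [CompactSpace Y] [Nonempty Y] {r : ℝ}
    (h : ghDist X Y < r) :
    ∃ R : X → Y → Prop, (∀ x, ∃ y, R x y) ∧ (∀ y, ∃ x, R x y) ∧
      ∀ x y x' y', R x y → R x' y' → |dist x x' - dist y y'| ≤ 2 * r := by
  obtain ⟨Φ, Ψ, hΦ, hΨ, hd⟩ := ghDist_eq_hausdorffDist X Y
  rw [hd] at h
  have hne : Metric.hausdorffEDist (Set.range Φ) (Set.range Ψ) ≠ ⊤ :=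
    Metric.hausdorffEDist_ne_top_of_nonempty_of_bounded (Set.range_nonempty _)
      (Set.range_nonempty _) (isCompact_range hΦ.continuous).isBounded
      (isCompact_range hΨ.continuous).isBounded
  refine ⟨fun x y => dist (Φ x) (Ψ y) < r, fun x => ?_, fun y => ?_, fun x y x' y' hxy hxy' => ?_⟩
  · obtain ⟨_, ⟨y, rfl⟩, hy⟩ :=
      Metric.exists_dist_lt_of_hausdorffDist_lt (Set.mem_range_self x) h hne
    exact ⟨y, hy⟩
  · obtain ⟨_, ⟨x, rfl⟩, hx⟩ :=
      Metric.exists_dist_lt_of_hausdorffDist_lt' (Set.mem_range_self y) h hne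
    exact ⟨x, hx⟩
  · have := dist_dist_dist_le (Φ x) (Φ x') (Ψ y) (Ψ y')
    rw [Real.dist_eq, hΦ.dist_eq, hΨ.dist_eq] at this
    linarith

/-- In a triangle of `GHSpace` with one vertex at `tΔ_n` and the other two vertices of
diameter at most `t`, the side opposite to `tΔ_n` is never strictly the longest. -/
theorem ghspace_simplex_side_not_longest (n : ℕ) (hn : 1 ≤ n) (t : ℝ) (ht : 0 < t)
    (B C : GromovHausdorff.GHSpace) (hB : ghDiam B ≤ t) (hC : ghDiam C ≤ t) :
    dist B C ≤ max (dist (simplexGH n hn t ht) B) (dist (simplexGH n hn t ht) C) := by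
  have hdist (X : GromovHausdorff.GHSpace) {x y : X.Rep} (hX : ghDiam X ≤ t) : dist x y ≤ t :=
    (Metric.dist_le_diam_of_mem isCompact_univ.isBounded (Set.mem_univ x) (Set.mem_univ y)).trans hX
  let _ := simplexMetric n t ht
  have : Nonempty (Fin n) := ⟨⟨0, hn⟩⟩
  have hne {i j : Fin n} (h : i ≠ j) : dist i j = t := if_neg h
  have hsimplex (X : GromovHausdorff.GHSpace) :
      dist (simplexGH n hn t ht) X = GromovHausdorff.ghDist (Fin n) X.Rep := by
    conv_lhs => rw [← X.toGHSpace_rep]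
    rfl
  rw [hsimplex, hsimplex, GromovHausdorff.dist_ghDist]
  refine le_of_forall_gt_imp_ge_of_dense fun r hr => ?_
  obtain ⟨hrB, hrC⟩ := max_lt_iff.1 hr
  have hr0 : 0 < r := (dist_nonneg : 0 ≤ GromovHausdorff.ghDist (Fin n) B.Rep).trans_lt hrB
  rcases le_or_gt t (2 * r) with htr | htr
  · refine GromovHausdorff.ghDist_le_of_correspondence (fun _ _ => True) hr0
      (fun _ => ⟨Classical.arbitrary _, trivial⟩) (fun _ => ⟨Classical.arbitrary _, trivial⟩)
      fun b c b' c' _ _ => ?_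
    have := hdist B (x := b) (y := b') hB
    have := hdist C (x := c) (y := c') hC
    rw [abs_le]
    constructor <;> linarith [dist_nonneg (x := b) (y := b'), dist_nonneg (x := c) (y := c')]
  · obtain ⟨R, hRl, hRr, hR⟩ := GromovHausdorff.exists_correspondence_of_ghDist_lt hrB
    obtain ⟨S, hSl, hSr, hS⟩ := GromovHausdorff.exists_correspondence_of_ghDist_lt hrC
    refine GromovHausdorff.ghDist_le_of_correspondence (fun b c => ∃ i, R i b ∧ S i c) hr0
      (fun b => ?_) (fun c => ?_) ?_
    · obtain ⟨i, hi⟩ := hRr b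
      obtain ⟨c, hc⟩ := hSl i
      exact ⟨c, i, hi, hc⟩
    · obtain ⟨i, hi⟩ := hSr c
      obtain ⟨b, hb⟩ := hRl i
      exact ⟨b, i, hb, hi⟩
    · rintro b c b' c' ⟨i, hib, hic⟩ ⟨j, hjb, hjc⟩
      have h₁ := abs_le.1 (hR i b j b' hib hjb)
      have h₂ := abs_le.1 (hS i c j c' hic hjc)
      have := hdist B (x := b) (y := b') hB
      have := hdist C (x := c) (y := c') hC
      rw [abs_le]
      by_cases hij : i = j
      · subst hij
        rw [dist_self] at h₁ h₂
        constructor <;> linarith [dist_nonneg (x := b) (y := b'), dist_nonneg (x := c) (y := c')]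
      · rw [hne hij] at h₁ h₂
        constructor <;> linarith
end

section
/- Let t > 0 and let A ∈ GHSpace satisfy diam A ≤ t and A ≠ tΔ_n for every integer n ≥ 1. Then there exist B, C ∈ GHSpace with diam B ≤ t and diam C ≤ t such that max{ d_GH(A, B), d_GH(A, C) } < d_GH(B, C); that is, A is the vertex of a triangle inside the ball of radius t/2 around Δ_1 whose opposite side is strictly the longest. -/
/-- The metric obtained by scaling by `k` and truncating at height `T`. -/
@[reducible]
noncomputable def truncatedScalingMetric (X : Type) [MetricSpace X] (k T : ℝ) (hk : 0 < k)
    (hT : 0 < T) : MetricSpace X where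
  dist x y := min T (k * dist x y)
  dist_self x := by simp [hT.le]
  dist_comm x y := by simp [dist_comm]
  dist_triangle x y z := by
    have h1 := mul_le_mul_of_nonneg_left (dist_triangle x y z) hk.le
    have h2 : 0 ≤ k * dist x y := by positivity
    have h3 : 0 ≤ k * dist y z := by positivity
    rcases min_cases T (k * dist x y) with h | h <;>
    rcases min_cases T (k * dist y z) with h' | h' <;>
    rcases min_cases T (k * dist x z) with h'' | h'' <;> linarith
  eq_of_dist_eq_zero {x y} h := by
    rcases min_choice T (k * dist x y) with h' | h'
    · exact absurd (h'.symm.trans h) hT.ne'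
    · exact dist_eq_zero.1 ((mul_eq_zero.1 (h'.symm.trans h)).resolve_left hk.ne')

theorem compactSpace_truncatedScalingMetric (X : Type) [MetricSpace X] [CompactSpace X] (k T : ℝ)
    (hk : 0 < k) (hT : 0 < T) :
    @CompactSpace X (truncatedScalingMetric X k T hk hT).toUniformSpace.toTopologicalSpace := by
  have hcont : @Continuous X X _
      (truncatedScalingMetric X k T hk hT).toUniformSpace.toTopologicalSpace fun x => x := by
    refine (@Metric.continuous_iff X X _ (truncatedScalingMetric X k T hk hT).toPseudoMetricSpace
      fun x => x).2 fun b ε hε => ⟨ε / k, by positivity, fun a ha => ?_⟩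
    rw [lt_div_iff₀' hk] at ha
    exact (min_le_right T (k * dist a b)).trans_lt ha
  have := @isCompact_range X X _
    (truncatedScalingMetric X k T hk hT).toUniformSpace.toTopologicalSpace _ _ hcont
  rw [Set.range_id'] at this
  exact @CompactSpace.mk X
    (truncatedScalingMetric X k T hk hT).toUniformSpace.toTopologicalSpace this

open GromovHausdorff in
/-- Scaling a metric by `k` and truncating it at height `T` gives a point of the
Gromov–Hausdorff space. -/
theorem exists_ghSpace_truncated_scaling (X : Type) [MetricSpace X] [CompactSpace X] [Nonempty X]
    (k T : ℝ) (hk : 0 < k) (hT : 0 < T) :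
    ∃ (Y : GHSpace) (e : X ≃ Y.Rep), ∀ x y, dist (e x) (e y) = min T (k * dist x y) := by
  have hcomp := compactSpace_truncatedScalingMetric X k T hk hT
  obtain ⟨e⟩ := (@toGHSpace_eq_toGHSpace_iff_isometryEquiv X (truncatedScalingMetric X k T hk hT)
    hcomp _ _ _ _ _).1 (GHSpace.toGHSpace_rep _).symm
  exact ⟨_, @IsometryEquiv.toEquiv X _
      (truncatedScalingMetric X k T hk hT).toPseudoMetricSpace.toPseudoEMetricSpace _ e,
    @IsometryEquiv.dist_eq X _ (truncatedScalingMetric X k T hk hT).toPseudoMetricSpace _ e⟩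

open GromovHausdorff in
/-- A bijection with distortion at most `δ` bounds the Gromov–Hausdorff distance by `δ / 2`. -/
theorem dist_ghSpace_le_of_equiv {X Y : GHSpace} (e : X.Rep ≃ Y.Rep) (δ : ℝ)
    (h : ∀ x y, |dist x y - dist (e x) (e y)| ≤ δ) : dist X Y ≤ δ / 2 := by
  rw [dist_ghDist]
  have := ghDist_le_of_approx_subsets (s := (Set.univ : Set X.Rep)) (fun x => e x)
    (ε₁ := 0) (ε₂ := δ) (ε₃ := 0) (fun x => ⟨x, trivial, by simp⟩)
    (fun y => ⟨⟨e.symm y, trivial⟩, by simp⟩) (fun x y => h x y)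
  linarith

open GromovHausdorff in
/-- If `Y` contains an `a`-separated family indexed by `ι` while every such family in `X` has two
members at distance at most `b`, then `X` and `Y` are at distance at least `(a - b) / 2`. -/
theorem le_dist_ghSpace_of_separated {ι : Type*} {X Y : GHSpace} (a b : ℝ) (y : ι → Y.Rep)
    (hy : Pairwise fun i j => a ≤ dist (y i) (y j))
    (hX : ∀ x : ι → X.Rep, ∃ i j, i ≠ j ∧ dist (x i) (x j) ≤ b) :
    (a - b) / 2 ≤ dist X Y := by
  by_contra! hlt
  rw [dist_ghDist, ← hausdorffDist_optimal] at hlt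
  have key : ∀ i, ∃ x : X.Rep,
      dist (optimalGHInjl X.Rep Y.Rep x) (optimalGHInjr X.Rep Y.Rep (y i)) < (a - b) / 2 := by
    intro i
    obtain ⟨_, ⟨x, rfl⟩, hx⟩ := Metric.exists_dist_lt_of_hausdorffDist_lt'
      (Set.mem_range_self (y i)) hlt
      (Metric.hausdorffEDist_ne_top_of_nonempty_of_bounded (Set.range_nonempty _)
        (Set.range_nonempty _) (Metric.isBounded_of_compactSpace)
        (Metric.isBounded_of_compactSpace))
    exact ⟨x, hx⟩
  choose x hx using key
  obtain ⟨i, j, hij, hb⟩ := hX x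
  have h1 : a ≤ dist (y i) (y j) := hy hij
  rw [← (isometry_optimalGHInjr X.Rep Y.Rep).dist_eq] at h1
  rw [← (isometry_optimalGHInjl X.Rep Y.Rep).dist_eq] at hb
  have h2 := dist_triangle4 (optimalGHInjr X.Rep Y.Rep (y i)) (optimalGHInjl X.Rep Y.Rep (x i))
    (optimalGHInjl X.Rep Y.Rep (x j)) (optimalGHInjr X.Rep Y.Rep (y j))
  rw [dist_comm (optimalGHInjr X.Rep Y.Rep (y i)) (optimalGHInjl X.Rep Y.Rep (x i))] at h2
  linarith [hx i, hx j]

/-- In a compact metric space the cardinality of `t`-separated families is bounded. -/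
theorem exists_forall_fin_dist_lt (X : Type*) [MetricSpace X] [CompactSpace X] {t : ℝ}
    (ht : 0 < t) : ∃ n : ℕ, ∀ x : Fin n → X, ∃ i j, i ≠ j ∧ dist (x i) (x j) < t := by
  obtain ⟨F, -, hF, hcov⟩ := finite_cover_balls_of_compact (isCompact_univ (X := X)) (half_pos ht)
  have := hF.fintype
  refine ⟨Fintype.card F + 1, fun x => ?_⟩
  have hc : ∀ i, ∃ c : F, dist (x i) c < t / 2 := fun i => by
    obtain ⟨c, hc, h⟩ := Set.mem_iUnion₂.1 (hcov (Set.mem_univ (x i)))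
    exact ⟨⟨c, hc⟩, h⟩
  choose c hc using hc
  obtain ⟨i, j, hij, h⟩ := Fintype.exists_ne_map_eq_of_card_lt c (by simp)
  refine ⟨i, j, hij, ?_⟩
  have h1 := hc i
  have h2 := hc j
  rw [← h] at h2
  linarith [dist_triangle_right (x i) (x j) (c i)]

/-- A compact space that is not the image of a `t`-separated finite family
has, for some `n`, a largest separation `s` of `n`-point families with `0 < s < t`. -/
theorem exists_optimal_separation (X : Type*) [MetricSpace X] [CompactSpace X] [Nonempty X] {t : ℝ}
    (ht : 0 < t)
    (hX : ∀ (n : ℕ) (x : Fin n → X), (Pairwise fun i j => t ≤ dist (x i) (x j)) →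
      ¬ Function.Surjective x) :
    ∃ (n : ℕ) (s : ℝ), 0 < s ∧ s < t ∧
      (∃ x : Fin n → X, Pairwise fun i j => s ≤ dist (x i) (x j)) ∧
      ∀ x : Fin n → X, ∃ i j, i ≠ j ∧ dist (x i) (x j) ≤ s := by
  classical
  have hex := exists_forall_fin_dist_lt X ht
  obtain ⟨n, hn, hmin⟩ : ∃ n : ℕ, (∀ x : Fin n → X, ∃ i j, i ≠ j ∧ dist (x i) (x j) < t) ∧
      ∀ m < n, ¬ ∀ x : Fin m → X, ∃ i j, i ≠ j ∧ dist (x i) (x j) < t :=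
    ⟨Nat.find hex, Nat.find_spec hex, fun m hm => Nat.find_min hex hm⟩
  obtain ⟨p⟩ := ‹Nonempty X›
  obtain ⟨i₀, j₀, hij₀, -⟩ := hn fun _ => p
  obtain ⟨m, rfl⟩ : ∃ m, n = m + 1 := Nat.exists_eq_succ_of_ne_zero fun h => (h ▸ i₀).elim0
  have hm := hmin m (Nat.lt_succ_self m)
  push Not at hm
  obtain ⟨x, hx⟩ := hm
  obtain ⟨q, hq⟩ := not_forall.1 (hX m x fun i j hij => hx i j hij)
  have hxinj : Function.Injective x := fun i j h => by
    by_contra hij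
    have := hx i j hij
    rw [h, dist_self] at this
    linarith
  have hinj : Function.Injective (Fin.cons q x : Fin (m + 1) → X) :=
    Fin.cons_injective_iff.2 ⟨hq, hxinj⟩
  let S : Finset (Fin (m + 1) × Fin (m + 1)) := Finset.univ.offDiag
  have hS : S.Nonempty := ⟨(i₀, j₀), by simp [S, hij₀]⟩
  let g : (Fin (m + 1) → X) → ℝ := fun x => S.inf' hS fun a => dist (x a.1) (x a.2)
  have hg : Continuous g := by
    refine Continuous.finset_inf'_apply hS fun a _ => ?_
    fun_prop
  obtain ⟨z, -, hz⟩ := isCompact_univ.exists_isMaxOn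
    (Set.univ_nonempty (α := Fin (m + 1) → X)) hg.continuousOn
  have hgle : ∀ (x : Fin (m + 1) → X) i j, i ≠ j → g x ≤ dist (x i) (x j) := fun x i j hij =>
    Finset.inf'_le (fun a : Fin (m + 1) × Fin (m + 1) => dist (x a.1) (x a.2))
      (show (i, j) ∈ S by simp [S, hij])
  refine ⟨m + 1, g z, ?_, ?_, ⟨z, fun i j hij => hgle z i j hij⟩, fun y => ?_⟩
  · refine lt_of_lt_of_le ?_ (hz (Set.mem_univ (Fin.cons q x : Fin (m + 1) → X)))
    refine (Finset.lt_inf'_iff hS).2 fun a ha => dist_pos.2 (hinj.ne ?_)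
    simpa [S] using ha
  · obtain ⟨i, j, hij, h⟩ := hn z
    exact (hgle z i j hij).trans_lt h
  · obtain ⟨a, ha, h⟩ := S.exists_mem_eq_inf' hS fun a => dist (y a.1) (y a.2)
    refine ⟨a.1, a.2, by simpa [S] using ha, ?_⟩
    rw [← h]
    exact hz (Set.mem_univ y)

/-- A point of the Gromov–Hausdorff space enumerated by a family with all distances equal to `t`
is a simplex. -/
theorem eq_simplexGH_of_surjective (A : GromovHausdorff.GHSpace) (t : ℝ) (ht : 0 < t) (n : ℕ)
    (hn : 0 < n) (x : Fin n → A.Rep) (hx : Pairwise fun i j => dist (x i) (x j) = t)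
    (hsurj : Function.Surjective x) : A = simplexGH n hn t ht := by
  have hinj : Function.Injective x := fun i j h => by
    by_contra hij
    have := hx hij
    simp only [h, dist_self] at this
    exact ht.ne this
  let _ := simplexMetric n t ht
  have : Nonempty (Fin n) := ⟨⟨0, hn⟩⟩
  rw [← A.toGHSpace_rep]
  refine Eq.symm ?_
  refine GromovHausdorff.toGHSpace_eq_toGHSpace_iff_isometryEquiv.2
    ⟨⟨Equiv.ofBijective x ⟨hinj, hsurj⟩, Isometry.of_dist_eq fun i j => ?_⟩⟩
  change dist (x i) (x j) = if i = j then 0 else t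
  split_ifs with h
  · simp [h]
  · exact hx h

/-- If `A` lies in the ball of radius `t/2` around `Δ₁` (i.e. `diam A ≤ t`) and `A` is not
one of the simplexes `tΔ_n`, then `A` is a vertex of a triangle inside this ball whose
opposite side is strictly the longest. -/
theorem ghspace_non_simplex_has_long_opposite_side (t : ℝ) (ht : 0 < t)
    (A : GromovHausdorff.GHSpace) (hA : ghDiam A ≤ t)
    (hAn : ∀ (n : ℕ) (hn : 1 ≤ n), A ≠ simplexGH n hn t ht) :
    ∃ B C : GromovHausdorff.GHSpace, ghDiam B ≤ t ∧ ghDiam C ≤ t ∧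
      max (dist A B) (dist A C) < dist B C := by
  have hdiam : ∀ x y : A.Rep, dist x y ≤ t := fun x y =>
    (Metric.dist_le_diam_of_mem Metric.isBounded_of_compactSpace (Set.mem_univ x)
      (Set.mem_univ y)).trans hA
  obtain ⟨n, s, hs, hst, ⟨z, hz⟩, hsep⟩ := exists_optimal_separation A.Rep ht fun n x hx hsurj => by
    obtain ⟨i, -⟩ := hsurj (Classical.arbitrary A.Rep)
    exact hAn n i.pos (eq_simplexGH_of_surjective A t ht n i.pos x
      (fun i j hij => (hdiam _ _).antisymm (hx hij)) hsurj)
  obtain ⟨B, e, he⟩ := exists_ghSpace_truncated_scaling A.Rep (s / t) t (by positivity) ht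
  obtain ⟨C, f, hf⟩ := exists_ghSpace_truncated_scaling A.Rep (t / s) t (by positivity) ht
  have heB : ∀ x y, dist (e x) (e y) = s / t * dist x y := fun x y => by
    rw [he, min_eq_right]
    exact (mul_le_of_le_one_left dist_nonneg ((div_le_one ht).2 hst.le)).trans (hdiam x y)
  refine ⟨B, C, Metric.diam_le_of_forall_dist_le ht.le fun x _ y _ => ?_,
    Metric.diam_le_of_forall_dist_le ht.le fun x _ y _ => ?_, ?_⟩
  · rw [← e.apply_symm_apply x, ← e.apply_symm_apply y, he]
    exact min_le_left _ _
  · rw [← f.apply_symm_apply x, ← f.apply_symm_apply y, hf]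
    exact min_le_left _ _
  have hAB : dist A B ≤ (t - s) / 2 := dist_ghSpace_le_of_equiv e _ fun x y => by
    have h1 : dist x y - s / t * dist x y = (t - s) * (dist x y / t) := by field_simp
    have h2 : dist x y / t ≤ 1 := (div_le_one ht).2 (hdiam x y)
    have h3 : 0 ≤ dist x y / t := by positivity
    rw [heB, h1, abs_of_nonneg (mul_nonneg (by linarith) h3)]
    exact mul_le_of_le_one_right (by linarith) h2
  have hAC : dist A C ≤ (t - s) / 2 := dist_ghSpace_le_of_equiv f _ fun x y => by
    have h1 : t / s * dist x y - dist x y = (t - s) * (dist x y / s) := by field_simp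
    have h2 : 0 ≤ dist x y / s := by positivity
    have h3 : 0 ≤ (t - s) * (dist x y / s) := mul_nonneg (by linarith) h2
    rw [hf, abs_sub_comm, abs_of_nonneg
      (sub_nonneg.2 (le_min (hdiam x y) (by linarith)))]
    rcases le_total (dist x y) s with h | h
    · have h4 : (t - s) * (dist x y / s) ≤ t - s :=
        mul_le_of_le_one_right (by linarith) ((div_le_one hs).2 h)
      linarith [min_le_right t (t / s * dist x y)]
    · linarith [min_le_left t (t / s * dist x y)]
  have hBC : (t - s / t * s) / 2 ≤ dist B C := by
    refine le_dist_ghSpace_of_separated t (s / t * s) (fun i => f (z i)) (fun i j hij => ?_)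
      fun x => ?_
    · change t ≤ dist (f (z i)) (f (z j))
      rw [hf]
      refine le_min le_rfl ?_
      calc t = t / s * s := by field_simp
        _ ≤ _ := mul_le_mul_of_nonneg_left (hz hij) (by positivity)
    · obtain ⟨i, j, hij, h⟩ := hsep fun i => e.symm (x i)
      refine ⟨i, j, hij, ?_⟩
      rw [← e.apply_symm_apply (x i), ← e.apply_symm_apply (x j), heB]
      exact mul_le_mul_of_nonneg_left h (by positivity)
  have hlt : s / t * s < s := mul_lt_of_lt_one_left hs ((div_lt_one ht).2 hst)
  exact max_lt (by linarith) (by linarith)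
end

section
/- Let f be a surjective isometry of the Gromov–Hausdorff space onto itself. Then for every integer n ≥ 2 and every real t > 0, f(tΔ_n) = tΔ_n. -/
open GromovHausdorff Metric Set

section Correspondences

variable {X Y : Type*} [MetricSpace X] [CompactSpace X] [Nonempty X]
  [MetricSpace Y] [CompactSpace Y] [Nonempty Y]

/-- A correspondence of distortion at most `r` bounds the Gromov–Hausdorff distance by `r / 2`. -/
theorem dist_toGHSpace_le_of_correspondence {r : ℝ} (R : X → Y → Prop)
    (hl : ∀ x, ∃ y, R x y) (hr : ∀ y, ∃ x, R x y)
    (H : ∀ x y x' y', R x y → R x' y' → |dist x x' - dist y y'| ≤ r) :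
    dist (toGHSpace X) (toGHSpace Y) ≤ r / 2 := by
  obtain ⟨x₀⟩ := ‹Nonempty X›
  obtain ⟨y₀, h₀⟩ := hl x₀
  have r0 : 0 ≤ r := (abs_nonneg _).trans (H _ _ _ _ h₀ h₀)
  refine le_of_forall_pos_le_add fun δ δ0 => ?_
  let Z := {p : X × Y // R p.1 p.2}
  let Φ : Z → X := fun p => p.1.1
  let Ψ : Z → Y := fun p => p.1.2
  have : Nonempty Z := ⟨⟨(x₀, y₀), h₀⟩⟩
  have hZ : ∀ p q : Z, |dist (Φ p) (Φ q) - dist (Ψ p) (Ψ q)| ≤ 2 * (r / 2 + δ) := fun p q =>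
    (H _ _ _ _ p.2 q.2).trans (by linarith)
  let _ : MetricSpace (X ⊕ Y) := glueMetricApprox Φ Ψ (r / 2 + δ) (by linarith) hZ
  have Il : Isometry (@Sum.inl X Y) := Isometry.of_dist_eq fun x y => rfl
  have Ir : Isometry (@Sum.inr X Y) := Isometry.of_dist_eq fun x y => rfl
  have glued : ∀ x y, R x y → dist (Sum.inl x : X ⊕ Y) (Sum.inr y) = r / 2 + δ := fun x y h =>
    glueDist_glued_points Φ Ψ (r / 2 + δ) ⟨(x, y), h⟩
  refine (ghDist_le_hausdorffDist Il Ir).trans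
    (hausdorffDist_le_of_mem_dist (by linarith) ?_ ?_)
  · rintro _ ⟨x, rfl⟩
    obtain ⟨y, h⟩ := hl x
    exact ⟨_, mem_range_self y, (glued x y h).le⟩
  · rintro _ ⟨y, rfl⟩
    obtain ⟨x, h⟩ := hr y
    exact ⟨_, mem_range_self x, by rw [dist_comm]; exact (glued x y h).le⟩

/-- A bound on the Gromov–Hausdorff distance is witnessed by a correspondence. -/
theorem exists_correspondence_of_dist_toGHSpace_lt {r : ℝ}
    (h : dist (toGHSpace X) (toGHSpace Y) < r / 2) :
    ∃ (R : X → Y → Prop) (r' : ℝ), r' < r ∧ (∀ x, ∃ y, R x y) ∧ (∀ y, ∃ x, R x y) ∧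
      ∀ x y x' y', R x y → R x' y' → |dist x x' - dist y y'| ≤ r' := by
  obtain ⟨s, hs, hsr⟩ := exists_between h
  have hd : hausdorffDist (range (optimalGHInjl X Y)) (range (optimalGHInjr X Y)) < s := by
    rw [hausdorffDist_optimal]; exact hs
  have fin := hausdorffEDist_ne_top_of_nonempty_of_bounded
    (range_nonempty (optimalGHInjl X Y)) (range_nonempty (optimalGHInjr X Y))
    (isCompact_range (isometry_optimalGHInjl X Y).continuous).isBounded
    (isCompact_range (isometry_optimalGHInjr X Y).continuous).isBounded
  refine ⟨fun x y => dist (optimalGHInjl X Y x) (optimalGHInjr X Y y) < s, 2 * s, by linarith,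
    fun x => ?_, fun y => ?_, fun x y x' y' h h' => ?_⟩
  · obtain ⟨_, ⟨y, rfl⟩, hy⟩ := exists_dist_lt_of_hausdorffDist_lt (mem_range_self x) hd fin
    exact ⟨y, hy⟩
  · obtain ⟨_, ⟨x, rfl⟩, hx⟩ := exists_dist_lt_of_hausdorffDist_lt' (mem_range_self y) hd fin
    exact ⟨x, hx⟩
  · rw [← (isometry_optimalGHInjl X Y).dist_eq x x', ← (isometry_optimalGHInjr X Y).dist_eq y y']
    have h1 := dist_triangle4 (optimalGHInjl X Y x) (optimalGHInjr X Y y)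
      (optimalGHInjr X Y y') (optimalGHInjl X Y x')
    have h2 := dist_triangle4 (optimalGHInjr X Y y) (optimalGHInjl X Y x)
      (optimalGHInjl X Y x') (optimalGHInjr X Y y')
    rw [dist_comm (optimalGHInjr X Y y') (optimalGHInjl X Y x')] at h1
    rw [dist_comm (optimalGHInjr X Y y) (optimalGHInjl X Y x)] at h2
    rw [abs_le]
    constructor <;> linarith

end Correspondences

section Simplexes

variable {X : Type*} [MetricSpace X] [CompactSpace X] [Nonempty X]

theorem exists_simplex_model (n : ℕ) (hn : 0 < n) (t : ℝ) (ht : 0 < t) :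
    ∃ (S : Type) (_ : MetricSpace S) (_ : CompactSpace S) (_ : Nonempty S) (e : S ≃ Fin n),
      toGHSpace S = simplexGH n hn t ht ∧
        ∀ a b : S, dist a b = if e a = e b then 0 else t :=
  letI := simplexMetric n t ht
  ⟨Fin n, simplexMetric n t ht, inferInstance, ⟨⟨0, hn⟩⟩, Equiv.refl _, rfl, fun _ _ => rfl⟩

theorem dist_simplexGH_le {n : ℕ} {hn : 0 < n} {t : ℝ} {ht : 0 < t} {r : ℝ} (g : X → Fin n)
    (hg : g.Surjective) (H : ∀ x y, |dist x y - if g x = g y then 0 else t| ≤ r) :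
    dist (toGHSpace X) (simplexGH n hn t ht) ≤ r / 2 := by
  obtain ⟨S, _, _, _, e, hS, hd⟩ := exists_simplex_model n hn t ht
  rw [← hS]
  refine dist_toGHSpace_le_of_correspondence (fun x a => g x = e a)
    (fun x => ⟨e.symm (g x), by simp⟩) (fun a => hg (e a)) fun x a x' a' h h' => ?_
  rw [hd, ← h, ← h']
  exact H x x'

theorem exists_partition_of_dist_simplexGH_lt {n : ℕ} {hn : 0 < n} {t : ℝ} {ht : 0 < t}
    (h : dist (toGHSpace X) (simplexGH n hn t ht) < t / 2) :
    ∃ (g : X → Fin n) (r : ℝ), r < t ∧ g.Surjective ∧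
      ∀ x y, |dist x y - if g x = g y then 0 else t| ≤ r := by
  obtain ⟨S, _, _, _, e, hS, hd⟩ := exists_simplex_model n hn t ht
  rw [← hS] at h
  obtain ⟨R, r, hr, hl, hR, H⟩ := exists_correspondence_of_dist_toGHSpace_lt h
  choose φ hφ using hl
  refine ⟨fun x => e (φ x), r, hr, fun i => ?_, fun x y => ?_⟩
  · obtain ⟨x, hx⟩ := hR (e.symm i)
    refine ⟨x, by_contra fun hne => ?_⟩
    have := H _ _ _ _ hx (hφ x)
    rw [hd, if_neg (by simpa using Ne.symm hne)] at this
    simp only [dist_self, zero_sub, abs_neg, abs_of_pos ht] at this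
    linarith
  · rw [← hd]
    exact H _ _ _ _ (hφ x) (hφ y)

theorem dist_onePointGH_le_iff {r : ℝ} :
    dist (toGHSpace X) onePointGH ≤ r / 2 ↔ ∀ x y : X, dist x y ≤ r := by
  constructor
  · intro h x y
    refine le_of_forall_gt_imp_ge_of_dense fun s hs => ?_
    obtain ⟨S, _, _, _, e, hS, hd⟩ := exists_simplex_model 1 one_pos 1 one_pos
    have h' : dist (toGHSpace X) (toGHSpace S) < s / 2 := by
      rw [hS]; exact h.trans_lt (by linarith)
    obtain ⟨R, s', hs', hl, -, H⟩ := exists_correspondence_of_dist_toGHSpace_lt h'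
    obtain ⟨a, ha⟩ := hl x
    obtain ⟨b, hb⟩ := hl y
    have := H _ _ _ _ ha hb
    rw [hd, if_pos (Subsingleton.elim _ _), sub_zero, abs_of_nonneg dist_nonneg] at this
    linarith
  · intro h
    refine dist_simplexGH_le (fun _ => 0) (fun i => ?_) fun x y => ?_
    · obtain ⟨x⟩ := ‹Nonempty X›
      exact ⟨x, Subsingleton.elim _ _⟩
    · simpa using h x y

theorem dist_onePointGH_lt_iff {r : ℝ} :
    dist (toGHSpace X) onePointGH < r / 2 ↔ ∃ s < r, ∀ x y : X, dist x y ≤ s := by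
  constructor
  · intro h
    exact ⟨2 * dist (toGHSpace X) onePointGH, by linarith,
      dist_onePointGH_le_iff.1 (by linarith)⟩
  · rintro ⟨s, hs, h⟩
    exact (dist_onePointGH_le_iff.2 h).trans_lt (by linarith)

end Simplexes

/-- Scaling the metric by `C` and truncating at `s` yields a compact space again. -/
theorem exists_truncation.{u} (X : Type u) [MetricSpace X] [CompactSpace X] [Nonempty X]
    {s C : ℝ} (hs : 0 < s) (hC : 0 < C) :
    ∃ (W : Type u) (_ : MetricSpace W) (_ : CompactSpace W) (_ : Nonempty W) (e : X ≃ W),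
      ∀ x y, dist (e x) (e y) = min s (C * dist x y) := by
  obtain ⟨W, ⟨e⟩⟩ : ∃ W : Type u, Nonempty (X ≃ W) := ⟨X, ⟨Equiv.refl X⟩⟩
  let m : MetricSpace W :=
    { dist := fun a b => min s (C * dist (e.symm a) (e.symm b))
      dist_self := fun a => by simp [hs.le]
      dist_comm := fun a b => by simp [dist_comm]
      dist_triangle := fun a b c => by
        have h := mul_le_mul_of_nonneg_left (dist_triangle (e.symm a) (e.symm b) (e.symm c)) hC.le
        have h1 : 0 ≤ C * dist (e.symm a) (e.symm b) := by positivity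
        have h2 : 0 ≤ C * dist (e.symm b) (e.symm c) := by positivity
        grind
      eq_of_dist_eq_zero := fun {a b} h => by
        have h1 : 0 ≤ C * dist (e.symm a) (e.symm b) := by positivity
        have h2 : C * dist (e.symm a) (e.symm b) = 0 := by grind
        exact e.symm.injective (dist_eq_zero.1 ((mul_eq_zero.1 h2).resolve_left hC.ne')) }
  have hd : ∀ x y : X, dist (e x) (e y) = min s (C * dist x y) := fun x y => by
    change min s (C * dist (e.symm (e x)) (e.symm (e y))) = _
    simp
  have hc : Continuous e :=
    (LipschitzWith.of_dist_le_mul (K := ⟨C, hC.le⟩)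
      fun x y => (hd x y).trans_le (min_le_right _ _)).continuous
  exact ⟨W, m, e.surjective.compactSpace hc, e.nonempty_congr.1 inferInstance, e, hd⟩

/-- The one-point space is the only point `p` of the Gromov–Hausdorff space such that
`dist q q' ≤ max (dist q p) (dist q' p)` for all `q` and `q'`. -/
theorem eq_onePointGH_iff (p : GHSpace) :
    p = onePointGH ↔ ∀ q q' : GHSpace, dist q q' ≤ max (dist q p) (dist q' p) := by
  constructor
  · rintro rfl q q'
    rw [← q.toGHSpace_rep, ← q'.toGHSpace_rep]
    set a := dist (toGHSpace q.Rep) onePointGH with ha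
    set b := dist (toGHSpace q'.Rep) onePointGH with hb
    have h1 : ∀ x y : q.Rep, dist x y ≤ 2 * a := dist_onePointGH_le_iff.1 (by linarith)
    have h2 : ∀ x y : q'.Rep, dist x y ≤ 2 * b := dist_onePointGH_le_iff.1 (by linarith)
    have h3 : dist (toGHSpace q.Rep) (toGHSpace q'.Rep) ≤ (2 * max a b) / 2 := by
      refine dist_toGHSpace_le_of_correspondence (fun _ _ => True)
        (fun _ => ⟨Classical.arbitrary _, trivial⟩) (fun _ => ⟨Classical.arbitrary _, trivial⟩)
        fun x y x' y' _ _ => ?_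
      have hx := h1 x x'
      have hy := h2 y y'
      have hx0 : 0 ≤ dist x x' := dist_nonneg
      have hy0 : 0 ≤ dist y y' := dist_nonneg
      have := le_max_left a b
      have := le_max_right a b
      rw [abs_le]
      constructor <;> linarith
    linarith
  · intro h
    by_contra hne
    have hpos : 0 < dist p onePointGH := dist_pos.2 hne
    rw [← p.toGHSpace_rep] at h hpos
    set a := dist (toGHSpace p.Rep) onePointGH with ha
    have hda : ∀ x y : p.Rep, dist x y ≤ 2 * a := dist_onePointGH_le_iff.1 (by linarith)
    obtain ⟨W, _, _, _, e, hd⟩ :=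
      exists_truncation p.Rep (s := 4 * a) (C := 2) (by linarith) two_pos
    have hd' : ∀ x y, dist (e x) (e y) = 2 * dist x y := fun x y => by
      rw [hd, min_eq_right]
      linarith [hda x y]
    have hW : dist (toGHSpace p.Rep) (toGHSpace W) ≤ 2 * a / 2 := by
      refine dist_toGHSpace_le_of_correspondence (fun x w => e x = w) (fun x => ⟨_, rfl⟩)
        e.surjective ?_
      rintro x _ x' _ rfl rfl
      rw [hd', abs_le]
      have h0 : 0 ≤ dist x x' := dist_nonneg
      constructor <;> linarith [hda x x']
    have hmax : dist (toGHSpace W) onePointGH ≤ (2 * a) / 2 := by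
      refine (h _ _).trans (max_le ?_ ?_)
      · rwa [dist_comm]
      · rw [dist_comm, ← ha]
        linarith
    have hhalf : dist (toGHSpace p.Rep) onePointGH ≤ a / 2 := by
      refine dist_onePointGH_le_iff.2 fun x y => ?_
      have := dist_onePointGH_le_iff.1 hmax (e x) (e y)
      rw [hd'] at this
      linarith
    linarith

theorem IsometryEquiv.map_onePointGH (f : GHSpace ≃ᵢ GHSpace) : f onePointGH = onePointGH := by
  rw [eq_onePointGH_iff]
  intro q q'
  have h := (eq_onePointGH_iff onePointGH).1 rfl (f.symm q) (f.symm q')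
  rw [← f.dist_eq, ← f.dist_eq (f.symm q), ← f.dist_eq (f.symm q')] at h
  simpa using h

theorem IsometryEquiv.dist_map_onePointGH (f : GHSpace ≃ᵢ GHSpace) (p : GHSpace) :
    dist (f p) onePointGH = dist p onePointGH := by
  conv_lhs => rw [← f.map_onePointGH]
  exact f.dist_eq _ _

/-- `p` has diameter at most `t`, and any two spaces of diameter at most `t` that are at distance
less than `t / 2` from `p` are at distance less than `t / 2` from each other. -/
def HasCliqueNeighborhood (t : ℝ) (p : GHSpace) : Prop :=
  dist p onePointGH ≤ t / 2 ∧ ∀ q q' : GHSpace, dist q onePointGH ≤ t / 2 →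
    dist q' onePointGH ≤ t / 2 → dist q p < t / 2 → dist q' p < t / 2 → dist q q' < t / 2

theorem HasCliqueNeighborhood.map {t : ℝ} {p : GHSpace} (h : HasCliqueNeighborhood t p)
    (f : GHSpace ≃ᵢ GHSpace) : HasCliqueNeighborhood t (f p) := by
  refine ⟨by rw [f.dist_map_onePointGH]; exact h.1, fun q q' hq hq' hp hp' => ?_⟩
  rw [← f.symm.dist_eq] at hp hp' ⊢
  rw [← f.symm.dist_map_onePointGH] at hq hq'
  rw [f.symm_apply_apply] at hp hp'
  exact h.2 _ _ hq hq' hp hp'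

theorem simplexGH_hasCliqueNeighborhood (n : ℕ) (hn : 0 < n) (t : ℝ) (ht : 0 < t) :
    HasCliqueNeighborhood t (simplexGH n hn t ht) := by
  refine ⟨?_, fun q q' hq hq' hp hp' => ?_⟩
  · obtain ⟨S, _, _, _, e, hS, hd⟩ := exists_simplex_model n hn t ht
    rw [← hS, dist_onePointGH_le_iff]
    intro x y
    rw [hd]
    split_ifs <;> linarith
  rw [← q.toGHSpace_rep] at hq hp ⊢
  rw [← q'.toGHSpace_rep] at hq' hp' ⊢
  rw [dist_onePointGH_le_iff] at hq hq'
  obtain ⟨g, r, hr, hg, H⟩ := exists_partition_of_dist_simplexGH_lt hp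
  obtain ⟨g', r', hr', hg', H'⟩ := exists_partition_of_dist_simplexGH_lt hp'
  refine (dist_toGHSpace_le_of_correspondence (r := max r r') (fun x y => g x = g' y)
    (fun x => ?_) (fun y => hg (g' y)) fun x y x' y' h h' => ?_).trans_lt ?_
  · obtain ⟨y, hy⟩ := hg' (g x)
    exact ⟨y, hy.symm⟩
  · have h1 := H x x'
    have h2 := H' y y'
    rw [← h, ← h'] at h2
    have hx := hq x x'
    have hy := hq' y y'
    have hx0 : 0 ≤ dist x x' := dist_nonneg
    have hy0 : 0 ≤ dist y y' := dist_nonneg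
    have := le_max_left r r'
    have := le_max_right r r'
    rw [abs_le] at h1 h2 ⊢
    split_ifs at h1 h2 <;> constructor <;> linarith
  · have := max_lt hr hr'
    linarith

/-- A compact space of diameter at most `t` that is not a simplex with edge `t` has a partition
into pieces of diameter less than `t` with fewer pieces than the space has points. -/
theorem exists_coarse_partition {X : Type*} [MetricSpace X] [CompactSpace X] [Nonempty X]
    {t : ℝ} (ht : 0 < t) (hX : ∀ x y : X, dist x y ≤ t)
    (hne : ∀ (n : ℕ) (hn : 0 < n), toGHSpace X ≠ simplexGH n hn t ht) :
    ∃ (g : X → X) (r : ℝ) (F : Finset X), r < t ∧ (range g).Finite ∧ (range g).ncard < F.card ∧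
      ∀ x y, g x = g y → dist x y ≤ r := by
  classical
  rcases finite_or_infinite X with hfin | hinf
  · have := Fintype.ofFinite X
    obtain ⟨a, b, hab, hlt⟩ : ∃ a b : X, a ≠ b ∧ dist a b < t := by
      by_contra! hcon
      refine hne (Fintype.card X) Fintype.card_pos ?_
      have hle : dist (toGHSpace X) (simplexGH (Fintype.card X) Fintype.card_pos t ht) ≤ 0 / 2 := by
        refine dist_simplexGH_le (Fintype.equivFin X) (Fintype.equivFin X).surjective
          fun x y => ?_
        by_cases hxy : x = y
        · simp [hxy]
        · simp [hxy, le_antisymm (hX x y) (hcon x y hxy)]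
      exact dist_le_zero.1 (by linarith)
    refine ⟨Function.update id b a, dist a b, Finset.univ, hlt, toFinite _, ?_, fun x y h => ?_⟩
    · rw [Finset.card_univ, ← Nat.card_eq_fintype_card, ← ncard_univ]
      refine ncard_lt_ncard (ssubset_univ_iff.2 fun hu => ?_)
      obtain ⟨x, hx⟩ : b ∈ range (Function.update id b a) := hu ▸ mem_univ b
      by_cases hxb : x = b
      · subst hxb; simp at hx; exact hab hx
      · simp [hxb] at hx
    · by_cases hxb : x = b <;> by_cases hyb : y = b <;>
        simp_all [dist_comm]
  · obtain ⟨s, -, hsf, hs⟩ := (isCompact_univ (X := X)).finite_cover_balls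
      (e := t / 3) (by linarith)
    have hcov : ∀ x : X, ∃ c ∈ s, dist x c < t / 3 := fun x => by
      simpa using hs (mem_univ x)
    choose g hgs hg using hcov
    have hgr : (range g).Finite := hsf.subset (range_subset_iff.2 hgs)
    obtain ⟨F, hF⟩ := Infinite.exists_subset_card_eq X ((range g).ncard + 1)
    refine ⟨g, 2 * t / 3, F, by linarith, hgr, by omega, fun x y h => ?_⟩
    have := dist_triangle_right x y (g x)
    have h1 := hg x
    have h2 := hg y
    rw [← h] at h2
    linarith

theorem exists_eq_simplexGH_of_hasCliqueNeighborhood {t : ℝ} (ht : 0 < t) {p : GHSpace}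
    (hp : HasCliqueNeighborhood t p) : ∃ (n : ℕ) (hn : 0 < n), p = simplexGH n hn t ht := by
  classical
  by_contra! hne
  rw [← p.toGHSpace_rep] at hp hne
  have hX := dist_onePointGH_le_iff.1 hp.1
  obtain ⟨g, r, F, hr, hfin, hF, hg⟩ := exists_coarse_partition ht hX hne
  have := hfin.to_subtype
  obtain ⟨S, _, _, _, e, -, hd⟩ := exists_simplex_model (range g).ncard
    ((ncard_pos hfin).2 (range_nonempty g)) (t / 2) (by linarith)
  let ι : range g ≃ Fin (range g).ncard := Finite.equivFinOfCardEq (Nat.card_coe_set_eq _)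
  have hS : dist (toGHSpace p.Rep) (toGHSpace S) < t / 2 := by
    refine (dist_toGHSpace_le_of_correspondence (r := max r (t / 2))
      (fun x a => ι ⟨g x, mem_range_self x⟩ = e a) (fun x => ⟨e.symm (ι ⟨g x, mem_range_self x⟩), by simp⟩)
      (fun a => ?_) fun x a y b hxa hyb => ?_).trans_lt ?_
    · obtain ⟨⟨_, x, rfl⟩, hx⟩ := ι.surjective (e a)
      exact ⟨x, hx⟩
    · rw [hd, ← hxa, ← hyb]
      have h0 : 0 ≤ dist x y := dist_nonneg
      have := hX x y
      have := le_max_left r (t / 2)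
      have := le_max_right r (t / 2)
      rw [abs_le]
      split_ifs with h
      · have := hg x y (by simpa using h)
        constructor <;> linarith
      · constructor <;> linarith
    · have := max_lt hr (half_lt_self ht)
      linarith
  obtain ⟨M, hM⟩ := (F.offDiag.image fun z => t / dist z.1 z.2).exists_le
  let C := max 1 M
  have hC1 : 1 ≤ C := le_max_left _ _
  have hC0 : 0 < C := by linarith
  obtain ⟨W, _, _, _, w, hw⟩ := exists_truncation p.Rep ht hC0
  have hCu : C * (t / C) = t := mul_div_cancel₀ t hC0.ne'
  have hW : dist (toGHSpace p.Rep) (toGHSpace W) < t / 2 := by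
    refine (dist_toGHSpace_le_of_correspondence (r := t - t / C) (fun x a => w x = a)
      (fun x => ⟨_, rfl⟩) w.surjective ?_).trans_lt ?_
    · rintro x _ y _ rfl rfl
      have h0 : 0 ≤ dist x y := dist_nonneg
      have h1 := hX x y
      have h2 : dist x y ≤ C * dist x y := le_mul_of_one_le_left h0 hC1
      have h3 : dist x y ≤ min t (C * dist x y) := le_min h1 h2
      have h4 : min t (C * dist x y) - dist x y ≤ t - t / C := by
        rcases le_total (dist x y) (t / C) with h | h
        · have := min_le_right t (C * dist x y)
          nlinarith
        · have := min_le_left t (C * dist x y)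
          linarith
      rw [hw, abs_le]
      constructor <;> linarith
    · have : 0 < t / C := by positivity
      linarith
  have hfar : dist (toGHSpace W) (toGHSpace S) < t / 2 := by
    refine hp.2 _ _ (dist_onePointGH_le_iff.2 fun a b => ?_)
      (dist_onePointGH_le_iff.2 fun a b => ?_) (by rwa [dist_comm]) (by rwa [dist_comm])
    · rw [← w.apply_symm_apply a, ← w.apply_symm_apply b, hw]
      exact min_le_left _ _
    · rw [hd]
      split_ifs <;> linarith
  obtain ⟨R, r', hr', hl, -, H⟩ := exists_correspondence_of_dist_toGHSpace_lt hfar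
  choose φ hφ using hl
  obtain ⟨x, hx, y, hy, hxy, heq⟩ := Finset.exists_ne_map_eq_of_card_lt_of_maps_to
    (s := F) (t := Finset.univ) (f := fun x => e (φ (w x))) (by simpa using hF) (by simp)
  have hxyd : t ≤ C * dist x y := by
    rw [← div_le_iff₀ (dist_pos.2 hxy)]
    exact (hM _ (Finset.mem_image.2 ⟨(x, y), by simp [hx, hy, hxy], rfl⟩)).trans
      (le_max_right _ _)
  have hdist := H _ _ _ _ (hφ (w x)) (hφ (w y))
  rw [hd, if_pos heq, hw, min_eq_left hxyd, sub_zero, abs_of_pos ht] at hdist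
  linarith

/-- Among spaces of diameter less than `t`, those close to `tΔ_n` are close to `tΔ_m` for every
`m ≤ n`, and only for these `m`. -/
theorem le_iff_forall_dist_simplexGH_lt {m n : ℕ} (hm : 0 < m) (hn : 0 < n) {t : ℝ} (ht : 0 < t) :
    m ≤ n ↔ ∀ q : GHSpace, dist q onePointGH < t / 2 → dist q (simplexGH n hn t ht) < t / 2 →
      dist q (simplexGH m hm t ht) < t / 2 := by
  constructor
  · intro hmn q hq hqn
    rw [← q.toGHSpace_rep] at hq hqn ⊢
    obtain ⟨s, hs, hqs⟩ := dist_onePointGH_lt_iff.1 hq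
    obtain ⟨g, r, hr, hg, H⟩ := exists_partition_of_dist_simplexGH_lt hqn
    let c : Fin n → Fin m := fun i => ⟨min i (m - 1), by omega⟩
    have hc : c.Surjective := fun j => ⟨⟨j, by omega⟩, Fin.ext (by simp [c]; omega)⟩
    refine (dist_simplexGH_le (r := max r s) (c ∘ g) (hc.comp hg) fun x y => ?_).trans_lt ?_
    · have h1 := H x y
      have h2 := hqs x y
      have h0 : 0 ≤ dist x y := dist_nonneg
      have := le_max_left r s
      have := le_max_right r s
      have hcg : g x = g y → (c ∘ g) x = (c ∘ g) y := fun h => by simp [h]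
      rw [abs_le] at h1 ⊢
      split_ifs at h1 ⊢ <;> first | (constructor <;> linarith) | tauto
    · have := max_lt hr hs
      linarith
  · intro h
    obtain ⟨S, _, _, _, e, hS, hd⟩ := exists_simplex_model n hn (t / 2) (by linarith)
    have hlt := h (toGHSpace S)
      (dist_onePointGH_lt_iff.2 ⟨t / 2, by linarith, fun x y => by
        rw [hd]; split_ifs <;> linarith⟩)
      ((dist_simplexGH_le (r := t / 2) e e.surjective fun x y => by
        rw [hd, abs_le]; split_ifs <;> constructor <;> linarith).trans_lt (by linarith))
    obtain ⟨g, r, -, hg, -⟩ := exists_partition_of_dist_simplexGH_lt hlt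
    simpa using Fintype.card_le_of_surjective _ (hg.comp e.symm.surjective)

theorem exists_map_simplexGH (f : GHSpace ≃ᵢ GHSpace) {t : ℝ} (ht : 0 < t) (n : ℕ) (hn : 0 < n) :
    ∃ (m : ℕ) (hm : 0 < m), f (simplexGH n hn t ht) = simplexGH m hm t ht :=
  exists_eq_simplexGH_of_hasCliqueNeighborhood ht
    ((simplexGH_hasCliqueNeighborhood n hn t ht).map f)

theorem le_of_map_simplexGH_eq (f : GHSpace ≃ᵢ GHSpace) {t : ℝ} (ht : 0 < t) {n m : ℕ}
    (hn : 0 < n) (hm : 0 < m) (h : f (simplexGH n hn t ht) = simplexGH m hm t ht) : n ≤ m := by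
  have hex : ∀ k : ℕ, ∃ l : ℕ, f (simplexGH (k + 1) k.succ_pos t ht) =
      simplexGH (l + 1) l.succ_pos t ht := fun k => by
    obtain ⟨l, hl, hkl⟩ := exists_map_simplexGH f ht (k + 1) k.succ_pos
    obtain ⟨l, rfl⟩ := Nat.exists_eq_succ_of_ne_zero hl.ne'
    exact ⟨l, hkl⟩
  choose σ hσ using hex
  have hmono : ∀ k l, σ k ≤ σ l → k ≤ l := fun k l hkl => by
    have H := (le_iff_forall_dist_simplexGH_lt (σ k).succ_pos (σ l).succ_pos ht).1
      (Nat.succ_le_succ hkl)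
    refine Nat.succ_le_succ_iff.1
      ((le_iff_forall_dist_simplexGH_lt k.succ_pos l.succ_pos ht).2 fun q hq hql => ?_)
    rw [← f.dist_eq, hσ]
    refine H (f q) (by rwa [f.dist_map_onePointGH]) ?_
    rw [← hσ, f.dist_eq]
    exact hql
  have hstrict : StrictMono σ := fun k l hkl => by
    by_contra hle
    exact absurd (hmono l k (not_lt.1 hle)) (not_le.2 hkl)
  obtain ⟨k, rfl⟩ := Nat.exists_eq_succ_of_ne_zero hn.ne'
  have heq : simplexGH (σ k + 1) (σ k).succ_pos t ht = simplexGH m hm t ht := (hσ k).symm.trans h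
  have hle : σ k + 1 ≤ m :=
    (le_iff_forall_dist_simplexGH_lt (σ k).succ_pos hm ht).2 fun q _ hq => by rwa [heq]
  exact (Nat.succ_le_succ hstrict.le_apply).trans hle

/-- Every surjective isometry of the Gromov–Hausdorff space fixes every simplex `tΔ_n`,
`n ≥ 2`, `t > 0`. -/
theorem ghspace_isometry_fixes_simplexes
    (f : GromovHausdorff.GHSpace ≃ᵢ GromovHausdorff.GHSpace)
    (n : ℕ) (hn : 2 ≤ n) (t : ℝ) (ht : 0 < t) :
    f (simplexGH n (by omega) t ht) = simplexGH n (by omega) t ht := by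
  obtain ⟨m, hm, h⟩ := exists_map_simplexGH f ht n (by omega)
  have hnm : n = m := le_antisymm (le_of_map_simplexGH_eq f ht _ _ h)
    (le_of_map_simplexGH_eq f.symm ht _ _ (by rw [← h, f.symm_apply_apply]))
  subst hnm
  exact h
end
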